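/- Let $0<\mu<1$, $c>1$, $C>0$ and $D\ge 2$ be fixed. Then for all sufficiently large $X$ and all real $t$ with $|t|\le X^{-c}(\log X)^{D}$, one has $\sum_{1<q\le (\log X)^{C}}\frac{1}{\varphi(q)}\sum^{*}_{\chi\ (\mathrm{mod}\ q)}\Big|\sum_{\mu X<n\le X}\Lambda(n)\chi(n)e(tn^{c})\Big|\ll \frac{X}{e^{(\log X)^{1/4}}}$, with the implied constant depending only on $\mu,c,C,D$. -/

import Mathlib

open Finset
open scoped Classical

/-- `e(x) = e^{2πix}`. -/
noncomputable def e (x : ℝ) : ℂ := Complex.exp (2 * Real.pi * Complex.I * x)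

namespace SiegelWalfisz

open Metric Complex in
/-- A nonvanishing entire function on a disc has a holomorphic logarithm there. -/
lemma exists_log_on_ball {f : ℂ → ℂ} (hf : Differentiable ℂ f) {r : ℝ} (hr : 0 < r)
    (h0 : ∀ z ∈ ball (0 : ℂ) r, f z ≠ 0) :
    ∃ h : ℂ → ℂ, (∀ z ∈ ball (0 : ℂ) r, HasDerivAt h (deriv f z / f z) z) ∧ h 0 = 0 ∧
      ∀ z ∈ ball (0 : ℂ) r, f z = f 0 * exp (h z) := by
  have hd : Differentiable ℂ (deriv f) := by
    have := hf.contDiff (n := 2)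
    exact (this.differentiable_deriv_two)
  have hq : DifferentiableOn ℂ (fun z => deriv f z / f z) (ball 0 r) :=
    hd.differentiableOn.div hf.differentiableOn h0
  obtain ⟨h, hh⟩ := hq.isExactOn_ball
  have hmem : (0 : ℂ) ∈ ball (0 : ℂ) r := mem_ball_self hr
  refine ⟨fun z => h z - h 0, fun z hz => (hh z hz).sub_const _, by simp, fun z hz => ?_⟩
  have hder : ∀ w ∈ ball (0 : ℂ) r, HasDerivAt (fun w => f w * exp (-(h w - h 0))) 0 w := by
    intro w hw
    have hw' : HasDerivAt h (deriv f w / f w) w := hh w hw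
    refine ((hf w).hasDerivAt.mul (((hw'.sub_const (h 0)).fun_neg).cexp)).congr_deriv ?_
    have := h0 w hw
    field_simp
    ring
  have hc := (convex_ball (0 : ℂ) r).is_const_of_fderivWithin_eq_zero (𝕜 := ℂ)
    (f := fun w => f w * exp (-(h w - h 0)))
    (fun w hw => (hder w hw).differentiableAt.differentiableWithinAt)
    (fun w hw => by
      rw [fderivWithin_of_isOpen isOpen_ball hw]
      rw [(hder w hw).hasFDerivAt.fderiv]
      ext; simp) hz hmem
  simp only [sub_self, neg_zero, exp_zero, mul_one] at hc
  rw [← hc, mul_assoc, ← exp_add]; simp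

open Metric Complex in
/-- Logarithmic derivative of an entire function which is nonvanishing on a disc. -/
lemma norm_logDeriv_le_of_ne_zero {f : ℂ → ℂ} (hf : Differentiable ℂ f) {r M : ℝ} (hr : 0 < r)
    (hM : 0 < M) (h0 : ∀ z ∈ ball (0 : ℂ) r, f z ≠ 0)
    (hb : ∀ z ∈ ball (0 : ℂ) r, ‖f z‖ ≤ Real.exp M * ‖f 0‖) {z : ℂ} (hz : ‖z‖ < r) :
    ‖deriv f z / f z‖ ≤ 8 * M * r / (r - ‖z‖) ^ 2 := by
  obtain ⟨h, hd, hh0, hexp⟩ := exists_log_on_ball hf hr h0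
  have hmem : (0 : ℂ) ∈ ball (0 : ℂ) r := mem_ball_self hr
  have hf0 : 0 < ‖f 0‖ := norm_pos_iff.mpr (h0 0 hmem)
  have hre : Set.MapsTo h (ball 0 r) {z | z.re ≤ M} := by
    intro w hw
    have h1 := hb w hw
    rw [hexp w hw, norm_mul, mul_comm, norm_exp] at h1
    exact Real.exp_le_exp.mp (le_of_mul_le_mul_right h1 hf0)
  have hdo : DifferentiableOn ℂ h (ball 0 r) :=
    fun w hw => (hd w hw).differentiableAt.differentiableWithinAt
  have hz0 : 0 ≤ ‖z‖ := norm_nonneg z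
  have hρ : 0 < (r - ‖z‖) / 2 := by linarith
  have hsub : closedBall z ((r - ‖z‖) / 2) ⊆ ball 0 r := by
    intro w hw
    rw [mem_closedBall, dist_eq_norm] at hw
    rw [mem_ball_zero_iff]
    have := norm_add_le (w - z) z
    rw [sub_add_cancel] at this
    linarith
  have key := norm_deriv_le_of_forall_mem_sphere_norm_le (f := h) (c := z)
    (C := 4 * M * r / (r - ‖z‖)) hρ
    (hdo.diffContOnCl_ball hsub) ?_
  · rw [(hd z (by rwa [mem_ball_zero_iff])).deriv] at key
    refine key.trans (le_of_eq ?_)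
    field_simp
    ring
  · intro w hw
    have hwm := hsub (sphere_subset_closedBall hw)
    have hb := borelCaratheodory_zero hM hdo hre hr hwm hh0
    rw [mem_sphere, dist_eq_norm] at hw
    have hwn : ‖w‖ ≤ (r + ‖z‖) / 2 := by
      have := norm_add_le (w - z) z
      rw [sub_add_cancel] at this
      linarith
    refine hb.trans ?_
    have h1 : 0 < r - ‖z‖ := by linarith
    have h2 : (r - ‖z‖) / 2 ≤ r - ‖w‖ := by linarith
    calc 2 * M * ‖w‖ / (r - ‖w‖) ≤ 2 * M * r / ((r - ‖z‖) / 2) := by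
          gcongr; linarith
      _ = 4 * M * r / (r - ‖z‖) := by field_simp; ring

open Metric Complex in
/-- Removing a zero of an entire function by means of a Blaschke factor. -/
lemma exists_remove_zero {f : ℂ → ℂ} (hf : Differentiable ℂ f) {R M : ℝ} (hR : 0 < R)
    (hf0 : f 0 ≠ 0) (hb : ∀ z, ‖z‖ ≤ R → ‖f z‖ ≤ Real.exp M * ‖f 0‖)
    (hre : ∀ z, ‖z‖ < R / 2 → f z = 0 → z.re ≤ 0)
    {ρ : ℂ} (hρ : ‖ρ‖ < R / 2) (hfρ : f ρ = 0) :
    ∃ g : ℂ → ℂ, Differentiable ℂ g ∧ g 0 ≠ 0 ∧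
      (∀ z, ‖z‖ ≤ R → ‖g z‖ ≤ Real.exp (M - Real.log 2) * ‖g 0‖) ∧
      (∀ z, ‖z‖ < R / 2 → g z = 0 → z.re ≤ 0) ∧
      (deriv f 0 / f 0).re =
        (deriv g 0 / g 0).re + ρ.re * (1 / R ^ 2 - 1 / ‖ρ‖ ^ 2) := by
  have hρ0 : ρ ≠ 0 := by rintro rfl; exact hf0 hfρ
  have hρn : 0 < ‖ρ‖ := norm_pos_iff.mpr hρ0
  have hRc : (R : ℂ) ≠ 0 := by exact_mod_cast hR.ne'
  set g : ℂ → ℂ := fun z => dslope f ρ z * ((R ^ 2 - (starRingEnd ℂ) ρ * z) / R) with hg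
  have hds : Differentiable ℂ (dslope f ρ) := by
    rw [← differentiableOn_univ, differentiableOn_dslope Filter.univ_mem, differentiableOn_univ]
    exact hf
  have hgd : Differentiable ℂ g := by fun_prop
  have hgne : ∀ z, z ≠ ρ → g z = f z * ((R ^ 2 - (starRingEnd ℂ) ρ * z) / (R * (z - ρ))) := by
    intro z hz
    have : z - ρ ≠ 0 := sub_ne_zero.mpr hz
    simp only [hg, dslope_of_ne f hz, slope_def_field, hfρ, sub_zero]
    field_simp
  have hg0 : g 0 = f 0 * (-(R / ρ)) := by
    rw [hgne 0 hρ0.symm]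
    congr 1
    simp only [mul_zero, sub_zero, zero_sub]
    field_simp
  have hg0n : ‖g 0‖ = ‖f 0‖ * (R / ‖ρ‖) := by
    rw [hg0, norm_mul, norm_neg, norm_div, Complex.norm_real, Real.norm_of_nonneg hR.le]
  refine ⟨g, hgd, ?_, ?_, ?_, ?_⟩
  · rw [hg0]
    exact mul_ne_zero hf0 (neg_ne_zero.mpr (div_ne_zero hRc hρ0))
  · have hs : ∀ z ∈ frontier (ball (0 : ℂ) R), ‖g z‖ ≤ Real.exp M * ‖f 0‖ := by
      intro z hz
      rw [frontier_ball _ hR.ne'] at hz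
      have hzn : ‖z‖ = R := by simpa using hz
      have hzρ : z ≠ ρ := by rintro rfl; linarith
      have := norm_canonicalFactor_eval_circle_eq_one (R := R) (w := ρ) (z := z)
        (by rw [mem_ball_zero_iff]; linarith) hz
      rw [canonicalFactor_apply] at this
      rw [hgne z hzρ, norm_mul, this, mul_one]
      exact hb z hzn.le
    intro z hz
    have h1 := norm_le_of_forall_mem_frontier_norm_le isBounded_ball hgd.diffContOnCl hs
      (z := z) (by rw [closure_ball _ hR.ne']; simpa using hz)
    refine h1.trans ?_
    rw [Real.exp_sub, Real.exp_log two_pos, hg0n]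
    have h2 : 2 ≤ R / ‖ρ‖ := by rw [le_div_iff₀ hρn]; linarith
    have h3 : 0 ≤ Real.exp M * ‖f 0‖ := by positivity
    calc Real.exp M * ‖f 0‖ = Real.exp M * ‖f 0‖ * 2 / 2 := by ring
      _ ≤ Real.exp M * ‖f 0‖ * (R / ‖ρ‖) / 2 := by gcongr
      _ = _ := by ring
  · intro z hz hgz
    by_cases hzρ : z = ρ
    · rw [hzρ]; exact hre ρ hρ hfρ
    · rw [hgne z hzρ] at hgz
      have hc := canonicalFactor_ne_zero (R := R) (w := ρ) (z := z)
        (by rw [mem_ball_zero_iff]; linarith) (by rw [mem_closedBall_zero_iff]; linarith) hzρ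
      rw [canonicalFactor_apply] at hc
      exact hre z hz ((mul_eq_zero.mp hgz).resolve_right hc)
  · have hev : g =ᶠ[nhds 0] fun z => f z * ((R ^ 2 - (starRingEnd ℂ) ρ * z) / (R * (z - ρ))) := by
      filter_upwards [isOpen_ne.mem_nhds hρ0.symm] with z hz using hgne z hz
    have hnum : HasDerivAt (fun z : ℂ => (R : ℂ) ^ 2 - (starRingEnd ℂ) ρ * z)
        (-((starRingEnd ℂ) ρ)) 0 := by
      simpa using ((hasDerivAt_id (0 : ℂ)).const_mul ((starRingEnd ℂ) ρ)).const_sub ((R : ℂ) ^ 2)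
    have hden : HasDerivAt (fun z : ℂ => (R : ℂ) * (z - ρ)) R 0 := by
      simpa using ((hasDerivAt_id (0 : ℂ)).sub_const ρ).const_mul (R : ℂ)
    have hprod := (hf 0).hasDerivAt.mul (hnum.div hden (by simp [hRc, hρ0]))
    have hdg : deriv g 0 = _ := hev.deriv_eq.trans hprod.deriv
    have heq : deriv f 0 / f 0 =
        deriv g 0 / g 0 + ((starRingEnd ℂ) ρ / (R : ℂ) ^ 2 - ρ⁻¹) := by
      rw [hdg, hg0]
      simp only [Pi.div_apply, mul_zero, sub_zero, zero_sub]
      field_simp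
      ring
    rw [heq, add_re, sub_re]
    congr 1
    have e1 : ((starRingEnd ℂ) ρ / (R : ℂ) ^ 2).re = ρ.re / R ^ 2 := by
      rw [← ofReal_pow, div_ofReal_re, conj_re]
    rw [e1, inv_re, normSq_eq_norm_sq]
    ring

lemma exists_remove_zero_term_nonneg {R : ℝ} {ρ : ℂ} (hρ0 : ρ ≠ 0) (hρ : ‖ρ‖ < R / 2)
    (hre : ρ.re ≤ 0) : 0 ≤ ρ.re * (1 / R ^ 2 - 1 / ‖ρ‖ ^ 2) := by
  have h1 : 0 < ‖ρ‖ := norm_pos_iff.mpr hρ0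
  refine mul_nonneg_of_nonpos_of_nonpos hre ?_
  rw [sub_nonpos]
  apply one_div_le_one_div_of_le (by positivity)
  apply pow_le_pow_left₀ h1.le
  linarith

open Metric Complex in
/-- Lower bound for the logarithmic derivative of an entire function at the centre of a disc, when
no zero in the half disc lies to the right of the centre. -/
lemma re_logDeriv_ge_aux {R K : ℝ} (hR : 0 < R) (hK : 0 < K) (n : ℕ) : ∀ (f : ℂ → ℂ) (M : ℝ),
    Differentiable ℂ f → f 0 ≠ 0 → M ≤ K → M ≤ n * Real.log 2 →
    (∀ z, ‖z‖ ≤ R → ‖f z‖ ≤ Real.exp M * ‖f 0‖) →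
    (∀ z, ‖z‖ < R / 2 → f z = 0 → z.re ≤ 0) →
    -(16 * K / R) ≤ (deriv f 0 / f 0).re := by
  induction n with
  | zero =>
    intro f M hf hf0 hMK hMn hb hre
    by_cases hz : ∃ ρ : ℂ, ‖ρ‖ < R / 2 ∧ f ρ = 0
    · obtain ⟨ρ, hρ, hfρ⟩ := hz
      obtain ⟨g, -, hg0, hgb, -⟩ := exists_remove_zero hf hR hf0 hb hre hρ hfρ
      have := hgb 0 (by simpa using hR.le)
      have h2 : Real.exp (M - Real.log 2) < 1 := by
        rw [Real.exp_lt_one_iff]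
        have := Real.log_pos one_lt_two
        simp at hMn
        linarith
      have h3 : 0 < ‖g 0‖ := norm_pos_iff.mpr hg0
      nlinarith
    · push Not at hz
      have := norm_logDeriv_le_of_ne_zero hf (r := R / 2) (by positivity) hK
        (fun z hz' => hz z (by simpa using hz'))
        (fun z hz' => (hb z (by rw [mem_ball_zero_iff] at hz'; linarith)).trans (by gcongr))
        (z := 0) (by simpa using hR)
      have h2 := neg_le_of_abs_le ((abs_re_le_norm _).trans this)
      refine le_trans (le_of_eq ?_) h2
      simp only [norm_zero, sub_zero]
      field_simp
      norm_num
  | succ n ih =>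
    intro f M hf hf0 hMK hMn hb hre
    by_cases hz : ∃ ρ : ℂ, ‖ρ‖ < R / 2 ∧ f ρ = 0
    · obtain ⟨ρ, hρ, hfρ⟩ := hz
      obtain ⟨g, hgd, hg0, hgb, hgre, heq⟩ := exists_remove_zero hf hR hf0 hb hre hρ hfρ
      have hρ0 : ρ ≠ 0 := by rintro rfl; exact hf0 hfρ
      have h1 := exists_remove_zero_term_nonneg hρ0 hρ (hre ρ hρ hfρ)
      have hl := Real.log_pos one_lt_two
      have h2 := ih g (M - Real.log 2) hgd hg0 (by linarith)
        (by push_cast at hMn; linarith) hgb hgre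
      rw [heq]; linarith
    · push Not at hz
      have := norm_logDeriv_le_of_ne_zero hf (r := R / 2) (by positivity) hK
        (fun z hz' => hz z (by simpa using hz'))
        (fun z hz' => (hb z (by rw [mem_ball_zero_iff] at hz'; linarith)).trans (by gcongr))
        (z := 0) (by simpa using hR)
      have h2 := neg_le_of_abs_le ((abs_re_le_norm _).trans this)
      refine le_trans (le_of_eq ?_) h2
      simp only [norm_zero, sub_zero]
      field_simp
      norm_num

lemma re_logDeriv_ge_zero {R M : ℝ} (hR : 0 < R) (hM : 0 < M) {f : ℂ → ℂ}
    (hf : Differentiable ℂ f) (hf0 : f 0 ≠ 0)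
    (hb : ∀ z, ‖z‖ ≤ R → ‖f z‖ ≤ Real.exp M * ‖f 0‖)
    (hre : ∀ z, ‖z‖ < R / 2 → f z = 0 → z.re ≤ 0) :
    -(16 * M / R) ≤ (deriv f 0 / f 0).re := by
  obtain ⟨n, hn⟩ := exists_nat_ge (M / Real.log 2)
  rw [div_le_iff₀ (Real.log_pos one_lt_two)] at hn
  exact re_logDeriv_ge_aux hR hM n f M hf hf0 le_rfl hn hb hre

/-- Lower bound for the logarithmic derivative at `c` of an entire function all of whose zeros
near `c` lie in the half plane to the left of `c`. -/
lemma re_logDeriv_ge {R M : ℝ} (hR : 0 < R) (hM : 0 < M) {f : ℂ → ℂ} {c : ℂ}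
    (hf : Differentiable ℂ f) (hf0 : f c ≠ 0)
    (hb : ∀ z, ‖z - c‖ ≤ R → ‖f z‖ ≤ Real.exp M * ‖f c‖)
    (hre : ∀ z, ‖z - c‖ < R / 2 → f z = 0 → z.re ≤ c.re) :
    -(16 * M / R) ≤ (deriv f c / f c).re := by
  have := re_logDeriv_ge_zero hR hM (f := fun z => f (z + c)) (by fun_prop) (by simpa using hf0)
    (fun z hz => by simpa using hb (z + c) (by simpa using hz))
    (fun z hz h0 => by simpa using hre (z + c) (by simpa using hz) h0)
  simpa [deriv_comp_add_const] using this

/-- Same as `re_logDeriv_ge`, taking into account the contribution of one zero to the left of the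
centre. -/
lemma re_logDeriv_ge_of_zero {R M : ℝ} (hR : 0 < R) (hM : 0 < M) {f : ℂ → ℂ} {c : ℂ}
    (hf : Differentiable ℂ f) (hf0 : f c ≠ 0)
    (hb : ∀ z, ‖z - c‖ ≤ R → ‖f z‖ ≤ Real.exp M * ‖f c‖)
    (hre : ∀ z, ‖z - c‖ < R / 2 → f z = 0 → z.re ≤ c.re)
    {a : ℝ} (ha : 0 < a) (haR : a < R / 2) (hfa : f (c - a) = 0) :
    1 / a - a / R ^ 2 - 16 * M / R ≤ (deriv f c / f c).re := by
  set F : ℂ → ℂ := fun z => f (z + c) with hF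
  have hFd : Differentiable ℂ F := by fun_prop
  have hFb : ∀ z, ‖z‖ ≤ R → ‖F z‖ ≤ Real.exp M * ‖F 0‖ :=
    fun z hz => by simpa [hF] using hb (z + c) (by simpa using hz)
  have hFre : ∀ z, ‖z‖ < R / 2 → F z = 0 → z.re ≤ 0 :=
    fun z hz h0 => by simpa using hre (z + c) (by simpa using hz) h0
  have hna : ‖(-(a : ℂ))‖ = a := by
    rw [norm_neg, Complex.norm_real, Real.norm_of_nonneg ha.le]
  obtain ⟨g, hgd, hg0, hgb, hgre, heq⟩ := exists_remove_zero (ρ := -(a : ℂ)) hFd hR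
    (by simpa [hF] using hf0) hFb hFre (by rw [hna]; exact haR)
    (by simp only [hF]; rw [← hfa]; congr 1; ring)
  have h1 := re_logDeriv_ge_zero hR hM hgd hg0 (fun z hz => (hgb z hz).trans (by
    gcongr; linarith [Real.log_pos one_lt_two])) hgre
  have h2 : deriv F 0 / F 0 = deriv f c / f c := by simp [hF, deriv_comp_add_const]
  rw [← h2, heq, hna, Complex.neg_re, Complex.ofReal_re]
  have : -a * (1 / R ^ 2 - 1 / a ^ 2) = 1 / a - a / R ^ 2 := by field_simp; ring
  linarith

lemma norm_logDeriv_le_of_ne_zero' {f : ℂ → ℂ} {c : ℂ} (hf : Differentiable ℂ f) {r M : ℝ}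
    (hr : 0 < r) (hM : 0 < M) (h0 : ∀ z, ‖z - c‖ < r → f z ≠ 0)
    (hb : ∀ z, ‖z - c‖ < r → ‖f z‖ ≤ Real.exp M * ‖f c‖) {z : ℂ} (hz : ‖z - c‖ < r) :
    ‖deriv f z / f z‖ ≤ 8 * M * r / (r - ‖z - c‖) ^ 2 := by
  have := norm_logDeriv_le_of_ne_zero (f := fun z => f (z + c)) (by fun_prop) hr hM
    (fun z hz => h0 (z + c) (by simpa using hz))
    (fun z hz => by simpa using hb (z + c) (by simpa using hz)) (z := z - c) hz
  simpa [deriv_comp_add_const] using this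

open Complex MeasureTheory Filter Topology in
/-- Analytic continuation of a Dirichlet series whose coefficients have mean value `κ`. -/
lemma exists_continuation {a : ℕ → ℂ} {κ : ℂ} {B θ : ℝ} (hθ0 : 0 ≤ θ) (hθ1 : θ ≤ 1)
    (ha : ∀ n, ‖a n‖ ≤ 1)
    (hS : ∀ u : ℝ, 1 ≤ u → ‖∑ k ∈ Icc 1 ⌊u⌋₊, a k - κ * u‖ ≤ B * u ^ θ) :
    ∃ G : ℂ → ℂ, (∀ s : ℂ, θ < s.re → DifferentiableAt ℂ G s) ∧
      (∀ s : ℂ, θ < s.re → ‖G s‖ ≤ B / (s.re - θ)) ∧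
      (∀ s : ℂ, 1 < s.re → LSeries a s = s * G s + κ * s / (s - 1)) := by
  set S : ℝ → ℂ := fun t => ∑ k ∈ Icc 1 ⌊t⌋₊, a k with hSdef
  have hSm : Measurable S :=
    (measurable_from_nat (f := fun n : ℕ => ∑ k ∈ Icc 1 n, a k)).comp Nat.measurable_floor
  have hB : 0 ≤ B := by
    have := hS 1 le_rfl
    simp only [Real.one_rpow, mul_one] at this
    exact (norm_nonneg _).trans this
  set E : ℝ → ℂ := (Set.Ioi (1 : ℝ)).indicator (fun t => S t - κ * t) with hE
  have hEm : Measurable E := by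
    apply Measurable.indicator _ measurableSet_Ioi
    exact hSm.sub (measurable_const.mul Complex.measurable_ofReal)
  have hEb : ∀ t, 0 < t → ‖E t‖ ≤ B * t ^ θ := by
    intro t ht
    by_cases h1 : t ∈ Set.Ioi (1 : ℝ)
    · rw [hE, Set.indicator_of_mem h1]
      exact hS t (le_of_lt h1)
    · rw [hE, Set.indicator_of_notMem h1, norm_zero]
      positivity
  have hloc : LocallyIntegrableOn E (Set.Ioi 0) := by
    have hc : LocallyIntegrableOn (fun t : ℝ => B * t ^ θ) (Set.Ioi 0) := by
      apply ContinuousOn.locallyIntegrableOn _ measurableSet_Ioi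
      exact continuousOn_const.mul (continuousOn_id.rpow_const fun x hx => Or.inr hθ0)
    refine (locallyIntegrableOn_iff isOpen_Ioi.isLocallyClosed).mpr fun k hk hkc => ?_
    have := (locallyIntegrableOn_iff isOpen_Ioi.isLocallyClosed).mp hc k hk hkc
    refine Integrable.mono' this hEm.aestronglyMeasurable ?_
    filter_upwards [ae_restrict_mem hkc.measurableSet] with t ht using hEb t (hk ht)
  have hint : ∀ s : ℂ, mellin E (-s) = ∫ t in Set.Ioi (1 : ℝ), (S t - κ * t) * t ^ (-(s + 1)) := by
    intro s
    rw [mellin]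
    have h1 : ∀ t : ℝ, (t : ℂ) ^ (-s - 1) • E t =
        (Set.Ioi (1 : ℝ)).indicator (fun t => (S t - κ * t) * (t : ℂ) ^ (-(s + 1))) t := by
      intro t
      by_cases h1 : t ∈ Set.Ioi (1 : ℝ)
      · rw [hE, Set.indicator_of_mem h1, Set.indicator_of_mem h1, smul_eq_mul, mul_comm]
        congr 2; ring
      · rw [hE, Set.indicator_of_notMem h1, Set.indicator_of_notMem h1, smul_zero]
    simp_rw [h1]
    rw [setIntegral_indicator measurableSet_Ioi]
    congr 2
    ext t; simp only [Set.mem_inter_iff, Set.mem_Ioi]; constructor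
    · exact fun h => h.2
    · exact fun h => ⟨by linarith, h⟩
  have hnb : ∀ s : ℂ, ∀ t ∈ Set.Ioi (1 : ℝ),
      ‖(S t - κ * t) * (t : ℂ) ^ (-(s + 1))‖ ≤ B * t ^ (θ - s.re - 1) := by
    intro s t ht
    have ht0 : (0 : ℝ) < t := lt_trans one_pos ht
    rw [norm_mul, norm_cpow_eq_rpow_re_of_pos ht0]
    have := hS t (le_of_lt ht)
    calc _ ≤ (B * t ^ θ) * t ^ (-(s + 1)).re := by gcongr
      _ = _ := by
        rw [mul_assoc, ← Real.rpow_add ht0]; congr 2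
        simp only [neg_re, add_re, one_re]; ring
  refine ⟨fun s => mellin E (-s), ?_, ?_, ?_⟩
  · intro s hs
    have hm : DifferentiableAt ℂ (mellin E) (-s) := by
      refine mellin_differentiableAt_of_isBigO_rpow (a := -θ) (b := -s.re - 1) hloc ?_ (by simpa)
        ?_ (by simp)
      · rw [neg_neg]
        refine Asymptotics.IsBigO.of_bound B ?_
        filter_upwards [eventually_gt_atTop 0] with t ht
        rw [Real.norm_of_nonneg (by positivity)]
        exact hEb t ht
      · refine Asymptotics.IsBigO.of_bound 0 ?_
        have : Set.Iio (1 : ℝ) ∈ 𝓝[>] (0 : ℝ) :=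
          mem_nhdsWithin_of_mem_nhds (Iio_mem_nhds one_pos)
        filter_upwards [this] with t ht
        have h1 : t ∉ Set.Ioi (1 : ℝ) := by simp only [Set.mem_Ioi, not_lt]; exact le_of_lt ht
        simp [hE, Set.indicator_of_notMem h1]
    exact hm.comp s differentiableAt_id.neg
  · intro s hs
    simp only [hint]
    have hlt : θ - s.re - 1 < -1 := by linarith
    refine (norm_integral_le_of_norm_le
      ((integrableOn_Ioi_rpow_of_lt hlt one_pos).const_mul B) ?_).trans (le_of_eq ?_)
    · filter_upwards [ae_restrict_mem measurableSet_Ioi] with t ht using hnb s t ht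
    · rw [integral_const_mul, integral_Ioi_rpow_of_lt hlt one_pos, Real.one_rpow]
      have : s.re - θ ≠ 0 := by linarith
      have h2 : θ - s.re - 1 + 1 ≠ 0 := by intro h; apply this; linarith
      field_simp
      ring
  · intro s hs
    have hO : (fun n : ℕ => ∑ k ∈ Icc 1 n, ‖a k‖) =O[atTop] fun n : ℕ => (n : ℝ) ^ (1 : ℝ) := by
      refine Asymptotics.IsBigO.of_bound 1 (Eventually.of_forall fun n => ?_)
      rw [Real.rpow_one, one_mul, Real.norm_natCast,
        Real.norm_of_nonneg (Finset.sum_nonneg fun _ _ => norm_nonneg _)]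
      calc ∑ k ∈ Icc 1 n, ‖a k‖ ≤ ∑ k ∈ Icc 1 n, 1 := Finset.sum_le_sum fun k _ => ha k
        _ = n := by simp
    rw [LSeries_eq_mul_integral' a zero_le_one hs hO]
    simp only [hint]
    have hs1 : s - 1 ≠ 0 := by
      intro h
      have : s = 1 := by linear_combination h
      rw [this] at hs; simp at hs
    have hI1 : IntegrableOn (fun t : ℝ => (S t - κ * t) * (t : ℂ) ^ (-(s + 1)))
        (Set.Ioi 1) := by
      have hlt : θ - s.re - 1 < -1 := by linarith
      refine Integrable.mono' ((integrableOn_Ioi_rpow_of_lt hlt one_pos).const_mul B) ?_ ?_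
      · apply Measurable.aestronglyMeasurable
        exact (hSm.sub (measurable_const.mul Complex.measurable_ofReal)).mul
          (Complex.measurable_ofReal.pow_const _)
      · filter_upwards [ae_restrict_mem measurableSet_Ioi] with t ht using hnb s t ht
    have hI2 : IntegrableOn (fun t : ℝ => κ * (t : ℂ) ^ (-s)) (Set.Ioi 1) :=
      ((integrableOn_Ioi_cpow_of_lt (by simpa using hs) one_pos)).const_mul κ
    have hsplit : ∫ t in Set.Ioi (1 : ℝ), S t * (t : ℂ) ^ (-(s + 1)) =
        (∫ t in Set.Ioi (1 : ℝ), (S t - κ * t) * (t : ℂ) ^ (-(s + 1))) +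
          ∫ t in Set.Ioi (1 : ℝ), κ * (t : ℂ) ^ (-s) := by
      rw [← integral_add hI1 hI2]
      refine setIntegral_congr_fun measurableSet_Ioi fun t ht => ?_
      have ht0 : (t : ℂ) ≠ 0 := by
        have : (0 : ℝ) < t := lt_trans one_pos ht
        exact_mod_cast this.ne'
      have : (t : ℂ) ^ (-s) = t * (t : ℂ) ^ (-(s + 1)) := by
        rw [show -s = 1 + (-(s + 1)) by ring, cpow_add _ _ ht0, cpow_one]
      simp only [this]
      ring
    have hval : ∫ t in Set.Ioi (1 : ℝ), κ * (t : ℂ) ^ (-s) = κ / (s - 1) := by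
      rw [integral_const_mul, integral_Ioi_cpow_of_lt (by simpa using hs) one_pos]
      simp only [ofReal_one, one_cpow]
      have : -s + 1 ≠ 0 := by intro h; apply hs1; linear_combination -h
      field_simp
      ring
    rw [hsplit, hval]
    ring

open Complex in
lemma eq_of_eq_on_one_lt_re {F G : ℂ → ℂ} {θ : ℝ} (hθ : θ ≤ 1) (hF : Differentiable ℂ F)
    (hG : ∀ s : ℂ, θ < s.re → DifferentiableAt ℂ G s)
    (h : ∀ s : ℂ, 1 < s.re → F s = G s) {s : ℂ} (hs : θ < s.re) : F s = G s := by
  have ho : IsOpen {s : ℂ | θ < s.re} := isOpen_lt continuous_const continuous_re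
  have hFa : AnalyticOnNhd ℂ F {s : ℂ | θ < s.re} :=
    hF.differentiableOn.analyticOnNhd ho
  have hGa : AnalyticOnNhd ℂ G {s : ℂ | θ < s.re} :=
    DifferentiableOn.analyticOnNhd (fun s hs => (hG s hs).differentiableWithinAt) ho
  have hc : IsPreconnected {s : ℂ | θ < s.re} := (convex_halfSpace_re_gt θ).isPreconnected
  refine hFa.eqOn_of_preconnected_of_eventuallyEq hGa hc (z₀ := 2) ?_ ?_ hs
  · simp; linarith
  · have : {s : ℂ | 1 < s.re} ∈ nhds (2 : ℂ) :=
      (isOpen_lt continuous_const continuous_re).mem_nhds (by simp)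
    filter_upwards [this] with s hs using h s hs

lemma sum_Icc_char_le_level {q : ℕ} [NeZero q] {χ : DirichletCharacter ℂ q} (hχ : χ ≠ 1) (n : ℕ) :
    ‖∑ k ∈ Icc 1 n, χ (k : ZMod q)‖ ≤ q := by
  have hper : ∀ N, ∑ k ∈ range (q + N), χ (k : ZMod q) = ∑ k ∈ range N, χ (k : ZMod q) := by
    intro N
    rw [sum_range_add]
    have h1 : ∑ k ∈ range q, χ (k : ZMod q) = 0 := by
      rw [← MulChar.sum_eq_zero_of_ne_one hχ]
      refine Finset.sum_bij (fun k _ => (k : ZMod q)) (by simp) ?_ ?_ (by simp)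
      · intro a ha b hb hab
        rw [mem_range] at ha hb
        rw [ZMod.natCast_eq_natCast_iff'] at hab
        rwa [Nat.mod_eq_of_lt ha, Nat.mod_eq_of_lt hb] at hab
      · intro x _
        exact ⟨x.val, by simpa using x.val_lt, by simp⟩
    rw [h1, zero_add]
    simp
  have hper' : ∀ m N, ∑ k ∈ range (q * m + N), χ (k : ZMod q) = ∑ k ∈ range N, χ (k : ZMod q) := by
    intro m N
    induction m with
    | zero => simp
    | succ m ih => rw [← ih, ← hper (q * m + N)]; congr 2; ring
  have hq1 : q ≠ 1 := by
    rintro rfl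
    exact hχ (DirichletCharacter.level_one χ)
  have h0 : χ (0 : ZMod q) = 0 := by
    apply MulChar.map_nonunit
    have : Fact (1 < q) := ⟨by have := NeZero.ne q; omega⟩
    simp
  have hT : ∑ k ∈ Icc 1 n, χ (k : ZMod q) = ∑ k ∈ range (n + 1), χ (k : ZMod q) := by
    rw [range_eq_Ico, Finset.sum_eq_sum_Ico_succ_bot (by omega)]
    simp only [Nat.cast_zero, h0, zero_add]
    rfl
  rw [hT, ← Nat.div_add_mod (n + 1) q, hper']
  calc _ ≤ ∑ k ∈ range ((n + 1) % q), ‖χ (k : ZMod q)‖ := norm_sum_le _ _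
    _ ≤ ∑ k ∈ range ((n + 1) % q), (1 : ℝ) := Finset.sum_le_sum fun k _ => χ.norm_le_one _
    _ = ((n + 1) % q : ℕ) := by simp
    _ ≤ q := by exact_mod_cast (Nat.mod_lt _ (NeZero.pos q)).le

lemma norm_sum_Icc_char_le {q : ℕ} [NeZero q] {χ : DirichletCharacter ℂ q} (hχ : χ ≠ 1)
    {ε : ℝ} (hε0 : 0 ≤ ε) (hε1 : ε ≤ 1) {u : ℝ} (hu : 1 ≤ u) :
    ‖∑ k ∈ Icc 1 ⌊u⌋₊, χ (k : ZMod q)‖ ≤ (q : ℝ) ^ ε * u ^ (1 - ε) := by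
  set T := ‖∑ k ∈ Icc 1 ⌊u⌋₊, χ (k : ZMod q)‖ with hT
  have h1 : T ≤ q := sum_Icc_char_le_level hχ _
  have h2 : T ≤ u := by
    calc T ≤ ∑ k ∈ Icc 1 ⌊u⌋₊, ‖χ (k : ZMod q)‖ := norm_sum_le _ _
      _ ≤ ∑ k ∈ Icc 1 ⌊u⌋₊, (1 : ℝ) := Finset.sum_le_sum fun k _ => χ.norm_le_one _
      _ = (⌊u⌋₊ : ℝ) := by simp
      _ ≤ u := Nat.floor_le (by linarith)
  have hT0 : 0 ≤ T := norm_nonneg _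
  calc T = T ^ ε * T ^ (1 - ε) := by
        rw [← Real.rpow_add_of_nonneg hT0 hε0 (by linarith)]; simp
    _ ≤ _ := by
      gcongr

open Complex DirichletCharacter in
/-- Bound for a nonprincipal Dirichlet `L`-function to the right of the line `re s = 1 - ε`. -/
lemma norm_LFunction_le {q : ℕ} [NeZero q] {χ : DirichletCharacter ℂ q} (hχ : χ ≠ 1)
    {ε : ℝ} (hε0 : 0 ≤ ε) (hε1 : ε ≤ 1) {s : ℂ} (hs : 1 - ε < s.re) :
    ‖LFunction χ s‖ ≤ ‖s‖ * ((q : ℝ) ^ ε / (s.re - (1 - ε))) := by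
  obtain ⟨G, hGd, hGb, hGe⟩ := exists_continuation (a := fun n => χ (n : ZMod q)) (κ := 0)
    (B := (q : ℝ) ^ ε) (θ := 1 - ε) (by linarith) (by linarith) (fun n => χ.norm_le_one _)
    (fun u hu => by simpa using norm_sum_Icc_char_le hχ hε0 hε1 hu)
  have := eq_of_eq_on_one_lt_re (F := LFunction χ) (G := fun s => s * G s) (θ := 1 - ε)
    (by linarith) (differentiable_LFunction hχ) (fun s hs => differentiableAt_id.mul (hGd s hs))
    (fun s hs => by rw [LFunction_eq_LSeries χ hs, hGe s hs]; simp) hs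
  rw [this, norm_mul]
  gcongr
  exact hGb s hs

open Complex DirichletCharacter in
lemma norm_sub_one_mul_zeta_le {s : ℂ} (hs : 0 < s.re) (hs1 : s ≠ 1) :
    ‖(s - 1) * riemannZeta s‖ ≤ ‖s‖ * ‖s - 1‖ / s.re + ‖s‖ := by
  obtain ⟨G, hGd, hGb, hGe⟩ := exists_continuation (a := fun _ => 1) (κ := 1)
    (B := 1) (θ := 0) le_rfl zero_le_one (fun n => by simp)
    (fun u hu => by
      have h1 := Nat.floor_le (zero_le_one.trans hu)
      have h2 := Nat.lt_floor_add_one u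
      have : ∑ k ∈ Icc 1 ⌊u⌋₊, (1 : ℂ) - 1 * (u : ℂ) = (((⌊u⌋₊ : ℝ) - u : ℝ) : ℂ) := by simp
      rw [this, Complex.norm_real, Real.rpow_zero, mul_one, Real.norm_eq_abs, abs_le]
      constructor <;> linarith)
  have hval : ∀ s : ℂ, s ≠ 1 → LFunctionTrivChar₁ 1 s = (s - 1) * riemannZeta s := by
    intro s hs
    rw [LFunctionTrivChar₁, Function.update_of_ne hs, LFunctionTrivChar, LFunction_modOne_eq]
  have := eq_of_eq_on_one_lt_re (F := LFunctionTrivChar₁ 1)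
    (G := fun s => s * (s - 1) * G s + s) (θ := 0) zero_le_one
    (differentiable_LFunctionTrivChar₁ 1)
    (fun s hs => ((differentiableAt_id.mul (differentiableAt_id.sub_const 1)).mul
      (hGd s hs)).add differentiableAt_id)
    (fun s hs => by
      have hs1 : s ≠ 1 := by rintro rfl; simp at hs
      have h2 := hGe s hs
      have h3 : LSeries (fun _ => 1) s = riemannZeta s := by
        rw [← LSeries_one_eq_riemannZeta hs]; rfl
      rw [h3] at h2
      rw [hval s hs1, h2]
      have : s - 1 ≠ 0 := sub_ne_zero.mpr hs1
      field_simp) hs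
  rw [← hval s hs1, this]
  refine (norm_add_le _ _).trans ?_
  gcongr
  rw [norm_mul, norm_mul, div_eq_mul_one_div]
  gcongr
  simpa using hGb s hs

open Complex DirichletCharacter in
/-- Bound for `(s - 1) L(s, χ₀)`, where `χ₀` is the principal character mod `q`. -/
lemma norm_LFunctionTrivChar₁_le {q : ℕ} [NeZero q] {s : ℂ} (hs : 0 < s.re) :
    ‖LFunctionTrivChar₁ q s‖ ≤ q * (‖s‖ * ‖s - 1‖ / s.re + ‖s‖) := by
  have hq : (1 : ℝ) ≤ q := by exact_mod_cast NeZero.one_le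
  have hprod : ∀ s : ℂ, 0 < s.re → ‖∏ p ∈ q.primeFactors, (1 - (p : ℂ) ^ (-s))‖ ≤ q := by
    intro s hs
    rw [norm_prod]
    calc ∏ p ∈ q.primeFactors, ‖1 - (p : ℂ) ^ (-s)‖ ≤ ∏ p ∈ q.primeFactors, (p : ℝ) := by
          refine Finset.prod_le_prod (fun _ _ => norm_nonneg _) fun p hp => ?_
          have hp' := Nat.prime_of_mem_primeFactors hp
          have h2 : (2 : ℝ) ≤ p := by exact_mod_cast hp'.two_le
          refine (norm_sub_le _ _).trans ?_
          rw [norm_one, norm_natCast_cpow_of_pos hp'.pos]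
          have : (p : ℝ) ^ (-s).re ≤ 1 :=
            Real.rpow_le_one_of_one_le_of_nonpos (by linarith) (by simpa using hs.le)
          linarith
      _ = ((∏ p ∈ q.primeFactors, p : ℕ) : ℝ) := by push_cast; rfl
      _ ≤ q := by
        exact_mod_cast Nat.le_of_dvd (NeZero.pos q) (Nat.prod_primeFactors_dvd q)
  by_cases hs1 : s = 1
  · subst hs1
    have : LFunctionTrivChar₁ q 1 = ∏ p ∈ q.primeFactors, (1 - (p : ℂ) ^ (-1 : ℂ)) := by
      simp only [LFunctionTrivChar₁, Function.update_self, cpow_neg_one]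
    rw [this]
    refine (hprod 1 (by simp)).trans ?_
    simp
  · rw [LFunctionTrivChar₁, Function.update_of_ne hs1, LFunctionTrivChar_eq_mul_riemannZeta hs1]
    rw [mul_left_comm, norm_mul]
    gcongr
    · exact hprod s hs
    · exact norm_sub_one_mul_zeta_le hs hs1

open Complex DirichletCharacter in
/-- The entire function attached to `χ`: its `L`-function, with the pole at `1` removed when
`χ` is principal. -/
noncomputable def entireL {q : ℕ} [NeZero q] (χ : DirichletCharacter ℂ q) : ℂ → ℂ :=
  if χ = 1 then LFunctionTrivChar₁ q else LFunction χ

open Complex DirichletCharacter in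
lemma differentiable_entireL {q : ℕ} [NeZero q] (χ : DirichletCharacter ℂ q) :
    Differentiable ℂ (entireL χ) := by
  unfold entireL
  split_ifs with h
  · exact differentiable_LFunctionTrivChar₁ q
  · exact differentiable_LFunction h

open Complex DirichletCharacter in
lemma entireL_of_ne_one {q : ℕ} [NeZero q] {χ : DirichletCharacter ℂ q} (h : χ ≠ 1) :
    entireL χ = LFunction χ := if_neg h

open Complex DirichletCharacter in
lemma entireL_one_apply {q : ℕ} [NeZero q] {s : ℂ} (hs : s ≠ 1) :
    entireL (1 : DirichletCharacter ℂ q) s =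
      (s - 1) * LFunction (1 : DirichletCharacter ℂ q) s := by
  rw [entireL, if_pos rfl, LFunctionTrivChar₁, Function.update_of_ne hs]

open Complex DirichletCharacter in
lemma entireL_ne_zero {q : ℕ} [NeZero q] (χ : DirichletCharacter ℂ q) {s : ℂ} (hs : 1 ≤ s.re) :
    entireL χ s ≠ 0 := by
  by_cases h : χ = 1
  · subst h
    by_cases hs1 : s = 1
    · subst hs1
      rw [entireL, if_pos rfl]
      exact LFunctionTrivChar₁_apply_one_ne_zero q
    · rw [entireL_one_apply hs1]
      exact mul_ne_zero (sub_ne_zero.mpr hs1)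
        (LFunction_ne_zero_of_one_le_re _ (Or.inr hs1) hs)
  · rw [entireL_of_ne_one h]
    exact LFunction_ne_zero_of_one_le_re _ (Or.inl h) hs

open Complex DirichletCharacter in
lemma norm_entireL_le {q : ℕ} [NeZero q] (χ : DirichletCharacter ℂ q) {s : ℂ}
    (hs : 1 / 4 ≤ s.re) : ‖entireL χ s‖ ≤ 5 * q * (‖s‖ + 1) ^ 2 := by
  have hq : (1 : ℝ) ≤ q := by exact_mod_cast NeZero.one_le
  have h0 := norm_nonneg s
  by_cases h : χ = 1
  · subst h
    rw [entireL, if_pos rfl]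
    refine (norm_LFunctionTrivChar₁_le (by linarith)).trans ?_
    have h1 : ‖s - 1‖ ≤ ‖s‖ + 1 := by simpa using norm_sub_le s 1
    have h2 : ‖s‖ * ‖s - 1‖ / s.re ≤ 4 * (‖s‖ * (‖s‖ + 1)) := by
      rw [div_le_iff₀ (by linarith)]
      have : ‖s‖ * ‖s - 1‖ ≤ ‖s‖ * (‖s‖ + 1) := by gcongr
      nlinarith [mul_nonneg h0 (by linarith : 0 ≤ ‖s‖ + 1)]
    calc (q : ℝ) * (‖s‖ * ‖s - 1‖ / s.re + ‖s‖) ≤ q * (4 * (‖s‖ * (‖s‖ + 1)) + ‖s‖) := by gcongr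
      _ ≤ q * (5 * (‖s‖ + 1) ^ 2) := by gcongr; nlinarith
      _ = _ := by ring
  · rw [entireL_of_ne_one h]
    refine (norm_LFunction_le h zero_le_one le_rfl (by linarith)).trans ?_
    rw [Real.rpow_one]
    have : (q : ℝ) / (s.re - (1 - 1)) ≤ 4 * q := by
      rw [div_le_iff₀ (by linarith)]; nlinarith
    calc ‖s‖ * ((q : ℝ) / (s.re - (1 - 1))) ≤ ‖s‖ * (4 * q) := by gcongr
      _ = q * (4 * ‖s‖) := by ring
      _ ≤ q * (5 * (‖s‖ + 1) ^ 2) := by gcongr 1; nlinarith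
      _ = _ := by ring

open Complex DirichletCharacter in
lemma logDeriv_entireL {q : ℕ} [NeZero q] (χ : DirichletCharacter ℂ q) {s : ℂ} (hs : 1 < s.re) :
    deriv (entireL χ) s / entireL χ s =
      deriv (LFunction χ) s / LFunction χ s + if χ = 1 then 1 / (s - 1) else 0 := by
  split_ifs with h
  · subst h
    have hs1 : s ≠ 1 := by rintro rfl; simp at hs
    have h1 : s - 1 ≠ 0 := sub_ne_zero.mpr hs1
    have h2 := LFunction_ne_zero_of_one_le_re (1 : DirichletCharacter ℂ q) (Or.inr hs1) hs.le
    have : deriv (entireL (1 : DirichletCharacter ℂ q)) s =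
        LFunction (1 : DirichletCharacter ℂ q) s +
          (s - 1) * deriv (LFunction (1 : DirichletCharacter ℂ q)) s := by
      have he : entireL (1 : DirichletCharacter ℂ q) =ᶠ[nhds s]
          fun s => (s - 1) * LFunction (1 : DirichletCharacter ℂ q) s := by
        filter_upwards [isOpen_ne.mem_nhds hs1] with z hz using entireL_one_apply hz
      rw [he.deriv_eq]
      have hd := (differentiableAt_LFunction (1 : DirichletCharacter ℂ q) s (Or.inl hs1)).hasDerivAt
      have := ((hasDerivAt_id s).sub_const 1).mul hd
      have h3 := this.deriv
      simp only [id, one_mul] at h3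
      exact h3
    rw [this, entireL_one_apply hs1]
    field_simp
    ring
  · rw [entireL_of_ne_one h, add_zero]

open Complex DirichletCharacter ArithmeticFunction in
lemma neg_logDeriv_eq {q : ℕ} [NeZero q] (χ : DirichletCharacter ℂ q) {s : ℂ} (hs : 1 < s.re) :
    -(deriv (LFunction χ) s / LFunction χ s) =
      LSeries (fun n => χ (n : ZMod q) * (vonMangoldt n : ℂ)) s := by
  have := LSeries_twist_vonMangoldt_eq χ hs
  rw [deriv_LFunction_eq_deriv_LSeries χ hs, LFunction_eq_LSeries χ hs, ← neg_div, ← this]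
  rfl

open Complex DirichletCharacter ArithmeticFunction in
lemma summable_vonMangoldt_rpow {σ : ℝ} (hσ : 1 < σ) :
    Summable fun n : ℕ => vonMangoldt n * (n : ℝ) ^ (-σ) := by
  have := (LSeriesSummable_vonMangoldt (s := σ) (by simpa using hσ)).norm
  refine this.congr fun n => ?_
  rcases Nat.eq_zero_or_pos n with rfl | hn
  · simp
  · rw [LSeries.term_of_ne_zero hn.ne', norm_div, norm_natCast_cpow_of_pos hn, Complex.norm_real,
      Real.norm_of_nonneg vonMangoldt_nonneg, Real.rpow_neg (by positivity), ofReal_re,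
      div_eq_mul_inv]

open Complex DirichletCharacter ArithmeticFunction in
lemma term_twist_norm_le {q : ℕ} [NeZero q] (χ : DirichletCharacter ℂ q) (s : ℂ) (n : ℕ) :
    ‖LSeries.term (fun n => χ (n : ZMod q) * (vonMangoldt n : ℂ)) s n‖ ≤
      vonMangoldt n * (n : ℝ) ^ (-s.re) := by
  rcases Nat.eq_zero_or_pos n with rfl | hn
  · simp
  · rw [LSeries.term_of_ne_zero hn.ne', norm_div, norm_mul, norm_natCast_cpow_of_pos hn,
      Complex.norm_real, Real.norm_of_nonneg vonMangoldt_nonneg, Real.rpow_neg (by positivity),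
      div_eq_mul_inv]
    gcongr
    have := χ.norm_le_one (n : ZMod q)
    nlinarith [vonMangoldt_nonneg (n := n)]

open Complex DirichletCharacter ArithmeticFunction in
/-- `|L'/L|` is dominated by its value for the zeta function. -/
lemma norm_logDeriv_le_tsum {q : ℕ} [NeZero q] (χ : DirichletCharacter ℂ q) {s : ℂ}
    (hs : 1 < s.re) : ‖deriv (LFunction χ) s / LFunction χ s‖ ≤
      ∑' n : ℕ, vonMangoldt n * (n : ℝ) ^ (-s.re) := by
  rw [← norm_neg, neg_logDeriv_eq χ hs, LSeries]
  exact tsum_of_norm_bounded (summable_vonMangoldt_rpow hs).hasSum (term_twist_norm_le χ s)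

open Complex DirichletCharacter ArithmeticFunction in
lemma three_four_one {q : ℕ} [NeZero q] (χ : DirichletCharacter ℂ q) {σ : ℝ} (hσ : 1 < σ) (t : ℝ) :
    4 * (deriv (LFunction χ) (σ + t * I) / LFunction χ (σ + t * I)).re +
      (deriv (LFunction (χ ^ 2)) (σ + 2 * t * I) / LFunction (χ ^ 2) (σ + 2 * t * I)).re ≤
      3 * ∑' n : ℕ, vonMangoldt n * (n : ℝ) ^ (-σ) := by
  have h1 : 1 < (σ + t * I : ℂ).re := by simpa using hσ
  have h2 : 1 < (σ + 2 * t * I : ℂ).re := by simpa using hσ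
  have e1 := congrArg re (neg_logDeriv_eq χ h1)
  have e2 := congrArg re (neg_logDeriv_eq (χ ^ 2) h2)
  have s0 := (summable_vonMangoldt_rpow hσ)
  have s1 : Summable (LSeries.term (fun n => χ (n : ZMod q) * (vonMangoldt n : ℂ)) (σ + t * I)) :=
    LSeriesSummable_twist_vonMangoldt χ h1
  have s2 : Summable
      (LSeries.term (fun n => (χ ^ 2) (n : ZMod q) * (vonMangoldt n : ℂ)) (σ + 2 * t * I)) :=
    LSeriesSummable_twist_vonMangoldt (χ ^ 2) h2
  rw [LSeries, Complex.re_tsum s1, neg_re] at e1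
  rw [LSeries, Complex.re_tsum s2, neg_re] at e2
  have s1' := Complex.reCLM.summable s1
  have s2' := Complex.reCLM.summable s2
  simp only [Complex.reCLM_apply] at s1' s2'
  have key : 0 ≤ ∑' n : ℕ, (3 * (vonMangoldt n * (n : ℝ) ^ (-σ)) +
      4 * (LSeries.term (fun n => χ (n : ZMod q) * (vonMangoldt n : ℂ)) (σ + t * I) n).re +
      (LSeries.term (fun n => (χ ^ 2) (n : ZMod q) * (vonMangoldt n : ℂ))
        (σ + 2 * t * I) n).re) := by
    refine tsum_nonneg fun n => ?_
    rcases Nat.eq_zero_or_pos n with rfl | hn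
    · simp
    · have hn0 : (n : ℂ) ≠ 0 := by exact_mod_cast hn.ne'
      rw [LSeries.term_of_ne_zero hn.ne', LSeries.term_of_ne_zero hn.ne']
      set w : ℂ := χ (n : ZMod q) * (n : ℂ) ^ (-(t * I)) with hw
      have hw1 : ‖w‖ ≤ 1 := by
        rw [hw, norm_mul, norm_natCast_cpow_of_pos hn]
        simpa using χ.norm_le_one (n : ZMod q)
      have hp : (n : ℂ) ^ (-(σ : ℂ)) = (((n : ℝ) ^ (-σ) : ℝ) : ℂ) := by
        rw [ofReal_cpow (by positivity)]; simp
      have t1 : χ (n : ZMod q) * (vonMangoldt n : ℂ) / (n : ℂ) ^ (σ + t * I : ℂ) =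
          ((vonMangoldt n * (n : ℝ) ^ (-σ) : ℝ) : ℂ) * w := by
        rw [div_eq_mul_inv, ← cpow_neg, neg_add, cpow_add _ _ hn0, hp, hw]; push_cast; ring
      have t2 : (χ ^ 2) (n : ZMod q) * (vonMangoldt n : ℂ) / (n : ℂ) ^ (σ + 2 * t * I : ℂ) =
          ((vonMangoldt n * (n : ℝ) ^ (-σ) : ℝ) : ℂ) * w ^ 2 := by
        rw [div_eq_mul_inv, ← cpow_neg, neg_add, cpow_add _ _ hn0, hp, hw, mul_pow,
          ← cpow_nat_mul, MulChar.pow_apply' _ two_ne_zero]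
        push_cast
        ring_nf
      rw [t1, t2, re_ofReal_mul, re_ofReal_mul]
      have hA : 0 ≤ vonMangoldt n * (n : ℝ) ^ (-σ) :=
        mul_nonneg vonMangoldt_nonneg (by positivity)
      have h3 : 0 ≤ 3 + 4 * w.re + (w ^ 2).re := by
        have : w.re ^ 2 + w.im ^ 2 ≤ 1 := by
          have := Complex.sq_norm w
          rw [Complex.normSq_apply] at this
          nlinarith [norm_nonneg w]
        have h4 : (w ^ 2).re = w.re ^ 2 - w.im ^ 2 := by rw [pow_two, mul_re]; ring
        rw [h4]
        nlinarith [sq_nonneg (w.re + 1)]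
      nlinarith [mul_nonneg hA h3]
  rw [Summable.tsum_add ((s0.mul_left 3).add (s1'.mul_left 4)) s2',
    Summable.tsum_add (s0.mul_left 3) (s1'.mul_left 4), tsum_mul_left, tsum_mul_left] at key
  linarith

open Complex DirichletCharacter ArithmeticFunction in
lemma exists_zeta_bounds : ∃ A : ℝ, 1 ≤ A ∧ ∀ σ : ℝ, 1 < σ → σ ≤ 2 →
    ‖riemannZeta σ‖ ≤ A / (σ - 1) ∧
    ∑' n : ℕ, vonMangoldt n * (n : ℝ) ^ (-σ) ≤ 1 / (σ - 1) + A := by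
  have hd := differentiable_entireL (1 : DirichletCharacter ℂ 1)
  have hc1 : ContinuousOn (fun σ : ℝ => entireL (1 : DirichletCharacter ℂ 1) σ) (Set.Icc 1 2) :=
    (hd.continuous.comp continuous_ofReal).continuousOn
  have hc2 : ContinuousOn (fun σ : ℝ => deriv (entireL (1 : DirichletCharacter ℂ 1)) σ /
      entireL (1 : DirichletCharacter ℂ 1) σ) (Set.Icc 1 2) := by
    refine ContinuousOn.div ?_ hc1 fun σ hσ => entireL_ne_zero _ (by simpa using hσ.1)
    exact ((hd.contDiff (n := 1)).continuous_deriv le_rfl |>.comp continuous_ofReal).continuousOn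
  obtain ⟨A, hA⟩ := isCompact_Icc.exists_bound_of_continuousOn hc1
  obtain ⟨B, hB⟩ := isCompact_Icc.exists_bound_of_continuousOn hc2
  refine ⟨max 1 (max A B), le_max_left _ _, fun σ h1 h2 => ⟨?_, ?_⟩⟩
  · have := hA σ ⟨h1.le, h2⟩
    have hs1 : (σ : ℂ) ≠ 1 := by exact_mod_cast h1.ne'
    rw [entireL_one_apply hs1, LFunction_modOne_eq, norm_mul] at this
    have h3 : ‖(σ : ℂ) - 1‖ = σ - 1 := by
      rw [← ofReal_one, ← ofReal_sub, norm_real, Real.norm_of_nonneg (by linarith)]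
    rw [h3] at this
    rw [le_div_iff₀ (by linarith), mul_comm]
    exact this.trans ((le_max_left _ _).trans (le_max_right _ _))
  · have := hB σ ⟨h1.le, h2⟩
    have hs : 1 < (σ : ℂ).re := by simpa using h1
    rw [logDeriv_entireL _ hs, if_pos rfl] at this
    have h4 := neg_logDeriv_eq (1 : DirichletCharacter ℂ 1) hs
    have h5 : LSeries (fun n => (1 : DirichletCharacter ℂ 1) (n : ZMod 1) * (vonMangoldt n : ℂ)) σ
        = ((∑' n : ℕ, vonMangoldt n * (n : ℝ) ^ (-σ) : ℝ) : ℂ) := by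
      rw [LSeries, ofReal_tsum]
      refine tsum_congr fun n => ?_
      rcases Nat.eq_zero_or_pos n with rfl | hn
      · simp
      · rw [LSeries.term_of_ne_zero hn.ne', div_eq_mul_inv, ← cpow_neg]
        have : (1 : DirichletCharacter ℂ 1) (n : ZMod 1) = 1 := by
          rw [Subsingleton.elim (n : ZMod 1) 1, map_one]
        rw [this]
        push_cast
        rw [ofReal_cpow (by positivity)]
        simp
    rw [h5] at h4
    have h6 := (Complex.re_le_norm _).trans this
    have h7 := (abs_le.mp ((Complex.abs_re_le_norm _).trans this)).1
    have h8 := congrArg re h4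
    rw [neg_re, ofReal_re] at h8
    have h9 : (1 / ((σ : ℂ) - 1)).re = 1 / (σ - 1) := by
      rw [← ofReal_one, ← ofReal_sub, ← ofReal_div, ofReal_re]
    rw [add_re, h9] at h7
    have : B ≤ max 1 (max A B) := (le_max_right _ _).trans (le_max_right _ _)
    linarith

open Complex DirichletCharacter ArithmeticFunction in
/-- A lower bound for `L(s, χ)` in the half-plane of absolute convergence. -/
lemma exists_norm_LFunction_ge : ∃ a : ℝ, 0 < a ∧ a ≤ 1 ∧
    ∀ (q : ℕ) [NeZero q] (χ : DirichletCharacter ℂ q) (s : ℂ), 1 < s.re → s.re ≤ 2 →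
      a * (s.re - 1) ≤ ‖LFunction χ s‖ := by
  obtain ⟨A, hA1, hA⟩ := exists_zeta_bounds
  refine ⟨1 / A, by positivity, by rw [div_le_one (by linarith)]; exact hA1,
    fun q _ χ s h1 h2 => ?_⟩
  have h3 := LSeries.mul_mu_eq_one χ h1
  rw [← LFunction_eq_LSeries χ h1] at h3
  have hσ : 1 < ((s.re : ℝ) : ℂ).re := by simpa using h1
  have hz := LSeriesHasSum_one hσ
  have hsum : HasSum (fun n : ℕ => ‖LSeries.term 1 (s.re : ℂ) n‖) ‖riemannZeta (s.re : ℂ)‖ := by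
    have hterm : ∀ n : ℕ, LSeries.term 1 (s.re : ℂ) n =
        ((‖LSeries.term 1 (s.re : ℂ) n‖ : ℝ) : ℂ) := by
      intro n
      rcases Nat.eq_zero_or_pos n with rfl | hn
      · simp
      · rw [LSeries.term_of_ne_zero hn.ne', norm_div, norm_natCast_cpow_of_pos hn]
        push_cast
        rw [ofReal_cpow (by positivity)]
        simp
    have h : HasSum (fun n : ℕ => ((‖LSeries.term 1 (s.re : ℂ) n‖ : ℝ) : ℂ))
        (riemannZeta (s.re : ℂ)) := by
      have : LSeries.term 1 (s.re : ℂ) =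
        (fun n : ℕ => ((‖LSeries.term 1 (s.re : ℂ) n‖ : ℝ) : ℂ)) := funext hterm
      rw [← this]; exact hz
    have h0 : HasSum (fun n : ℕ => ‖LSeries.term 1 (s.re : ℂ) n‖) (riemannZeta (s.re : ℂ)).re := by
      simpa using Complex.reCLM.hasSum h
    have h1' : riemannZeta (s.re : ℂ) = ((riemannZeta (s.re : ℂ)).re : ℂ) := by
      apply Complex.ext
      · simp
      · simpa using riemannZeta_im_eq_zero_of_one_lt h1
    rw [h1', norm_real, Real.norm_of_nonneg (riemannZeta_re_pos_of_one_lt h1).le]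
    exact h0
  have hmu : ‖LSeries ((fun n : ℕ => χ (n : ZMod q)) * fun n : ℕ => ((moebius n : ℤ) : ℂ)) s‖ ≤
      A / (s.re - 1) := by
    refine le_trans ?_ (hA s.re h1 h2).1
    rw [LSeries]
    refine tsum_of_norm_bounded hsum fun n => ?_
    rcases Nat.eq_zero_or_pos n with rfl | hn
    · simp
    · rw [LSeries.term_of_ne_zero hn.ne', LSeries.term_of_ne_zero hn.ne', norm_div, norm_div,
        norm_natCast_cpow_of_pos hn, norm_natCast_cpow_of_pos hn, ofReal_re]
      gcongr
      simp only [Pi.mul_apply, norm_mul, Pi.one_apply, norm_one]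
      have h1 := χ.norm_le_one (n : ZMod q)
      have h2 : ‖((moebius n : ℤ) : ℂ)‖ ≤ 1 := by
        rw [Complex.norm_intCast]; exact_mod_cast abs_moebius_le_one
      nlinarith [norm_nonneg (χ (n : ZMod q)), norm_nonneg ((moebius n : ℤ) : ℂ)]
  have h4 := congrArg norm h3
  rw [norm_mul, norm_one] at h4
  have h5 : (0 : ℝ) ≤ ‖LFunction χ s‖ := norm_nonneg _
  have h6 : 1 ≤ ‖LFunction χ s‖ * (A / (s.re - 1)) := by
    refine h4.symm.le.trans ?_
    gcongr
  have h7 : 0 < s.re - 1 := by linarith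
  rw [mul_div_assoc', le_div_iff₀ h7] at h6
  rw [div_mul_eq_mul_div, div_le_iff₀ (by linarith)]
  linarith

open Complex DirichletCharacter ArithmeticFunction in
lemma norm_entireL_ge {a : ℝ} (ha0 : 0 < a)
    (ha : ∀ (q : ℕ) [NeZero q] (χ : DirichletCharacter ℂ q) (s : ℂ), 1 < s.re → s.re ≤ 2 →
      a * (s.re - 1) ≤ ‖LFunction χ s‖) {q : ℕ} [NeZero q] (χ : DirichletCharacter ℂ q) {s : ℂ}
    (h1 : 1 < s.re) (h2 : s.re ≤ 2) : a * (s.re - 1) ^ 2 ≤ ‖entireL χ s‖ := by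
  have h3 := ha q χ s h1 h2
  by_cases h : χ = 1
  · subst h
    have hs1 : s ≠ 1 := by rintro rfl; simp at h1
    rw [entireL_one_apply hs1, norm_mul]
    have h4 : s.re - 1 ≤ ‖s - 1‖ := by simpa using Complex.re_le_norm (s - 1)
    calc a * (s.re - 1) ^ 2 = (s.re - 1) * (a * (s.re - 1)) := by ring
      _ ≤ _ := by
        gcongr
  · rw [entireL_of_ne_one h]
    refine le_trans ?_ h3
    have : (s.re - 1) ^ 2 ≤ s.re - 1 := by nlinarith
    gcongr

open Complex DirichletCharacter in
lemma norm_entireL_le_exp_mul {a : ℝ} (ha0 : 0 < a)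
    (ha : ∀ (q : ℕ) [NeZero q] (χ : DirichletCharacter ℂ q) (s : ℂ), 1 < s.re → s.re ≤ 2 →
      a * (s.re - 1) ≤ ‖LFunction χ s‖) {q : ℕ} [NeZero q] (χ : DirichletCharacter ℂ q)
    {y : ℝ} (hy : 6 ≤ y) (hay : Real.exp (-y) ≤ a) (hq : (q : ℝ) ≤ Real.exp y) {c z : ℂ}
    (hc1 : 1 + Real.exp (-y) ≤ c.re) (hc2 : c.re ≤ 2) (hc3 : |c.im| ≤ 3 * Real.exp y)
    (hz : ‖z - c‖ ≤ 1 / 2) :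
    ‖entireL χ z‖ ≤ Real.exp (7 * y) * ‖entireL χ c‖ := by
  have hey : (80 : ℝ) ≤ Real.exp y := by
    calc (80 : ℝ) ≤ (2.7 : ℝ) ^ 6 := by norm_num
      _ ≤ Real.exp 1 ^ 6 := by gcongr; linarith [Real.exp_one_gt_d9]
      _ = Real.exp 6 := by rw [← Real.exp_nat_mul]; norm_num
      _ ≤ _ := Real.exp_le_exp.mpr hy
  have he0 := Real.exp_pos (-y)
  have hzre : 1 / 4 ≤ z.re := by
    have := (abs_le.mp ((Complex.abs_re_le_norm (z - c)).trans hz)).1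
    rw [sub_re] at this
    linarith
  have hcn : ‖c‖ ≤ 2 + 3 * Real.exp y := by
    refine (Complex.norm_le_abs_re_add_abs_im c).trans ?_
    rw [abs_of_nonneg (by linarith : 0 ≤ c.re)]
    linarith
  have hzn : ‖z‖ + 1 ≤ 4 * Real.exp y := by
    have : ‖z‖ ≤ ‖z - c‖ + ‖c‖ := by simpa using norm_add_le (z - c) c
    linarith
  have h1 : ‖entireL χ z‖ ≤ Real.exp y ^ 4 := by
    calc ‖entireL χ z‖ ≤ 5 * q * (‖z‖ + 1) ^ 2 := norm_entireL_le χ hzre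
      _ ≤ 5 * Real.exp y * (4 * Real.exp y) ^ 2 := by gcongr
      _ = 80 * Real.exp y ^ 3 := by ring
      _ ≤ Real.exp y * Real.exp y ^ 3 := by gcongr
      _ = _ := by ring
  have h2 : Real.exp (-y) * Real.exp (-y) ^ 2 ≤ ‖entireL χ c‖ := by
    refine le_trans ?_ (norm_entireL_ge ha0 ha χ (by linarith) hc2)
    gcongr
    linarith
  calc ‖entireL χ z‖ ≤ Real.exp y ^ 4 := h1
    _ = Real.exp (7 * y) * (Real.exp (-y) * Real.exp (-y) ^ 2) := by
      rw [← Real.exp_nat_mul, ← Real.exp_nat_mul, ← Real.exp_add, ← Real.exp_add]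
      congr 1; push_cast; ring
    _ ≤ _ := by gcongr

set_option maxHeartbeats 400000 in
open Complex DirichletCharacter ArithmeticFunction in
/-- The classical zero-free region, away from possible exceptional zeros. -/
lemma exists_zero_free : ∃ κ : ℝ, 0 < κ ∧ κ ≤ 1 ∧ ∃ y₀ : ℝ, 6 ≤ y₀ ∧ ∀ y : ℝ, y₀ ≤ y →
    ∀ (q : ℕ) [NeZero q] (χ : DirichletCharacter ℂ q), χ ≠ 1 → (q : ℝ) ≤ Real.exp y →
    ∀ s : ℂ, |s.im| ≤ (3 / 2) * Real.exp y → 1 - κ / y ≤ s.re → (χ ^ 2 ≠ 1 ∨ 1 / y ≤ |s.im|) →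
      LFunction χ s ≠ 0 := by
  obtain ⟨a, ha0, -, ha⟩ := exists_norm_LFunction_ge
  obtain ⟨A, hA1, hA⟩ := exists_zeta_bounds
  set A2 : ℝ := 3 * A + 16 + 160 * 7 + 1 with hA2
  set δ' : ℝ := 1 / (4 * A2) with hδ'
  have hA2pos : 1138 ≤ A2 := by rw [hA2]; linarith
  have hδ0 : 0 < δ' := by rw [hδ']; positivity
  have hδ1 : δ' ≤ 1 / 4000 := by
    rw [hδ']; apply one_div_le_one_div_of_le <;> linarith
  have hlim : Filter.Tendsto (fun y : ℝ => y * Real.exp (-y)) Filter.atTop (nhds 0) := by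
    simpa using Real.tendsto_pow_mul_exp_neg_atTop_nhds_zero 1
  obtain ⟨y₁, hy₁⟩ := Filter.eventually_atTop.mp (hlim.eventually (gt_mem_nhds (lt_min ha0 hδ0)))
  refine ⟨δ' / 7, by positivity, by linarith, max 6 y₁, le_max_left _ _, ?_⟩
  intro y hy q _ χ hχ hq ρ him hre hcase h0
  have hy6 : 6 ≤ y := (le_max_left _ _).trans hy
  have hy0 : 0 < y := by linarith
  have hye := hy₁ y ((le_max_right _ _).trans hy)
  have he0 := Real.exp_pos (-y)
  have hay : Real.exp (-y) ≤ a := by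
    have := hye.le.trans (min_le_left _ _)
    nlinarith
  set δ : ℝ := δ' / y with hδ
  have hδpos : 0 < δ := by positivity
  have hδe : Real.exp (-y) ≤ δ := by
    rw [hδ, le_div_iff₀ hy0, mul_comm]
    exact hye.le.trans (min_le_right _ _)
  have hδs : δ ≤ 1 / 4000 := by
    rw [hδ, div_le_iff₀ hy0]; nlinarith
  have hρ1 : ρ.re < 1 := by
    by_contra! h
    exact LFunction_ne_zero_of_one_le_re χ (Or.inl hχ) h h0
  have hη : 1 - ρ.re ≤ δ / 7 := by
    have : δ' / 7 / y = δ / 7 := by rw [hδ]; ring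
    rw [this] at hre; linarith
  set b : ℝ := 1 + δ - ρ.re with hb
  have hb0 : 0 < b := by rw [hb]; linarith
  have hb1 : b ≤ 8 / 7 * δ := by rw [hb]; linarith
  set γ := ρ.im
  have hey : 0 < Real.exp y := Real.exp_pos y
  have hσ : 1 < 1 + δ := by linarith
  -- the point `1 + δ + iγ`
  set c1 : ℂ := ((1 + δ : ℝ) : ℂ) + γ * I with hc1
  have hc1re : c1.re = 1 + δ := by simp [hc1]
  have hc1im : c1.im = γ := by simp [hc1]
  have hc1z : c1 - b = ρ := by
    apply Complex.ext
    · rw [sub_re, hc1re, ofReal_re, hb]; ring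
    · rw [sub_im, hc1im, ofReal_im]; simp [γ]
  have b1 : 1 / b - b / (1 / 2) ^ 2 - 16 * (7 * y) / (1 / 2) ≤
      (deriv (entireL χ) c1 / entireL χ c1).re := by
    apply re_logDeriv_ge_of_zero (by norm_num) (by positivity) (differentiable_entireL χ)
      (entireL_ne_zero χ (by rw [hc1re]; linarith))
    · intro z hz
      exact norm_entireL_le_exp_mul ha0 ha χ hy6 hay hq (by rw [hc1re]; linarith)
        (by rw [hc1re]; linarith) (by rw [hc1im]; linarith) hz
    · intro z _ hz
      by_contra! h
      exact entireL_ne_zero χ (by rw [hc1re] at h; linarith) hz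
    · exact hb0
    · linarith
    · rw [hc1z, entireL_of_ne_one hχ]; exact h0
  -- the point `1 + δ + 2 * iγ`
  set c2 : ℂ := ((1 + δ : ℝ) : ℂ) + 2 * γ * I with hc2
  have hc2re : c2.re = 1 + δ := by simp [hc2]
  have hc2im : c2.im = 2 * γ := by simp [hc2]
  have b2 : -(16 * (7 * y) / (1 / 2)) ≤ (deriv (entireL (χ ^ 2)) c2 / entireL (χ ^ 2) c2).re := by
    apply re_logDeriv_ge (by norm_num) (by positivity) (differentiable_entireL (χ ^ 2))
      (entireL_ne_zero _ (by rw [hc2re]; linarith))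
    · intro z hz
      exact norm_entireL_le_exp_mul ha0 ha _ hy6 hay hq (by rw [hc2re]; linarith)
        (by rw [hc2re]; linarith)
        (by rw [hc2im, abs_mul, abs_two]; linarith) hz
    · intro z _ hz
      by_contra! h
      exact entireL_ne_zero (χ ^ 2) (by rw [hc2re] at h; linarith) hz
  have hc1lt : 1 < c1.re := by rw [hc1re]; exact hσ
  have hc2lt : 1 < c2.re := by rw [hc2re]; exact hσ
  rw [logDeriv_entireL χ hc1lt, if_neg hχ, add_zero] at b1
  rw [logDeriv_entireL (χ ^ 2) hc2lt, add_re] at b2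
  have hpole : χ ^ 2 = 1 → (1 / (c2 - 1) : ℂ).re ≤ y := by
    intro h
    rcases hcase with h' | h'
    · exact absurd h h'
    have hre' : (c2 - 1).re = δ := by rw [sub_re, hc2re]; simp
    have him' : (c2 - 1).im = 2 * γ := by rw [sub_im, hc2im]; simp
    rw [one_div, Complex.inv_re, Complex.normSq_apply, hre', him']
    have hg0 : 0 < |γ| := lt_of_lt_of_le (by positivity) h'
    rw [div_le_iff₀ (by nlinarith only [mul_pos hδpos hδpos, sq_nonneg γ])]
    have hgy : 1 ≤ y * |γ| := by
      rw [div_le_iff₀ hy0] at h'; linarith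
    have h4 : |γ| ^ 2 = γ ^ 2 := sq_abs γ
    have e1 : 2 * δ * |γ| ≤ δ * δ + 2 * γ * (2 * γ) := by
      nlinarith only [sq_nonneg (δ - |γ|), h4, sq_nonneg γ]
    have e2 : δ ≤ δ * (y * |γ|) := by nlinarith only [hδpos, hgy]
    calc δ ≤ δ * (y * |γ|) := e2
      _ = y * (δ * |γ|) := by ring
      _ ≤ y * (2 * δ * |γ|) := by
        gcongr 1; nlinarith only [mul_pos hδpos hg0]
      _ ≤ _ := by gcongr
  have b3 : -(16 * (7 * y) / (1 / 2)) - y ≤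
      (deriv (LFunction (χ ^ 2)) c2 / LFunction (χ ^ 2) c2).re := by
    split_ifs at b2 with h
    · linarith [hpole h]
    · rw [zero_re] at b2; linarith
  have h341 := three_four_one χ hσ γ
  rw [← hc1, ← hc2] at h341
  have hK := (hA (1 + δ) hσ (by linarith)).2
  rw [add_sub_cancel_left] at hK
  have hmain : 4 / b ≤ 3 / δ + A2 * y := by
    have e1 : 4 / b = 4 * (1 / b) := by ring
    have e2 : 3 / δ = 3 * (1 / δ) := by ring
    have e3 : A ≤ A * y := by nlinarith
    have e4 : b ≤ y := by linarith
    rw [e1, e2, hA2]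
    have b1' : 1 / b - 4 * b - 224 * y ≤ (deriv (LFunction χ) c1 / LFunction χ c1).re := by
      refine le_trans (le_of_eq ?_) b1
      clear_value b
      ring
    have f1 : 4 * (1 / b) - 16 * b - 896 * y ≤
      4 * (deriv (LFunction χ) c1 / LFunction χ c1).re := by linarith only [b1']
    have f2 : 3 * ∑' n : ℕ, vonMangoldt n * (n : ℝ) ^ (-(1 + δ)) ≤ 3 * (1 / δ) + 3 * A := by
      linarith only [hK]
    have f3 := h341.trans f2
    have f4 : 4 * (1 / b) ≤ 3 * (1 / δ) + 3 * A + 16 * b + 1121 * y := by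
      linarith only [f1, f3, b3]
    linarith only [f4, e3, e4]
  have h5 : 4 / (8 / 7 * δ) ≤ 4 / b := by gcongr
  have h6 : 4 / (8 / 7 * δ) = 3.5 * (1 / δ) := by field_simp; norm_num
  have h7 : 1 / δ = 4 * A2 * y := by rw [hδ, hδ']; field_simp
  have h8 : 3 / δ = 3 * (1 / δ) := by ring
  rw [h6] at h5
  rw [h8] at hmain
  rw [h7] at h5 hmain
  have : 0 < A2 * y := by positivity
  linarith

open Complex DirichletCharacter in
/-- A zero-free region implies a bound for the logarithmic derivative. -/
lemma norm_logDeriv_le_of_zero_free : ∀ κ : ℝ, 0 < κ → κ ≤ 1 → ∃ y₁ : ℝ, 6 ≤ y₁ ∧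
    ∀ y : ℝ, y₁ ≤ y →
    ∀ (q : ℕ) [NeZero q] (χ : DirichletCharacter ℂ q), χ ≠ 1 → (q : ℝ) ≤ Real.exp y →
    (∀ s : ℂ, |s.im| ≤ (3 / 2) * Real.exp y → 1 - κ / y ≤ s.re → LFunction χ s ≠ 0) →
    ∀ s : ℂ, |s.im| ≤ Real.exp y → 1 - κ / (2 * y) ≤ s.re → s.re ≤ 1 + κ / y →
      ‖deriv (LFunction χ) s / LFunction χ s‖ ≤ 448 / κ * y ^ 2 := by
  intro κ hκ0 hκ1
  obtain ⟨a, ha0, -, ha⟩ := exists_norm_LFunction_ge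
  have hlim : Filter.Tendsto (fun y : ℝ => y * Real.exp (-y)) Filter.atTop (nhds 0) := by
    simpa using Real.tendsto_pow_mul_exp_neg_atTop_nhds_zero 1
  obtain ⟨y₁, hy₁⟩ := Filter.eventually_atTop.mp (hlim.eventually (gt_mem_nhds (lt_min ha0 hκ0)))
  refine ⟨max 6 y₁, le_max_left _ _, ?_⟩
  intro y hy q _ χ hχ hq hzf s him hre1 hre2
  have hy6 : 6 ≤ y := (le_max_left _ _).trans hy
  have hy0 : 0 < y := by linarith
  have hye := hy₁ y ((le_max_right _ _).trans hy)
  have he0 := Real.exp_pos (-y)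
  have hey : 7 ≤ Real.exp y := by linarith [Real.add_one_le_exp y]
  have hay : Real.exp (-y) ≤ a := by
    have := hye.le.trans (min_le_left _ _)
    nlinarith
  set δ : ℝ := κ / y with hδ
  have hδpos : 0 < δ := by positivity
  have hδe : Real.exp (-y) ≤ δ := by
    rw [hδ, le_div_iff₀ hy0, mul_comm]
    exact hye.le.trans (min_le_right _ _)
  have hδs : δ ≤ 1 / 6 := by
    rw [hδ, div_le_iff₀ hy0]; nlinarith
  have hδ2 : κ / (2 * y) = δ / 2 := by rw [hδ]; field_simp
  rw [hδ2] at hre1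
  set c1 : ℂ := ((1 + δ : ℝ) : ℂ) + s.im * I with hc1
  have hc1re : c1.re = 1 + δ := by simp [hc1]
  have hc1im : c1.im = s.im := by simp [hc1]
  have hdist : ‖s - c1‖ ≤ 3 / 2 * δ := by
    have : s - c1 = ((s.re - (1 + δ) : ℝ) : ℂ) := by
      apply Complex.ext
      · rw [sub_re, hc1re, ofReal_re]
      · rw [sub_im, hc1im, ofReal_im]; ring
    rw [this, norm_real, Real.norm_eq_abs, abs_le]
    constructor <;> linarith
  have key := norm_logDeriv_le_of_ne_zero' (f := entireL χ) (c := c1) (r := 2 * δ) (M := 7 * y)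
    (z := s) (differentiable_entireL χ) (by positivity) (by positivity)
    (fun z hz => by
      rw [entireL_of_ne_one hχ]
      have h1 := (abs_le.mp ((Complex.abs_re_le_norm _).trans hz.le)).1
      have h2 := ((Complex.abs_im_le_norm _).trans hz.le)
      rw [sub_re, hc1re] at h1
      rw [sub_im, hc1im] at h2
      have h3 : |z.im| ≤ |z.im - s.im| + |s.im| := by
        simpa using abs_add_le (z.im - s.im) s.im
      exact hzf z (by linarith) (by linarith))
    (fun z hz => norm_entireL_le_exp_mul ha0 ha χ hy6 hay hq (by rw [hc1re]; linarith)
        (by rw [hc1re]; linarith) (by rw [hc1im]; linarith) (by linarith))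
    (by linarith)
  rw [entireL_of_ne_one hχ] at key
  refine key.trans ?_
  have h1 : δ / 2 ≤ 2 * δ - ‖s - c1‖ := by linarith
  calc 8 * (7 * y) * (2 * δ) / (2 * δ - ‖s - c1‖) ^ 2
      ≤ 8 * (7 * y) * (2 * δ) / (δ / 2) ^ 2 := by gcongr
    _ = 448 / κ * y ^ 2 := by rw [hδ]; field_simp; norm_num

open Complex LSeries in
open scoped ComplexOrder Nat in
/-- Estermann's inequality: for a Dirichlet series `F` with nonnegative coefficients and a simple
pole at `1`, the product `(β - 1) F(β) = G β` cannot be too small unless the residue is large. -/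
lemma estermann {a : ℕ → ℂ} (ha0 : 0 ≤ a) (ha1 : a 1 = 1) (has : abscissaOfAbsConv a ≤ 1)
    {G : ℂ → ℂ} (hG : Differentiable ℂ G) (hGa : ∀ s : ℂ, 1 < s.re → G s = (s - 1) * LSeries a s)
    {B : ℝ} (hB : ∀ s : ℂ, ‖s - 2‖ ≤ 4 / 3 → ‖G s‖ ≤ B) {β : ℝ} (hβ1 : β < 1) (hβ : 7 / 8 ≤ β)
    {M : ℕ} (hM : M ≠ 0) :
    1 - 39 * B * (27 / 32 : ℝ) ^ M - (G 1).re * (2 - β) ^ M / (1 - β) ≤ (G β / (β - 1)).re := by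
  set H : ℂ → ℂ := dslope G 1 with hH
  have hHd : Differentiable ℂ H := by
    have h1 : DifferentiableOn ℂ G Set.univ := hG.differentiableOn
    have := (Complex.differentiableOn_dslope (c := 1) (s := Set.univ) Filter.univ_mem).mpr h1
    exact differentiableOn_univ.mp this
  have hHval : ∀ s : ℂ, s ≠ 1 → H s = (G s - G 1) / (s - 1) := by
    intro s hs
    rw [hH, dslope_of_ne _ hs, slope_def_field]
  have hB0 : 0 ≤ B := (norm_nonneg _).trans (hB 2 (by norm_num))
  have hG1 : ‖G 1‖ ≤ B := hB 1 (by norm_num)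
  have hHB : ∀ s ∈ Metric.sphere (2 : ℂ) (4 / 3), ‖H s‖ ≤ 6 * B := by
    intro s hs
    rw [mem_sphere_iff_norm] at hs
    have h1 : 1 / 3 ≤ ‖s - 1‖ := by
      have : ‖s - 2‖ ≤ ‖s - 1‖ + 1 := by
        have := norm_sub_le (s - 1) 1
        rw [norm_one] at this
        rwa [show s - 2 = s - 1 - 1 by ring]
      linarith
    have hs1 : s ≠ 1 := by rintro rfl; norm_num at h1
    rw [hHval s hs1, norm_div, div_le_iff₀ (by linarith)]
    have := norm_sub_le (G s) (G 1)
    have := hB s hs.le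
    nlinarith
  set h : ℕ → ℂ := fun m => (-1) ^ m * (iteratedDeriv m H 2 / (m ! : ℂ)) with hh
  have hhb : ∀ m, ‖h m‖ ≤ 6 * B * (3 / 4) ^ m := by
    intro m
    have := norm_iteratedDeriv_le_of_forall_mem_sphere_norm_le m (c := (2 : ℂ)) (R := 4 / 3)
      (C := 6 * B) (by norm_num) hHd.diffContOnCl hHB
    rw [hh]
    simp only [norm_mul, norm_pow, norm_neg, norm_one, one_pow, one_mul, norm_div, Complex.norm_natCast]
    rw [div_le_iff₀ (by positivity)]
    refine this.trans (le_of_eq ?_)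
    rw [div_pow, div_pow]
    field_simp
  have hterm : ∀ (m : ℕ) (z : ℂ), h m * (2 - z) ^ m =
      ((m ! : ℂ))⁻¹ • (z - 2) ^ m • iteratedDeriv m H 2 := by
    intro m z
    rw [hh]
    simp only [smul_eq_mul]
    have : (2 - z) ^ m = (-1) ^ m * (z - 2) ^ m := by rw [← mul_pow]; ring
    rw [this]
    have h2 : ((-1 : ℂ) ^ m) * (-1) ^ m = 1 := by rw [← mul_pow]; simp
    field_simp
    linear_combination (iteratedDeriv m H 2 * (z - 2) ^ m) * h2
  have hsum : ∀ z : ℂ, HasSum (fun m => h m * (2 - z) ^ m) (H z) := by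
    intro z
    have := hasSum_taylorSeries_of_entire hHd 2 z
    have heq : (fun m => h m * (2 - z) ^ m) =
        fun n => ((n ! : ℂ))⁻¹ • (z - 2) ^ n • iteratedDeriv n H 2 := by
      funext m
      exact hterm m z
    rw [heq]
    exact this
  set b : ℕ → ℂ := fun m => (-1) ^ m * iteratedDeriv m (LSeries a) 2 with hb
  have has2 : abscissaOfAbsConv a < ((2 : ℝ) : EReal) := lt_of_le_of_lt has (by exact_mod_cast one_lt_two)
  have hb0 : ∀ m, 0 ≤ (b m).re := by
    intro m
    have := iteratedDeriv_alternating ha0 has2 m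
    exact (Complex.le_def.mp this).1
  have hhb' : ∀ m, h m = b m / (m ! : ℂ) - G 1 := by
    intro m
    have hev : H =ᶠ[nhds 2] fun s => LSeries a s - G 1 * ((1 : ℂ) * s - 1)⁻¹ := by
      have : {s : ℂ | 1 < s.re} ∈ nhds (2 : ℂ) :=
        (isOpen_lt continuous_const Complex.continuous_re).mem_nhds (by simp)
      filter_upwards [this] with s hs
      have hs1 : s ≠ 1 := by rintro rfl; simp at hs
      have hs2 : s - 1 ≠ 0 := sub_ne_zero.mpr hs1
      rw [hHval s hs1, hGa s hs]
      field_simp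
    have hd1 : ContDiffAt ℂ m (LSeries a) 2 := by
      have := LSeries_analyticOnNhd a 2 (by simpa using has2)
      exact this.contDiffAt
    have hd2 : ContDiffAt ℂ m (fun s : ℂ => ((1 : ℂ) * s - 1)⁻¹) 2 := by
      apply ContDiffAt.inv
      · fun_prop
      · norm_num
    have e1 : iteratedDeriv m H 2 = iteratedDeriv m (LSeries a) 2 - G 1 * ((-1) ^ m * m !) := by
      rw [hev.iteratedDeriv_eq]
      have : iteratedDeriv m (fun s => LSeries a s - G 1 * ((1 : ℂ) * s - 1)⁻¹) 2 =
          iteratedDeriv m (LSeries a) 2 - iteratedDeriv m (fun s => G 1 * ((1 : ℂ) * s - 1)⁻¹) 2 :=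
        iteratedDeriv_sub hd1 (contDiffAt_const.mul hd2)
      have h3 : iteratedDeriv m (fun s : ℂ => ((1 : ℂ) * s - 1)⁻¹) 2 = (-1) ^ m * m ! := by
        rw [iteratedDeriv_eq_iterate, iter_deriv_inv_linear_sub]
        norm_num
      rw [this, iteratedDeriv_const_mul _ hd2, h3]
    have h2 : ((-1 : ℂ) ^ m) * (-1) ^ m = 1 := by rw [← mul_pow]; simp
    rw [hh, hb]
    simp only
    rw [e1]
    have hm : (m ! : ℂ) ≠ 0 := by exact_mod_cast m.factorial_ne_zero
    field_simp
    linear_combination (-(G 1) * (m ! : ℂ)) * h2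
  set lam : ℝ := (G 1).re with hlam
  have hre1 : ∀ m, -lam ≤ (h m).re := by
    intro m
    have : (b m / (m ! : ℂ)).re = (b m).re / (m ! : ℝ) := by
      rw [← ofReal_natCast, div_ofReal_re]
    rw [hhb', sub_re, this]
    have : 0 ≤ (b m).re / (m ! : ℝ) := div_nonneg (hb0 m) (by positivity)
    linarith
  have hre0 : 1 - lam ≤ (h 0).re := by
    rw [hhb' 0]
    simp only [hb, pow_zero, one_mul, iteratedDeriv_zero, Nat.factorial_zero, Nat.cast_one, div_one,
      sub_re]
    have hs : LSeriesSummable a 2 :=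
      LSeriesSummable_of_abscissaOfAbsConv_lt_re (by simpa using has2)
    have h1 : (LSeries a 2).re = ∑' n, (term a 2 n).re := Complex.re_tsum hs
    have h2 := Complex.reCLM.summable hs
    have h3 : (term a 2 1).re ≤ ∑' n, (term a 2 n).re := by
      refine h2.le_tsum 1 fun n _ => ?_
      rcases Nat.eq_zero_or_pos n with rfl | hn
      · simp
      · rw [Complex.reCLM_apply, term_of_ne_zero hn.ne']
        have h4 : (n : ℂ) ^ (2 : ℂ) = (((n : ℝ) ^ 2 : ℝ) : ℂ) := by
          rw [show (2 : ℂ) = ((2 : ℕ) : ℂ) by norm_num, cpow_natCast]; push_cast; rfl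
        rw [h4, div_ofReal_re]
        exact div_nonneg (Complex.le_def.mp (ha0 n)).1 (by positivity)
    have h4 : (term a 2 1).re = 1 := by
      rw [term_of_ne_zero one_ne_zero, ha1]; simp
    linarith
  set u : ℝ := 2 - β with hu
  have hu1 : 1 < u := by rw [hu]; linarith
  have hu2 : u ≤ 9 / 8 := by rw [hu]; linarith
  have hsβ : HasSum (fun m => (h m).re * u ^ m) (H β).re := by
    have := Complex.reCLM.hasSum (hsum β)
    simp only [Complex.reCLM_apply] at this
    convert this using 2 with m
    have : (2 - (β : ℂ)) ^ m = ((u ^ m : ℝ) : ℂ) := by rw [hu]; push_cast; rfl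
    rw [this, re_mul_ofReal]
  have hβne : (β : ℂ) ≠ 1 := by exact_mod_cast hβ1.ne
  have hpart : 1 - lam * ∑ m ∈ range M, u ^ m ≤
      ∑ m ∈ range M, (h m).re * u ^ m := by
    rcases M with _ | M
    · exact absurd rfl hM
    · rw [sum_range_succ', sum_range_succ', mul_add, mul_sum]
      simp only [pow_zero, mul_one]
      have : ∑ i ∈ range M, -(lam * u ^ (i + 1)) ≤ ∑ k ∈ range M, (h (k + 1)).re * u ^ (k + 1) := by
        refine sum_le_sum fun i _ => ?_
        have := hre1 (i + 1)
        have h5 : 0 < u ^ (i + 1) := by positivity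
        nlinarith
      rw [sum_neg_distrib] at this
      linarith
  have htail : -(39 * B * (27 / 32 : ℝ) ^ M) ≤ ∑' m, (h (m + M)).re * u ^ (m + M) := by
    have hg : HasSum (fun m => 6 * B * (27 / 32 : ℝ) ^ M * (27 / 32 : ℝ) ^ m)
        (6 * B * (27 / 32 : ℝ) ^ M * (1 - 27 / 32)⁻¹) :=
      (hasSum_geometric_of_lt_one (by norm_num) (by norm_num)).mul_left _
    have h6 : ‖∑' m, (h (m + M)).re * u ^ (m + M)‖ ≤ 6 * B * (27 / 32 : ℝ) ^ M * (1 - 27 / 32)⁻¹ := by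
      refine tsum_of_norm_bounded hg fun m => ?_
      rw [norm_mul, Real.norm_eq_abs, Real.norm_of_nonneg (by positivity : 0 ≤ u ^ (m + M))]
      calc |(h (m + M)).re| * u ^ (m + M) ≤ (6 * B * (3 / 4) ^ (m + M)) * (9 / 8) ^ (m + M) := by
            gcongr
            exact (Complex.abs_re_le_norm _).trans (hhb _)
        _ = 6 * B * ((3 / 4) * (9 / 8)) ^ (m + M) := by rw [mul_pow]; ring
        _ = _ := by rw [pow_add]; norm_num; ring
    have h7 := (abs_le.mp h6).1
    have h8 : 0 ≤ B * (27 / 32 : ℝ) ^ M := by positivity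
    have h9 : 6 * B * (27 / 32 : ℝ) ^ M * (1 - 27 / 32)⁻¹ = 38.4 * (B * (27 / 32 : ℝ) ^ M) := by
      norm_num; ring
    rw [h9] at h7
    linarith
  have hsplit := hsβ.summable.sum_add_tsum_nat_add M
  rw [hsβ.tsum_eq] at hsplit
  have hgeom : ∑ m ∈ range M, u ^ m = (u ^ M - 1) / (1 - β) := by
    rw [geom_sum_eq hu1.ne', hu]; congr 1; ring
  have hGβ : (G β / (β - 1)).re = (H β).re - lam / (1 - β) := by
    have : G β / (β - 1) = H β + G 1 / ((β - 1 : ℝ) : ℂ) := by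
      rw [hHval _ hβne]
      have : (β : ℂ) - 1 ≠ 0 := sub_ne_zero.mpr hβne
      push_cast
      field_simp
      ring
    rw [this, add_re, div_ofReal_re, hlam]
    have : β - 1 = -(1 - β) := by ring
    rw [this, div_neg]; ring
  have h1β : 0 < 1 - β := by linarith
  rw [hGβ]
  rw [hgeom] at hpart
  have e5 : lam * ((u ^ M - 1) / (1 - β)) = lam * u ^ M / (1 - β) - lam / (1 - β) := by ring
  rw [e5] at hpart
  linarith

open ArithmeticFunction in
/-- `a` is normalised and its formal logarithmic derivative has coefficients `c`. -/
def HasLogDeriv (a c : ArithmeticFunction ℂ) : Prop :=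
  a 1 = 1 ∧ ∀ n : ℕ, a n * (Real.log n : ℂ) = (c * a) n

open ArithmeticFunction in
lemma HasLogDeriv.mul {a b c d : ArithmeticFunction ℂ} (h : HasLogDeriv a c)
    (h' : HasLogDeriv b d) : HasLogDeriv (a * b) (c + d) := by
  refine ⟨by rw [ArithmeticFunction.mul_apply]; simp [h.1, h'.1], fun n => ?_⟩
  have e1 : (c + d) * (a * b) = (c * a) * b + a * (d * b) := by ring
  rw [e1, ArithmeticFunction.add_apply, ArithmeticFunction.mul_apply (f := a) (g := b),
    ArithmeticFunction.mul_apply (f := c * a), ArithmeticFunction.mul_apply (f := a) (g := d * b),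
    ← sum_add_distrib, sum_mul]
  refine sum_congr rfl fun x hx => ?_
  obtain ⟨hx1, hx0⟩ := Nat.mem_divisorsAntidiagonal.mp hx
  have hl : Real.log n = Real.log x.1 + Real.log x.2 := by
    rw [← hx1, Nat.cast_mul, Real.log_mul]
    · rintro h; apply hx0; rw [← hx1, Nat.cast_eq_zero.mp h, zero_mul]
    · rintro h; apply hx0; rw [← hx1, Nat.cast_eq_zero.mp h, mul_zero]
  rw [← h.2, ← h'.2, hl]
  push_cast
  ring

open ArithmeticFunction in
open scoped ComplexOrder in
lemma HasLogDeriv.nonneg {a c : ArithmeticFunction ℂ} (h : HasLogDeriv a c) (hc1 : c 1 = 0)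
    (hc : ∀ n, 0 ≤ c n) (n : ℕ) : 0 ≤ a n := by
  induction n using Nat.strong_induction_on with
  | _ n ih =>
    rcases Nat.lt_or_ge n 2 with hn | hn
    · interval_cases n
      · simp
      · rw [h.1]; exact zero_le_one
    · have hlog : 0 < Real.log n := Real.log_pos (by exact_mod_cast hn)
      have h1 : 0 ≤ a n * (Real.log n : ℂ) := by
        rw [h.2, ArithmeticFunction.mul_apply]
        refine sum_nonneg fun x hx => ?_
        obtain ⟨hx1, hx0⟩ := Nat.mem_divisorsAntidiagonal.mp hx
        by_cases hx2 : x.1 = 1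
        · rw [hx2, hc1, zero_mul]
        · refine mul_nonneg (hc _) (ih _ ?_)
          have : 2 ≤ x.1 := by
            have : x.1 ≠ 0 := by rintro h; apply hx0; rw [← hx1, h, zero_mul]
            omega
          have : x.2 ≠ 0 := by rintro h; apply hx0; rw [← hx1, h, mul_zero]
          rw [← hx1]
          nlinarith [Nat.pos_of_ne_zero this]
      have h2 : a n = a n * (Real.log n : ℂ) * ((Real.log n)⁻¹ : ℝ) := by
        rw [mul_assoc, ← Complex.ofReal_mul, mul_inv_cancel₀ hlog.ne']; simp
      rw [h2]
      exact mul_nonneg h1 (by exact_mod_cast (inv_pos.mpr hlog).le)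

/-- The coefficients of a Dirichlet `L`-series as an arithmetic function. -/
noncomputable def charFun {q : ℕ} (χ : DirichletCharacter ℂ q) : ArithmeticFunction ℂ :=
  toArithmeticFunction (fun n => χ n)

/-- The coefficients of the logarithmic derivative of a Dirichlet `L`-series. -/
noncomputable def charLogDeriv {q : ℕ} (χ : DirichletCharacter ℂ q) : ArithmeticFunction ℂ :=
  toArithmeticFunction (fun n => χ n * (ArithmeticFunction.vonMangoldt n : ℂ))

open ArithmeticFunction in
lemma hasLogDeriv_char {q : ℕ} (χ : DirichletCharacter ℂ q) :
    HasLogDeriv (charFun χ) (charLogDeriv χ) := by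
  refine ⟨by simp [charFun, toArithmeticFunction], fun n => ?_⟩
  have h := congrFun (DirichletCharacter.convolution_twist_vonMangoldt χ) n
  rw [LSeries.convolution] at h
  simp only [Pi.mul_apply] at h
  change (charLogDeriv χ * charFun χ) n = _ at h
  rw [h]
  rcases eq_or_ne n 0 with rfl | hn
  · simp
  · simp [charFun, toArithmeticFunction, hn, Complex.ofReal_log]

open ArithmeticFunction LSeries in
lemma char_LSeriesSummable {q : ℕ} (χ : DirichletCharacter ℂ q) {s : ℂ} (hs : 1 < s.re) :
    LSeriesSummable (charFun χ) s := by
  refine (LSeriesSummable_congr s (fun {n} hn => ?_)).mp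
    (DirichletCharacter.LSeriesSummable_of_one_lt_re χ hs)
  simp [charFun, toArithmeticFunction, hn]

open ArithmeticFunction LSeries in
lemma char_LSeries {q : ℕ} [NeZero q] (χ : DirichletCharacter ℂ q) {s : ℂ} (hs : 1 < s.re) :
    LSeries (charFun χ) s =
      DirichletCharacter.LFunction χ s := by
  rw [DirichletCharacter.LFunction_eq_LSeries χ hs]
  exact LSeries_congr (fun {n} hn => by simp [charFun, toArithmeticFunction, hn]) s

open scoped ComplexOrder in
/-- An entire function which is `(s - 1)` times a Dirichlet series with nonnegative coefficients
is real on the positive real axis. -/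
lemma im_eq_zero_of_nonneg {a : ℕ → ℂ} (ha0 : 0 ≤ a)
    {G : ℂ → ℂ} (hG : Differentiable ℂ G) (hGa : ∀ s : ℂ, 1 < s.re → G s = (s - 1) * LSeries a s)
    {x : ℝ} (hx : 0 < x) : (G x).im = 0 := by
  have hreal : ∀ n, (starRingEnd ℂ) (a n) = a n := fun n =>
    Complex.conj_eq_iff_im.mpr (Complex.le_def.mp (ha0 n)).2.symm
  have h := eq_of_eq_on_one_lt_re (F := G)
    (G := (starRingEnd ℂ) ∘ G ∘ (starRingEnd ℂ)) (θ := 0) zero_le_one hG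
    (fun s _ => by
      have := (hG ((starRingEnd ℂ) s)).conj_conj
      simpa using this) (fun s hs => ?_) (s := x) (by simpa using hx)
  · simp only [Function.comp_apply, Complex.conj_ofReal] at h
    exact Complex.conj_eq_iff_im.mp h.symm
  · simp only [Function.comp_apply]
    rw [hGa s hs, hGa _ (by simpa using hs), map_mul, LSeries, LSeries, Complex.conj_tsum]
    congr 1
    · simp
    · refine tsum_congr fun n => ?_
      rcases eq_or_ne n 0 with rfl | hn
      · simp
      · rw [LSeries.term_of_ne_zero hn, LSeries.term_of_ne_zero hn, map_div₀, hreal,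
          Complex.cpow_conj _ _ (by rw [Complex.natCast_arg]; exact Real.pi_pos.ne)]
        simp

lemma exists_pow_choice {B : ℝ} (hB : 1 ≤ B) : ∃ M : ℕ, M ≠ 0 ∧
    39 * B * (27 / 32 : ℝ) ^ M ≤ 1 / 2 ∧ (M : ℝ) ≤ 6 * Real.log (78 * B) + 1 := by
  have hl : 0 < Real.log (78 * B) := Real.log_pos (by linarith)
  refine ⟨⌈6 * Real.log (78 * B)⌉₊, (Nat.ceil_pos.mpr (by linarith)).ne', ?_,
    (Nat.ceil_lt_add_one (by linarith)).le⟩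
  set M := ⌈6 * Real.log (78 * B)⌉₊
  have hM : 6 * Real.log (78 * B) ≤ M := Nat.le_ceil _
  have h1 : (27 / 32 : ℝ) ≤ Real.exp (-(1 / 6)) := by
    have h : Real.exp (1 / 6) ≤ 32 / 27 := by
      refine le_of_pow_le_pow_left₀ (n := 6) (by norm_num) (by norm_num) ?_
      rw [← Real.exp_nat_mul]
      norm_num
      exact Real.exp_one_lt_d9.le.trans (by norm_num)
    rw [Real.exp_neg, show (27 / 32 : ℝ) = (32 / 27)⁻¹ by norm_num]
    gcongr
  have h2 : (27 / 32 : ℝ) ^ M ≤ (78 * B)⁻¹ := by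
    calc (27 / 32 : ℝ) ^ M ≤ Real.exp (-(1 / 6)) ^ M := by gcongr
      _ = Real.exp (M * (-(1 / 6))) := by rw [Real.exp_nat_mul]
      _ ≤ Real.exp (-Real.log (78 * B)) := Real.exp_le_exp.mpr (by linarith)
      _ = _ := by rw [Real.exp_neg, Real.exp_log (by linarith)]
  calc 39 * B * (27 / 32 : ℝ) ^ M ≤ 39 * B * (78 * B)⁻¹ := by gcongr
    _ = 1 / 2 := by field_simp; norm_num

open Complex LSeries in
open scoped ComplexOrder in
/-- If `G β` has the wrong sign then the residue `G 1` cannot be too small. -/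
lemma estermann_norm {a : ℕ → ℂ} (ha0 : 0 ≤ a) (ha1 : a 1 = 1)
    (has : ∀ s : ℂ, 1 < s.re → LSeriesSummable a s)
    {G : ℂ → ℂ} (hG : Differentiable ℂ G) (hGa : ∀ s : ℂ, 1 < s.re → G s = (s - 1) * LSeries a s)
    {B : ℝ} (hB1 : 1 ≤ B) (hB : ∀ s : ℂ, ‖s - 2‖ ≤ 4 / 3 → ‖G s‖ ≤ B) {β : ℝ} (hβ1 : β < 1)
    (hβ : 7 / 8 ≤ β) (hGβ : 0 ≤ (G β).re) :
    1 - β ≤ 6 * ‖G 1‖ * (78 * B) ^ (6 * (1 - β)) := by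
  obtain ⟨M, hM0, hM1, hM2⟩ := exists_pow_choice hB1
  have habs : abscissaOfAbsConv a ≤ 1 :=
    abscissaOfAbsConv_le_of_forall_lt_LSeriesSummable' fun y hy => has y (by
      rw [ofReal_re]; exact_mod_cast hy)
  have h := estermann ha0 ha1 habs hG hGa hB hβ1 hβ hM0
  have h1 : (G β / (β - 1)).re ≤ 0 := by
    have : (G β / (β - 1)).re = (G β).re / (β - 1) := by
      rw [← ofReal_one, ← ofReal_sub, div_ofReal_re]
    rw [this]
    exact div_nonpos_of_nonneg_of_nonpos hGβ (by linarith)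
  have h2 : (2 - β) ^ M ≤ 3 * (78 * B) ^ (6 * (1 - β)) := by
    have h3 : 2 - β ≤ Real.exp (1 - β) := by have := Real.add_one_le_exp (1 - β); linarith
    calc (2 - β) ^ M ≤ Real.exp (1 - β) ^ M := by gcongr; linarith
      _ = Real.exp (M * (1 - β)) := by rw [Real.exp_nat_mul]
      _ ≤ Real.exp (1 + Real.log (78 * B) * (6 * (1 - β))) := by
          apply Real.exp_le_exp.mpr
          nlinarith
      _ = Real.exp 1 * (78 * B) ^ (6 * (1 - β)) := by
          rw [Real.exp_add, Real.rpow_def_of_pos (by linarith)]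
      _ ≤ _ := by
          gcongr
          exact Real.exp_one_lt_d9.le.trans (by norm_num)
  have h4 : (G 1).re * (2 - β) ^ M ≤ ‖G 1‖ * (3 * (78 * B) ^ (6 * (1 - β))) := by
    calc (G 1).re * (2 - β) ^ M ≤ ‖G 1‖ * (2 - β) ^ M := by
          gcongr
          · exact pow_nonneg (by linarith) _
          · exact re_le_norm _
      _ ≤ _ := by gcongr
  have h5 : 1 / 2 ≤ (G 1).re * (2 - β) ^ M / (1 - β) := by linarith
  rw [le_div_iff₀ (by linarith)] at h5
  linarith

open scoped ComplexOrder in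
lemma quadratic_apply {q : ℕ} {χ : DirichletCharacter ℂ q} (hχ : χ ^ 2 = 1) (n : ZMod q) :
    χ n = 0 ∨ χ n = 1 ∨ χ n = -1 := by
  by_cases hn : IsUnit n
  · right
    have h : (χ ^ 2) n = 1 := by rw [hχ]; exact MulChar.one_apply hn
    rw [MulChar.pow_apply' _ two_ne_zero] at h
    exact sq_eq_one_iff.mp h
  · left; exact χ.map_nonunit hn

lemma charLogDeriv_apply {q : ℕ} (χ : DirichletCharacter ℂ q) (n : ℕ) :
    charLogDeriv χ n = χ n * (ArithmeticFunction.vonMangoldt n : ℂ) := by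
  rcases eq_or_ne n 0 with rfl | hn
  · simp
  · simp [charLogDeriv, toArithmeticFunction, hn]

lemma norm_entireL_le_of_norm_sub_two_le {q : ℕ} [NeZero q] (χ : DirichletCharacter ℂ q) {s : ℂ}
    (hs : ‖s - 2‖ ≤ 4 / 3) : ‖entireL χ s‖ ≤ 100 * q := by
  have h1 : 1 / 4 ≤ s.re := by
    have := (abs_le.mp ((Complex.abs_re_le_norm (s - 2)).trans hs)).1
    simp at this
    linarith
  have h2 : ‖s‖ ≤ 10 / 3 := by
    have := norm_add_le (s - 2) 2
    rw [sub_add_cancel] at this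
    norm_num at this
    linarith
  refine (norm_entireL_le χ h1).trans ?_
  have : (‖s‖ + 1) ^ 2 ≤ (13 / 3) ^ 2 := by gcongr; linarith
  have hq : (0 : ℝ) ≤ q := by positivity
  nlinarith

open Complex DirichletCharacter ArithmeticFunction in
open scoped ComplexOrder in
lemma siegel_of_no_zero : ∃ δ₀ : ℝ, 0 < δ₀ ∧ ∀ δ : ℝ, 0 < δ → δ ≤ δ₀ → δ ≤ 1 / 8 →
    ∀ (q : ℕ) [NeZero q] (χ : DirichletCharacter ℂ q), χ ≠ 1 → χ ^ 2 = 1 →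
    (∀ x : ℝ, 1 - δ ≤ x → x < 1 → LFunction χ x ≠ 0) →
    δ ≤ 120 * ‖LFunction χ 1‖ * (780000 * q) ^ (6 * δ) := by
  set E : ℂ → ℂ := entireL (1 : DirichletCharacter ℂ 1) with hE
  have hEd : Differentiable ℂ E := differentiable_entireL 1
  have hE1 : E 1 ≠ 0 := entireL_ne_zero 1 (by simp)
  have hev : ∀ᶠ x : ℝ in nhds 1, E x ≠ 0 := by
    have hc : ContinuousAt (fun x : ℝ => E x) 1 :=
      (hEd.continuous.comp continuous_ofReal).continuousAt
    exact hc.eventually_ne (by simpa using hE1)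
  obtain ⟨δ₀, hδ₀, hball⟩ := Metric.eventually_nhds_iff.mp hev
  refine ⟨δ₀ / 2, by positivity, fun δ hδ hδ1 hδ8 q _ χ hχ hχ2 hz => ?_⟩
  set A : ArithmeticFunction ℂ := charFun (1 : DirichletCharacter ℂ 1) * charFun χ with hA
  have hlog : HasLogDeriv A (charLogDeriv (1 : DirichletCharacter ℂ 1) + charLogDeriv χ) :=
    (hasLogDeriv_char _).mul (hasLogDeriv_char _)
  have ha0 : (0 : ℕ → ℂ) ≤ A := by
    intro n
    refine hlog.nonneg (by simp [charLogDeriv_apply]) (fun n => ?_) n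
    have h1 : (1 : DirichletCharacter ℂ 1) n = 1 := by
      rw [Subsingleton.elim (n : ZMod 1) 1, map_one]
    rw [ArithmeticFunction.add_apply, charLogDeriv_apply, charLogDeriv_apply, h1, ← add_mul]
    refine mul_nonneg ?_ (by exact_mod_cast vonMangoldt_nonneg)
    rcases quadratic_apply hχ2 n with h | h | h <;> rw [h] <;> norm_num
  have has : ∀ s : ℂ, 1 < s.re → LSeriesSummable A s := fun s hs =>
    LSeriesSummable_mul (char_LSeriesSummable _ hs) (char_LSeriesSummable _ hs)
  set G : ℂ → ℂ := fun s => E s * LFunction χ s with hG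
  have hGd : Differentiable ℂ G := hEd.mul (differentiable_LFunction hχ)
  have hGa : ∀ s : ℂ, 1 < s.re → G s = (s - 1) * LSeries A s := by
    intro s hs
    rw [hA, LSeries_mul' (char_LSeriesSummable _ hs) (char_LSeriesSummable _ hs)]
    rw [char_LSeries _ hs, char_LSeries _ hs, hG]
    simp only
    rw [hE, entireL_one_apply (by rintro rfl; simp at hs)]
    ring
  have hGim : ∀ x : ℝ, 0 < x → (G x).im = 0 := fun x hx => im_eq_zero_of_nonneg ha0 hGd hGa hx
  have hGne : ∀ x : ℝ, 1 - δ ≤ x → G x ≠ 0 := by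
    intro x hx
    rcases lt_or_ge x 1 with h1 | h1
    · refine mul_ne_zero (hball ?_) (hz x hx h1)
      rw [Real.dist_eq, abs_lt]; constructor <;> linarith
    · refine mul_ne_zero (entireL_ne_zero 1 (by simpa using h1)) ?_
      rw [← entireL_of_ne_one hχ]
      exact entireL_ne_zero χ (by simpa using h1)
  have habs : LSeries.abscissaOfAbsConv A ≤ 1 :=
    LSeries.abscissaOfAbsConv_le_of_forall_lt_LSeriesSummable' fun y hy => has y (by
      rw [ofReal_re]; exact_mod_cast hy)
  have hG2 : 0 ≤ (G (2 : ℝ)).re := by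
    have h := LSeries.positive ha0 (by rw [hlog.1]; exact zero_lt_one) (x := 2)
      (lt_of_le_of_lt habs (by exact_mod_cast one_lt_two))
    rw [hGa _ (by simp)]
    have h3 : (((2 : ℝ) : ℂ) - 1) = 1 := by push_cast; norm_num
    rw [h3, one_mul]
    exact (Complex.le_def.mp h.le).1
  have hβ : 0 ≤ (G ((1 - δ : ℝ) : ℂ)).re := by
    by_contra! hneg
    have hc : ContinuousOn (fun x : ℝ => (G x).re) (Set.Icc (1 - δ) 2) :=
      (continuous_re.comp (hGd.continuous.comp continuous_ofReal)).continuousOn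
    obtain ⟨x, hx, hx0⟩ := intermediate_value_Icc (by linarith) hc ⟨hneg.le, hG2⟩
    exact hGne x hx.1 (Complex.ext hx0 (hGim x (by linarith [hx.1])))
  have hq : (1 : ℝ) ≤ q := by exact_mod_cast NeZero.one_le
  have hBd : ∀ s : ℂ, ‖s - 2‖ ≤ 4 / 3 → ‖G s‖ ≤ 10000 * q := by
    intro s hs
    have h1 := norm_entireL_le_of_norm_sub_two_le (1 : DirichletCharacter ℂ 1) hs
    have h2 := norm_entireL_le_of_norm_sub_two_le χ hs
    rw [entireL_of_ne_one hχ] at h2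
    rw [hG]
    simp only [norm_mul]
    calc ‖E s‖ * ‖LFunction χ s‖ ≤ (100 * (1 : ℕ)) * (100 * q) := by gcongr
      _ = _ := by push_cast; ring
  have hfin := estermann_norm ha0 hlog.1 has hGd hGa (by linarith) hBd (β := 1 - δ) (by linarith)
    (by linarith) hβ
  have hE1b : ‖E 1‖ ≤ 20 := by
    have := norm_entireL_le (1 : DirichletCharacter ℂ 1) (s := 1) (by norm_num)
    norm_num at this
    exact this
  have e1 : 1 - (1 - δ) = δ := by ring
  rw [e1] at hfin
  calc δ ≤ 6 * ‖G 1‖ * (78 * (10000 * q)) ^ (6 * δ) := hfin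
    _ ≤ 6 * (20 * ‖LFunction χ 1‖) * (78 * (10000 * q)) ^ (6 * δ) := by
        rw [hG]; simp only [norm_mul]; gcongr
    _ = _ := by ring_nf

open DirichletCharacter in
/-- The product of two Dirichlet characters as a character modulo the product of the moduli. -/
noncomputable def prodChar {q r : ℕ} (χ : DirichletCharacter ℂ q) (ψ : DirichletCharacter ℂ r) :
    DirichletCharacter ℂ (q * r) :=
  changeLevel (dvd_mul_right q r) χ * changeLevel (dvd_mul_left r q) ψ

open DirichletCharacter in
lemma prodChar_apply {q r : ℕ} (χ : DirichletCharacter ℂ q) (ψ : DirichletCharacter ℂ r) (n : ℕ) :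
    prodChar χ ψ n = χ n * ψ n := by
  by_cases hn : n.Coprime (q * r)
  · have hc : IsCoprime (n : ℤ) ((q * r : ℕ) : ℤ) := Nat.isCoprime_iff_coprime.mpr hn
    have h1 := changeLevel_eq_cast_of_dvd' χ (dvd_mul_right q r) hc
    have h2 := changeLevel_eq_cast_of_dvd' ψ (dvd_mul_left r q) hc
    rw [prodChar, MulChar.mul_apply]
    simp only [Int.cast_natCast] at h1 h2
    rw [h1, h2]
  · have h0 : ¬ IsUnit ((n : ℕ) : ZMod (q * r)) := by rwa [ZMod.isUnit_iff_coprime]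
    rw [MulChar.map_nonunit _ h0]
    rw [Nat.coprime_mul_iff_right, not_and_or] at hn
    rcases hn with h | h
    · rw [χ.map_nonunit (by rwa [ZMod.isUnit_iff_coprime]), zero_mul]
    · rw [ψ.map_nonunit (by rwa [ZMod.isUnit_iff_coprime]), mul_zero]

open Complex DirichletCharacter ArithmeticFunction in
open scoped ComplexOrder in
lemma siegel_of_zero {q r : ℕ} [NeZero q] [NeZero r] {χ : DirichletCharacter ℂ q}
    {ψ : DirichletCharacter ℂ r} (hχ : χ ≠ 1) (hψ : ψ ≠ 1) (hχ2 : χ ^ 2 = 1) (hψ2 : ψ ^ 2 = 1)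
    (hne : prodChar χ ψ ≠ 1) {β : ℝ} (hβ1 : β < 1) (hβ : 7 / 8 ≤ β) (hz : LFunction χ β = 0) :
    1 - β ≤ 120 * (‖LFunction χ 1‖ * ‖LFunction ψ 1‖ * ‖LFunction (prodChar χ ψ) 1‖) *
      (7800000000 * ((q * r : ℕ) : ℝ) ^ 2) ^ (6 * (1 - β)) := by
  have hqr : NeZero (q * r) := inferInstance
  set E : ℂ → ℂ := entireL (1 : DirichletCharacter ℂ 1) with hE
  have hEd : Differentiable ℂ E := differentiable_entireL 1
  set A1 : ArithmeticFunction ℂ := charFun (1 : DirichletCharacter ℂ 1) * charFun χ with hA1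
  set A2 : ArithmeticFunction ℂ := charFun ψ * charFun (prodChar χ ψ) with hA2
  have hlog : HasLogDeriv (A1 * A2) ((charLogDeriv (1 : DirichletCharacter ℂ 1) + charLogDeriv χ)
      + (charLogDeriv ψ + charLogDeriv (prodChar χ ψ))) :=
    ((hasLogDeriv_char _).mul (hasLogDeriv_char _)).mul
      ((hasLogDeriv_char _).mul (hasLogDeriv_char _))
  have ha0 : (0 : ℕ → ℂ) ≤ (A1 * A2 : ArithmeticFunction ℂ) := by
    intro n
    refine hlog.nonneg (by simp [charLogDeriv_apply]) (fun n => ?_) n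
    have h1 : (1 : DirichletCharacter ℂ 1) n = 1 := by
      rw [Subsingleton.elim (n : ZMod 1) 1, map_one]
    simp only [ArithmeticFunction.add_apply, charLogDeriv_apply, h1, prodChar_apply, ← add_mul]
    refine mul_nonneg ?_ (by exact_mod_cast vonMangoldt_nonneg)
    rcases quadratic_apply hχ2 n with h | h | h <;>
      rcases quadratic_apply hψ2 n with h' | h' | h' <;> rw [h, h'] <;> norm_num
  have has1 : ∀ s : ℂ, 1 < s.re → LSeriesSummable A1 s := fun s hs =>
    LSeriesSummable_mul (char_LSeriesSummable _ hs) (char_LSeriesSummable _ hs)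
  have has2 : ∀ s : ℂ, 1 < s.re → LSeriesSummable A2 s := fun s hs =>
    LSeriesSummable_mul (char_LSeriesSummable _ hs) (char_LSeriesSummable _ hs)
  have has : ∀ s : ℂ, 1 < s.re → LSeriesSummable (A1 * A2 : ArithmeticFunction ℂ) s := fun s hs =>
    LSeriesSummable_mul (has1 s hs) (has2 s hs)
  set G : ℂ → ℂ := fun s =>
    (E s * LFunction χ s) * (LFunction ψ s * LFunction (prodChar χ ψ) s) with hG
  have hGd : Differentiable ℂ G := (hEd.mul (differentiable_LFunction hχ)).mul
    ((differentiable_LFunction hψ).mul (differentiable_LFunction hne))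
  have hGa : ∀ s : ℂ, 1 < s.re → G s = (s - 1) * LSeries (A1 * A2 : ArithmeticFunction ℂ) s := by
    intro s hs
    rw [LSeries_mul' (has1 s hs) (has2 s hs), hA1, hA2,
      LSeries_mul' (char_LSeriesSummable _ hs) (char_LSeriesSummable _ hs),
      LSeries_mul' (char_LSeriesSummable _ hs) (char_LSeriesSummable _ hs),
      char_LSeries _ hs, char_LSeries _ hs, char_LSeries _ hs, char_LSeries _ hs, hG]
    simp only
    rw [hE, entireL_one_apply (by rintro rfl; simp at hs)]
    ring
  have hq : (1 : ℝ) ≤ ((q * r : ℕ) : ℝ) := by exact_mod_cast NeZero.one_le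
  have hBd : ∀ s : ℂ, ‖s - 2‖ ≤ 4 / 3 → ‖G s‖ ≤ 100000000 * ((q * r : ℕ) : ℝ) ^ 2 := by
    intro s hs
    have h1 := norm_entireL_le_of_norm_sub_two_le (1 : DirichletCharacter ℂ 1) hs
    have h2 := norm_entireL_le_of_norm_sub_two_le χ hs
    have h3 := norm_entireL_le_of_norm_sub_two_le ψ hs
    have h4 := norm_entireL_le_of_norm_sub_two_le (prodChar χ ψ) hs
    rw [entireL_of_ne_one hχ] at h2
    rw [entireL_of_ne_one hψ] at h3
    rw [entireL_of_ne_one hne] at h4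
    rw [hG]
    simp only [norm_mul]
    calc ‖E s‖ * ‖LFunction χ s‖ * (‖LFunction ψ s‖ * ‖LFunction (prodChar χ ψ) s‖)
        ≤ (100 * (1 : ℕ)) * (100 * q) * ((100 * r) * (100 * ((q * r : ℕ) : ℝ))) := by gcongr
      _ = _ := by push_cast; ring
  have hfin := estermann_norm ha0 hlog.1 has hGd hGa (by nlinarith) hBd hβ1 hβ (by simp [hG, hz])
  have hE1b : ‖E 1‖ ≤ 20 := by
    have := norm_entireL_le (1 : DirichletCharacter ℂ 1) (s := 1) (by norm_num)
    norm_num at this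
    exact this
  have hG1 : ‖G 1‖ ≤
      20 * (‖LFunction χ 1‖ * ‖LFunction ψ 1‖ * ‖LFunction (prodChar χ ψ) 1‖) := by
    rw [hG]
    simp only [norm_mul]
    calc ‖E 1‖ * ‖LFunction χ 1‖ * (‖LFunction ψ 1‖ * ‖LFunction (prodChar χ ψ) 1‖)
        ≤ 20 * ‖LFunction χ 1‖ * (‖LFunction ψ 1‖ * ‖LFunction (prodChar χ ψ) 1‖) := by gcongr
      _ = _ := by ring
  calc 1 - β ≤ 6 * ‖G 1‖ * (78 * (100000000 * ((q * r : ℕ) : ℝ) ^ 2)) ^ (6 * (1 - β)) := hfin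
    _ ≤ 6 * (20 * (‖LFunction χ 1‖ * ‖LFunction ψ 1‖ * ‖LFunction (prodChar χ ψ) 1‖)) *
          (78 * (100000000 * ((q * r : ℕ) : ℝ) ^ 2)) ^ (6 * (1 - β)) := by
        gcongr
    _ = _ := by
      rw [← mul_assoc (78 : ℝ), ← mul_assoc (6 : ℝ) 20]; norm_num

open DirichletCharacter in
lemma level_eq_of_prodChar_eq_one {q r : ℕ} [NeZero q] [NeZero r] {χ : DirichletCharacter ℂ q}
    {ψ : DirichletCharacter ℂ r} (hχ : χ.IsPrimitive) (hψ : ψ.IsPrimitive)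
    (h : prodChar χ ψ = 1) : q = r := by
  have h1 : changeLevel (dvd_mul_right q r) χ = (changeLevel (dvd_mul_left r q) ψ)⁻¹ :=
    eq_inv_of_mul_eq_one_left h
  have h2 := congrArg conductor h1
  rw [conductor_inv, conductor_changeLevel, conductor_changeLevel] at h2
  exact hχ.symm.trans (h2.trans hψ)

open DirichletCharacter in
/-- **Siegel's theorem**: a lower bound for `L(1, χ)` for quadratic characters. -/
theorem siegel {ε : ℝ} (hε : 0 < ε) : ∃ c : ℝ, 0 < c ∧ ∀ (q : ℕ) [NeZero q]
    (χ : DirichletCharacter ℂ q), χ.IsPrimitive → χ ≠ 1 → χ ^ 2 = 1 →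
    c ≤ ‖LFunction χ 1‖ * (q : ℝ) ^ ε := by
  obtain ⟨δ₀, hδ₀, hno⟩ := siegel_of_no_zero
  set δ : ℝ := min δ₀ (min (1 / 8) (ε / 13)) with hδdef
  have hδ : 0 < δ := by positivity
  have hδ1 : δ ≤ δ₀ := min_le_left _ _
  have hδ2 : δ ≤ 1 / 8 := (min_le_right _ _).trans (min_le_left _ _)
  have hδ3 : δ ≤ ε / 13 := (min_le_right _ _).trans (min_le_right _ _)
  clear_value δ
  by_cases hcase : ∃ (q₁ : ℕ) (_ : NeZero q₁) (χ₁ : DirichletCharacter ℂ q₁) (β : ℝ),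
      χ₁.IsPrimitive ∧ χ₁ ≠ 1 ∧ χ₁ ^ 2 = 1 ∧ 1 - δ ≤ β ∧ β < 1 ∧ LFunction χ₁ β = 0
  · obtain ⟨q₁, _, χ₁, β, hp₁, hχ₁, hχ₁2, hβ, hβ1, hz⟩ := hcase
    have hne : (univ.filter fun χ : DirichletCharacter ℂ q₁ => χ ≠ 1).Nonempty :=
      ⟨χ₁, by simpa using hχ₁⟩
    obtain ⟨χ₂, hχ₂, hmin⟩ := exists_min_image _ (fun χ => ‖LFunction χ 1‖) hne
    have hχ₂' : χ₂ ≠ 1 := by simpa using hχ₂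
    have hc₂ : 0 < ‖LFunction χ₂ 1‖ := norm_pos_iff.mpr (LFunction_apply_one_ne_zero hχ₂')
    set K : ℝ := 120 * ‖LFunction χ₁ 1‖ * (q₁ : ℝ) ^ (13 * δ) * 7800000000 ^ (6 * δ) / δ with hK
    have hK0 : 0 ≤ K := by positivity
    have hβ0 : 0 < 1 - β := by linarith
    refine ⟨min ‖LFunction χ₂ 1‖ ((1 - β) / (K + 1)), by positivity, ?_⟩
    intro q _ χ hp hχ hχ2
    have hq : (1 : ℝ) ≤ q := by exact_mod_cast NeZero.one_le
    have hq₁ : (1 : ℝ) ≤ q₁ := by exact_mod_cast NeZero.one_le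
    have hqε : 1 ≤ (q : ℝ) ^ ε := Real.one_le_rpow hq hε.le
    by_cases hprod : prodChar χ₁ χ = 1
    · have hqq := level_eq_of_prodChar_eq_one hp₁ hp hprod
      subst hqq
      refine (min_le_left _ _).trans ((hmin χ (by simpa using hχ)).trans ?_)
      exact le_mul_of_one_le_right (norm_nonneg _) hqε
    · refine (min_le_right _ _).trans ?_
      have hqr : NeZero (q₁ * q) := inferInstance
      have h1 := siegel_of_zero hχ₁ hχ hχ₁2 hχ2 hprod hβ1 (by linarith) hz
      have h2 := norm_LFunction_le hprod hδ.le (by linarith) (s := 1) (by simpa using hδ)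
      rw [norm_one, one_mul, Complex.one_re, sub_sub_cancel] at h2
      have hN : (1 : ℝ) ≤ ((q₁ * q : ℕ) : ℝ) := by exact_mod_cast NeZero.one_le
      have h3 : (7800000000 * ((q₁ * q : ℕ) : ℝ) ^ 2) ^ (6 * (1 - β)) ≤
          (7800000000 * ((q₁ * q : ℕ) : ℝ) ^ 2) ^ (6 * δ) := by
        apply Real.rpow_le_rpow_of_exponent_le
        · nlinarith
        · linarith
      have h4 : (7800000000 * ((q₁ * q : ℕ) : ℝ) ^ 2) ^ (6 * δ) =
          7800000000 ^ (6 * δ) * ((q₁ * q : ℕ) : ℝ) ^ (12 * δ) := by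
        rw [Real.mul_rpow (by norm_num) (by positivity), ← Real.rpow_natCast, ← Real.rpow_mul
          (by positivity)]
        congr 2; push_cast; ring
      have h5 : ((q₁ * q : ℕ) : ℝ) ^ δ * ((q₁ * q : ℕ) : ℝ) ^ (12 * δ) =
          (q₁ : ℝ) ^ (13 * δ) * (q : ℝ) ^ (13 * δ) := by
        rw [← Real.rpow_add (by positivity), Nat.cast_mul, Real.mul_rpow (by positivity)
          (by positivity)]
        congr 2 <;> ring
      have h6 : (q : ℝ) ^ (13 * δ) ≤ (q : ℝ) ^ ε :=
        Real.rpow_le_rpow_of_exponent_le hq (by linarith)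
      rw [div_le_iff₀ (by positivity)]
      calc 1 - β ≤ 120 * (‖LFunction χ₁ 1‖ * ‖LFunction χ 1‖ * (((q₁ * q : ℕ) : ℝ) ^ δ / δ)) *
            (7800000000 ^ (6 * δ) * ((q₁ * q : ℕ) : ℝ) ^ (12 * δ)) := by
            refine h1.trans ?_
            rw [← h4]
            gcongr
        _ = 120 * ‖LFunction χ₁ 1‖ * ‖LFunction χ 1‖ / δ * 7800000000 ^ (6 * δ) *
              (((q₁ * q : ℕ) : ℝ) ^ δ * ((q₁ * q : ℕ) : ℝ) ^ (12 * δ)) := by ring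
        _ = ‖LFunction χ 1‖ * (q : ℝ) ^ (13 * δ) * K := by rw [h5, hK]; ring
        _ ≤ ‖LFunction χ 1‖ * (q : ℝ) ^ ε * (K + 1) := by gcongr; linarith
  · push Not at hcase
    refine ⟨δ / (120 * 780000 ^ (6 * δ)), by positivity, ?_⟩
    intro q _ χ hp hχ hχ2
    have hq : (1 : ℝ) ≤ q := by exact_mod_cast NeZero.one_le
    have h := hno δ hδ hδ1 hδ2 q χ hχ hχ2 fun x hx hx1 => hcase q _ χ x hp hχ hχ2 hx hx1
    rw [Real.mul_rpow (by norm_num) (by positivity)] at h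
    have h6 : (q : ℝ) ^ (6 * δ) ≤ (q : ℝ) ^ ε :=
      Real.rpow_le_rpow_of_exponent_le hq (by linarith)
    rw [div_le_iff₀ (by positivity)]
    calc δ ≤ 120 * ‖LFunction χ 1‖ * (780000 ^ (6 * δ) * (q : ℝ) ^ (6 * δ)) := h
      _ ≤ 120 * ‖LFunction χ 1‖ * (780000 ^ (6 * δ) * (q : ℝ) ^ ε) := by gcongr
      _ = _ := by ring

open DirichletCharacter in
lemma LFunction_ne_zero_near_one {ε : ℝ} (hε : 0 < ε) (hε1 : ε ≤ 1 / 2) :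
    ∃ c : ℝ, 0 < c ∧ ∀ (q : ℕ) [NeZero q]
    (χ : DirichletCharacter ℂ q), χ.IsPrimitive → χ ≠ 1 → χ ^ 2 = 1 →
    ∀ s : ℂ, ‖s - 1‖ * (q : ℝ) ^ (3 * ε) < c → LFunction χ s ≠ 0 := by
  obtain ⟨c, hc, hsiegel⟩ := siegel hε
  refine ⟨min ε (c * ε ^ 2 / 5), by positivity, fun q _ χ hp hχ hχ2 s hs hz => ?_⟩
  have hq : (1 : ℝ) ≤ q := by exact_mod_cast NeZero.one_le
  have hq3 : 1 ≤ (q : ℝ) ^ (3 * ε) := Real.one_le_rpow hq (by positivity)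
  have hq2 : 1 ≤ (q : ℝ) ^ (2 * ε) := Real.one_le_rpow hq (by positivity)
  have hsε : ‖s - 1‖ < ε := by
    refine lt_of_le_of_lt ?_ (hs.trans_le (min_le_left _ _))
    exact le_mul_of_one_le_right (norm_nonneg _) hq3
  have hbound : ∀ z : ℂ, ‖z - 1‖ < ε → ‖LFunction χ z‖ ≤ 2 * (q : ℝ) ^ (2 * ε) / ε := by
    intro z hz
    have h1 : 1 - ε < z.re := by
      have := (abs_le.mp (Complex.abs_re_le_norm (z - 1))).1
      simp at this
      linarith
    have h2 : ‖z‖ ≤ 2 := by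
      have := norm_add_le (z - 1) 1
      rw [sub_add_cancel, norm_one] at this
      linarith
    refine (norm_LFunction_le hχ (ε := 2 * ε) (by positivity) (by linarith) (by linarith)).trans ?_
    rw [mul_div_assoc]
    have h3 : ε ≤ z.re - (1 - 2 * ε) := by linarith
    exact mul_le_mul h2 (by gcongr) (div_nonneg (by positivity) (by linarith)) (by norm_num)
  have h1b := hbound 1 (by simpa using hε)
  have hmaps : Set.MapsTo (LFunction χ) (Metric.ball 1 ε)
      (Metric.closedBall (LFunction χ 1) (5 * (q : ℝ) ^ (2 * ε) / ε)) := by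
    intro z hz
    rw [mem_ball_iff_norm] at hz
    rw [mem_closedBall_iff_norm]
    have := hbound z hz
    have h3 := norm_sub_le (LFunction χ z) (LFunction χ 1)
    have h4 : 0 < (q : ℝ) ^ (2 * ε) / ε := by positivity
    have e1 : 2 * (q : ℝ) ^ (2 * ε) / ε = 2 * ((q : ℝ) ^ (2 * ε) / ε) := by ring
    have e2 : 5 * (q : ℝ) ^ (2 * ε) / ε = 5 * ((q : ℝ) ^ (2 * ε) / ε) := by ring
    rw [e1] at this h1b
    rw [e2]
    linarith
  have h := Complex.dist_le_div_mul_dist_of_mapsTo_ball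
    (differentiable_LFunction hχ).differentiableOn hmaps (mem_ball_iff_norm.mpr hsε)
  rw [hz, dist_eq_norm, dist_eq_norm, zero_sub, norm_neg] at h
  have h5 := hsiegel q χ hp hχ hχ2
  have h6 : c ≤ 5 * (‖s - 1‖ * (q : ℝ) ^ (3 * ε)) / ε ^ 2 := by
    calc c ≤ ‖LFunction χ 1‖ * (q : ℝ) ^ ε := h5
      _ ≤ 5 * (q : ℝ) ^ (2 * ε) / ε / ε * ‖s - 1‖ * (q : ℝ) ^ ε := by gcongr
      _ = 5 * (‖s - 1‖ * ((q : ℝ) ^ (2 * ε) * (q : ℝ) ^ ε)) / ε ^ 2 := by field_simp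
      _ = _ := by rw [← Real.rpow_add (by positivity)]; ring_nf
  have h7 := hs.trans_le (min_le_right _ _)
  rw [le_div_iff₀ (by positivity)] at h6
  linarith

open DirichletCharacter in
theorem exists_zero_free_of_isPrimitive {A : ℝ} (hA : 0 < A) :
    ∃ κ : ℝ, 0 < κ ∧ κ ≤ 1 ∧ ∃ y₀ : ℝ, 6 ≤ y₀ ∧ ∀ y : ℝ, y₀ ≤ y → (∀ (q : ℕ) [NeZero q]
    (χ : DirichletCharacter ℂ q), χ.IsPrimitive → χ ≠ 1 → (q : ℝ) ≤ y ^ A →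
    ∀ s : ℂ, |s.im| ≤ 3 / 2 * Real.exp y → 1 - κ / y ≤ s.re → LFunction χ s ≠ 0) ∧
    y ^ A ≤ Real.exp y := by
  obtain ⟨κ, hκ, hκ1, y₀, hy₀, hzf⟩ := exists_zero_free
  set ε : ℝ := min (1 / 2) (1 / (6 * A)) with hεdef
  have hε : 0 < ε := by positivity
  have hε1 : ε ≤ 1 / 2 := min_le_left _ _
  have hε2 : 3 * ε * A ≤ 1 / 2 := by
    have : ε ≤ 1 / (6 * A) := min_le_right _ _
    rw [le_div_iff₀ (by positivity)] at this
    linarith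
  clear_value ε
  obtain ⟨c, hc, hnear⟩ := LFunction_ne_zero_near_one hε hε1
  have hev : ∀ᶠ y : ℝ in Filter.atTop, y ^ A ≤ Real.exp y := by
    have := (isLittleO_rpow_exp_atTop A).bound (c := 1) one_pos
    filter_upwards [this, Filter.eventually_ge_atTop 0] with y hy hy0
    rwa [Real.norm_of_nonneg (by positivity), Real.norm_of_nonneg (by positivity), one_mul] at hy
  obtain ⟨y₁, hy₁⟩ := Filter.eventually_atTop.mp hev
  refine ⟨κ, hκ, hκ1, max y₀ (max y₁ (4 / c ^ 2 + 1)), hy₀.trans (le_max_left _ _), fun y hy => ?_⟩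
  have hyy₀ : y₀ ≤ y := (le_max_left _ _).trans hy
  have hyy₁ : y₁ ≤ y := ((le_max_left _ _).trans (le_max_right _ _)).trans hy
  have hyc : 4 / c ^ 2 + 1 ≤ y := ((le_max_right _ _).trans (le_max_right _ _)).trans hy
  have hy6 : 6 ≤ y := hy₀.trans hyy₀
  refine ⟨fun q _ χ hp hχ hq s him hre => ?_, hy₁ y hyy₁⟩
  by_cases hcond : χ ^ 2 ≠ 1 ∨ 1 / y ≤ |s.im|
  · exact hzf y hyy₀ q χ hχ (hq.trans (hy₁ y hyy₁)) s him hre hcond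
  · push Not at hcond
    rcases le_or_gt 1 s.re with h1 | h1
    · rw [← entireL_of_ne_one hχ]
      exact entireL_ne_zero χ h1
    · refine hnear q χ hp hχ hcond.1 s ?_
      have hq1 : (1 : ℝ) ≤ q := by exact_mod_cast NeZero.one_le
      have h2 : ‖s - 1‖ ≤ 2 / y := by
        have h3 := Complex.norm_le_abs_re_add_abs_im (s - 1)
        have h4 : |(s - 1).re| ≤ 1 / y := by
          have : κ / y ≤ 1 / y := by gcongr
          rw [abs_le]; simp; constructor
          · simp at this; linarith
          · have : 0 < y⁻¹ := by positivity
            linarith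
        have h5 : (s - 1).im = s.im := by simp
        rw [h5] at h3
        have e1 : 2 / y = 1 / y + 1 / y := by ring
        rw [e1]
        linarith [hcond.2]
      have h6 : (q : ℝ) ^ (3 * ε) ≤ y ^ (1 / 2 : ℝ) := by
        calc (q : ℝ) ^ (3 * ε) ≤ (y ^ A) ^ (3 * ε) := by gcongr
          _ = y ^ (3 * ε * A) := by rw [← Real.rpow_mul (by linarith)]; ring_nf
          _ ≤ _ := Real.rpow_le_rpow_of_exponent_le (by linarith) hε2
      rw [← Real.sqrt_eq_rpow] at h6
      have hsq : Real.sqrt y * Real.sqrt y = y := Real.mul_self_sqrt (by linarith)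
      have hsp : 0 < Real.sqrt y := Real.sqrt_pos.mpr (by linarith)
      have h7 : 2 / c < Real.sqrt y := by
        apply Real.lt_sqrt_of_sq_lt
        rw [div_pow]; norm_num; linarith
      calc ‖s - 1‖ * (q : ℝ) ^ (3 * ε) ≤ 2 / y * Real.sqrt y := by gcongr
        _ = 2 / Real.sqrt y := by
          rw [div_mul_eq_mul_div, div_eq_div_iff (by linarith) hsp.ne', mul_assoc, hsq]
        _ < c := by
          rw [div_lt_iff₀ hsp]
          rw [div_lt_iff₀ hc] at h7
          linarith

open DirichletCharacter in
lemma exists_logDeriv_bound {A : ℝ} (hA : 0 < A) :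
    ∃ κ : ℝ, 0 < κ ∧ κ ≤ 1 ∧ ∃ y₀ : ℝ, 6 ≤ y₀ ∧ ∀ y : ℝ, y₀ ≤ y →
      ∀ (q : ℕ) [NeZero q] (χ : DirichletCharacter ℂ q), χ.IsPrimitive → χ ≠ 1 →
      (q : ℝ) ≤ y ^ A → ∀ s : ℂ, |s.im| ≤ Real.exp y → 1 - κ / (2 * y) ≤ s.re →
      LFunction χ s ≠ 0 ∧ (s.re ≤ 1 + κ / y →
        ‖deriv (LFunction χ) s / LFunction χ s‖ ≤ 448 / κ * y ^ 2) := by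
  obtain ⟨κ, hκ, hκ1, y₀, hy₀, h⟩ := exists_zero_free_of_isPrimitive hA
  obtain ⟨y₁, hy₁, h₁⟩ := norm_logDeriv_le_of_zero_free κ hκ hκ1
  refine ⟨κ, hκ, hκ1, max y₀ y₁, le_max_of_le_left hy₀, fun y hy q _ χ hp hχ hq s him hre => ?_⟩
  have hy0 : y₀ ≤ y := (le_max_left _ _).trans hy
  have hy1 : y₁ ≤ y := (le_max_right _ _).trans hy
  have hypos : 0 < y := by linarith
  obtain ⟨hzf, hqe⟩ := h y hy0
  have hzf := hzf q χ hp hχ hq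
  constructor
  · refine hzf s (him.trans ?_) (le_trans ?_ hre)
    · have := Real.exp_pos y
      linarith
    · have : κ / (2 * y) ≤ κ / y := by
        gcongr
        linarith
      linarith
  · exact fun hre2 => h₁ y hy1 q χ hχ (hq.trans hqe) hzf s him hre hre2

lemma norm_one_div_mul_add_one_le {s : ℂ} (hs : 1 / 2 ≤ s.re) :
    ‖1 / (s * (s + 1))‖ ≤ 2 * (1 + s.im ^ 2)⁻¹ := by
  rw [norm_div, norm_one, norm_mul, ← div_eq_mul_inv, div_le_div_iff₀ ?_ (by positivity), one_mul]
  · have h1 : ‖s‖ ^ 2 = s.re ^ 2 + s.im ^ 2 := by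
      rw [← Complex.normSq_eq_norm_sq, Complex.normSq_apply]; ring
    have h2 : ‖s + 1‖ ^ 2 = (s.re + 1) ^ 2 + s.im ^ 2 := by
      rw [← Complex.normSq_eq_norm_sq, Complex.normSq_apply]; simp; ring
    apply le_of_sq_le_sq _ (by positivity)
    have : (2 * (‖s‖ * ‖s + 1‖)) ^ 2 = (4 * ‖s‖ ^ 2) * ‖s + 1‖ ^ 2 := by ring
    rw [this, h1, h2, sq (1 + s.im ^ 2)]
    apply mul_le_mul <;> nlinarith [sq_nonneg s.im]
  · apply mul_pos <;> rw [norm_pos_iff] <;> intro h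
    · rw [h] at hs; norm_num at hs
    · have := congrArg Complex.re h
      simp at this
      linarith

open Complex MeasureTheory in
lemma integrable_vertical_kernel {σ : ℝ} (hσ : 1 / 2 ≤ σ) :
    Integrable (fun y : ℝ => 1 / (((σ : ℂ) + y * I) * ((σ : ℂ) + y * I + 1))) := by
  refine Integrable.mono' (integrable_inv_one_add_sq.const_mul 2) ?_ ?_
  · apply Continuous.aestronglyMeasurable
    refine continuous_const.div (by fun_prop) fun y => mul_ne_zero ?_ ?_ <;>
    · intro h
      have := congrArg Complex.re h
      simp at this
      linarith
  · refine Filter.Eventually.of_forall fun y => ?_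
    simpa using norm_one_div_mul_add_one_le (s := (σ : ℂ) + y * I) (by simpa using hσ)

open Complex MeasureTheory in
lemma integral_perron_kernel {σ u : ℝ} (hσ : 1 / 2 ≤ σ) (hu : 0 < u) :
    ∫ y : ℝ, (u : ℂ) ^ (-((σ : ℂ) + y * I)) *
      (1 / (((σ : ℂ) + y * I) * ((σ : ℂ) + y * I + 1))) = 2 * Real.pi * (max (1 - u) 0 : ℝ) := by
  set f : ℝ → ℂ := fun t => (Set.Ioc (0 : ℝ) 1).indicator (fun _ => (1 : ℂ)) t -
    (Set.Ioc (0 : ℝ) 1).indicator (fun t : ℝ => (t : ℂ) ^ (1 : ℂ)) t with hf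
  have hm : ∀ s : ℂ, 0 < s.re → HasMellin f s (1 / (s * (s + 1))) := by
    intro s hs
    have h1 := hasMellin_one_Ioc hs
    have h2 := hasMellin_cpow_Ioc 1 (s := s) (by simp; linarith)
    have h3 := hasMellin_sub h1.1 h2.1
    rw [h1.2, h2.2] at h3
    have hs0 : s ≠ 0 := by rintro rfl; simp at hs
    have hs1 : s + 1 ≠ 0 := by
      intro h
      have := congrArg Complex.re h
      simp at this; linarith
    have h4 : 1 / (s * (s + 1)) = 1 / s - 1 / (s + 1) := by
      field_simp
      ring
    rw [h4]
    exact h3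
  have hre : ∀ y : ℝ, 0 < ((σ : ℂ) + y * I).re := by intro y; simp; linarith
  have hfx : ∀ t : ℝ, 0 < t → f t = (max (1 - t) 0 : ℝ) := by
    intro t ht
    simp only [hf, Set.indicator, Set.mem_Ioc, ht, true_and, cpow_one]
    split_ifs with h
    · rw [max_eq_left (by linarith)]; push_cast; ring
    · rw [max_eq_right (by linarith)]; simp
  have hinv := mellinInv_mellin_eq σ f hu (hm σ (by simp; linarith)).1 (by
      rw [VerticalIntegrable]
      refine (integrable_vertical_kernel hσ).congr (Filter.Eventually.of_forall fun y => ?_)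
      exact ((hm _ (hre y)).2).symm) (by
      have : f =ᶠ[nhds u] fun t => ((max (1 - t) 0 : ℝ) : ℂ) := by
        filter_upwards [lt_mem_nhds hu] with t ht using hfx t ht
      refine ContinuousAt.congr ?_ this.symm
      fun_prop)
  rw [hfx u hu, mellinInv] at hinv
  rw [← hinv, Complex.real_smul]
  have : ∀ y : ℝ, mellin f ((σ : ℂ) + y * I) =
    1 / (((σ : ℂ) + y * I) * ((σ : ℂ) + y * I + 1)) := fun y => (hm _ (hre y)).2
  simp only [this, smul_eq_mul]
  push_cast
  rw [← mul_assoc, mul_one_div_cancel (by simp), one_mul]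

open Complex MeasureTheory DirichletCharacter in
lemma hasSum_perron {q : ℕ} [NeZero q] (χ : DirichletCharacter ℂ q) {x σ : ℝ} (hx : 0 < x)
    (hσ : 1 < σ) :
    HasSum (fun n : ℕ => 2 * Real.pi * (χ n * (ArithmeticFunction.vonMangoldt n : ℂ) *
        (max (1 - n / x) 0 : ℝ)))
      (∫ y : ℝ, (x : ℂ) ^ ((σ : ℂ) + y * I) *
        (-(deriv (LFunction χ) ((σ : ℂ) + y * I) / LFunction χ ((σ : ℂ) + y * I))) *
        (1 / (((σ : ℂ) + y * I) * ((σ : ℂ) + y * I + 1)))) := by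
  set f : ℕ → ℂ := fun n => χ n * (ArithmeticFunction.vonMangoldt n : ℂ) with hf
  set F : ℕ → ℝ → ℂ := fun n y => LSeries.term f ((σ : ℂ) + y * I) n *
    ((x : ℂ) ^ ((σ : ℂ) + y * I) * (1 / (((σ : ℂ) + y * I) * ((σ : ℂ) + y * I + 1)))) with hF
  have hF0 : F 0 = 0 := by
    funext y; simp [hF]
  have hFn : ∀ n : ℕ, n ≠ 0 → F n = fun y : ℝ => f n * ((((n / x : ℝ) : ℝ) : ℂ) ^
      (-((σ : ℂ) + y * I)) * (1 / (((σ : ℂ) + y * I) * ((σ : ℂ) + y * I + 1)))) := by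
    intro n hn
    funext y
    simp only [hF]
    rw [LSeries.term_of_ne_zero hn, ofReal_div, div_cpow_ofReal_nonneg (by positivity) hx.le,
      cpow_neg, cpow_neg, ofReal_natCast]
    have : (n : ℂ) ^ ((σ : ℂ) + y * I) ≠ 0 := by
      rw [Ne, cpow_eq_zero_iff]; simp [hn]
    have : (x : ℂ) ^ ((σ : ℂ) + y * I) ≠ 0 := by
      rw [Ne, cpow_eq_zero_iff]; simp [hx.ne']
    field_simp
  have hb : ∀ n y, ‖F n y‖ ≤ ArithmeticFunction.vonMangoldt n * (n : ℝ) ^ (-σ) * x ^ σ *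
      (2 * (1 + y ^ 2)⁻¹) := by
    intro n y
    simp only [hF]
    rw [norm_mul, norm_mul, norm_cpow_eq_rpow_re_of_pos hx, mul_assoc _ (x ^ σ)]
    have h1 := term_twist_norm_le χ ((σ : ℂ) + y * I) n
    have h2 := norm_one_div_mul_add_one_le (s := (σ : ℂ) + y * I) (by simp; linarith)
    simp only [add_re, ofReal_re, mul_re, I_re, mul_zero, ofReal_im, I_im, mul_one, sub_self,
      add_zero, add_im, mul_im, zero_add] at h1 h2 ⊢
    have h3 : 0 ≤ ArithmeticFunction.vonMangoldt n := ArithmeticFunction.vonMangoldt_nonneg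
    gcongr
  have hint : ∀ n, Integrable (F n) := by
    intro n
    rcases eq_or_ne n 0 with rfl | hn
    · rw [hF0]; exact integrable_zero _ _ _
    refine Integrable.mono' ((integrable_inv_one_add_sq.const_mul 2).const_mul _) ?_
      (Filter.Eventually.of_forall (hb n))
    rw [hFn n hn]
    apply Continuous.aestronglyMeasurable
    have hnx : ((n / x : ℝ) : ℂ) ≠ 0 := by
      rw [ofReal_ne_zero]; positivity
    refine continuous_const.mul (Continuous.mul ?_ (continuous_const.div (by fun_prop)
      fun y => mul_ne_zero ?_ ?_))
    · exact Continuous.const_cpow (by fun_prop) (Or.inl hnx)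
    all_goals
      intro h
      have := congrArg Complex.re h
      simp at this
      linarith
  have hsum : Summable fun n => ∫ y, ‖F n y‖ := by
    refine Summable.of_nonneg_of_le (fun n => integral_nonneg fun y => norm_nonneg _)
      (fun n => integral_mono (hint n).norm ((integrable_inv_one_add_sq.const_mul 2).const_mul _)
        (hb n)) ?_
    simp only [integral_const_mul]
    exact ((summable_vonMangoldt_rpow hσ).mul_right _).mul_right _
  have hmain := hasSum_integral_of_summable_integral_norm hint hsum
  convert hmain using 1
  · rfl
  · funext n
    rcases eq_or_ne n 0 with rfl | hn
    · simp [hF0]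
    · rw [hFn n hn, integral_const_mul, integral_perron_kernel (by linarith) (by positivity)]
      ring
  · congr 1
    funext y
    simp only [hF]
    rw [tsum_mul_right, neg_logDeriv_eq χ (by simpa using hσ), LSeries]
    ring

open Complex MeasureTheory in
lemma norm_integral_vertical_le {G : ℂ → ℂ} {b σ T M₁ M₂ M₃ : ℝ} (hbσ : b ≤ σ) (hT : 0 < T)
    (hM₂ : 0 ≤ M₂)
    (hG : DifferentiableOn ℂ G (Set.uIcc b σ ×ℂ Set.uIcc (-T) T))
    (h₁ : ∀ v : ℝ, ‖G (σ + v * I)‖ ≤ M₁ * (1 + v ^ 2)⁻¹)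
    (h₂ : ∀ v : ℝ, |v| ≤ T → ‖G (b + v * I)‖ ≤ M₂ * (1 + v ^ 2)⁻¹)
    (h₃ : ∀ u : ℝ, b ≤ u → u ≤ σ → ∀ v : ℝ, |v| = T → ‖G (u + v * I)‖ ≤ M₃) :
    ‖∫ v : ℝ, G (σ + v * I)‖ ≤ M₁ * (2 / T) + M₂ * Real.pi + 2 * M₃ * (σ - b) := by
  have hM₁ : 0 ≤ M₁ := by
    have := (norm_nonneg _).trans (h₁ 0)
    simpa using this
  have hM₃ : 0 ≤ M₃ :=
    (norm_nonneg _).trans (h₃ b le_rfl hbσ T (abs_of_pos hT))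
  have hTT : -T ≤ T := by linarith
  by_cases hint : Integrable fun v : ℝ => G (σ + v * I)
  swap
  · rw [integral_undef hint, norm_zero]
    have := Real.pi_pos
    have : 0 ≤ σ - b := by linarith
    positivity
  have hgi := integrable_inv_one_add_sq.const_mul M₁
  have harc : Real.pi - (Real.arctan T - Real.arctan (-T)) ≤ 2 / T := by
    have h1 := Real.arctan_inv_of_pos hT
    have h2 : Real.arctan T⁻¹ ≤ T⁻¹ := by
      have := Real.le_tan (Real.arctan_nonneg.mpr (inv_nonneg.mpr hT.le))
        (Real.arctan_lt_pi_div_two _)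
      rwa [Real.tan_arctan] at this
    rw [Real.arctan_neg, div_eq_mul_inv]
    linarith
  have htail : ‖(∫ v : ℝ, G (σ + v * I)) - ∫ v in (-T)..T, G (σ + v * I)‖ ≤ M₁ * (2 / T) := by
    rw [intervalIntegral.integral_of_le hTT, ← integral_add_compl (measurableSet_Ioc) hint,
      add_sub_cancel_left]
    refine (norm_integral_le_of_norm_le (hgi.integrableOn)
      (Filter.Eventually.of_forall h₁)).trans ?_
    have h5 := integral_add_compl (measurableSet_Ioc (a := -T) (b := T)) hgi
    have h7 : ∫ x : ℝ, M₁ * (1 + x ^ 2)⁻¹ = M₁ * Real.pi := by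
      rw [integral_const_mul, integral_univ_inv_one_add_sq]
    rw [h7, ← intervalIntegral.integral_of_le hTT, intervalIntegral.integral_const_mul,
      integral_inv_one_add_sq] at h5
    have h6 := mul_le_mul_of_nonneg_left harc hM₁
    linarith
  have hrect := integral_boundary_rect_eq_zero_of_differentiableOn G (b + (-T : ℝ) * I)
    (σ + T * I) (by simpa using hG)
  simp only [add_re, ofReal_re, mul_re, I_re, mul_zero, ofReal_im, I_im, mul_one, sub_self,
      add_zero, add_im, mul_im, zero_add] at hrect
  have hhor : ∀ v : ℝ, |v| = T → ‖∫ u in b..σ, G (u + v * I)‖ ≤ M₃ * (σ - b) := by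
    intro v hv
    have := intervalIntegral.norm_integral_le_of_norm_le_const (a := b) (b := σ) (C := M₃)
      (f := fun u : ℝ => G (u + v * I)) (by
        intro u hu
        rw [Set.uIoc_of_le hbσ] at hu
        exact h₃ u hu.1.le hu.2 v hv)
    rwa [abs_of_nonneg (by linarith)] at this
  have hleft : ‖∫ v in (-T)..T, G (b + v * I)‖ ≤ M₂ * Real.pi := by
    have hi : IntervalIntegrable (fun v : ℝ => M₂ * (1 + v ^ 2)⁻¹) volume (-T) T :=
      (integrable_inv_one_add_sq.const_mul M₂).intervalIntegrable
    refine (intervalIntegral.norm_integral_le_of_norm_le hTT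
      (Filter.Eventually.of_forall fun v hv => ?_) hi).trans ?_
    · exact h₂ v (abs_le.mpr ⟨hv.1.le, hv.2⟩)
    · rw [intervalIntegral.integral_const_mul, integral_inv_one_add_sq, Real.arctan_neg]
      have := Real.arctan_lt_pi_div_two T
      gcongr
      linarith
  have hb1 := hhor (-T) (by rw [abs_neg, abs_of_pos hT])
  have hb2 := hhor T (abs_of_pos hT)
  have hmid : ‖∫ v in (-T)..T, G (σ + v * I)‖ ≤ M₂ * Real.pi + 2 * M₃ * (σ - b) := by
    have : I • (∫ v in (-T)..T, G (σ + v * I)) = I • (∫ v in (-T)..T, G (b + v * I)) +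
        ((∫ u in b..σ, G (u + T * I)) - ∫ u in b..σ, G (u + (-T : ℝ) * I)) := by
      rw [← sub_eq_zero, ← hrect]; ring
    have h7 : ‖I • (∫ v in (-T)..T, G (σ + v * I))‖ = ‖∫ v in (-T)..T, G (σ + v * I)‖ := by
      rw [norm_smul, norm_I, one_mul]
    rw [← h7, this]
    refine (norm_add_le _ _).trans ?_
    have h8 := norm_sub_le (∫ u in b..σ, G (u + T * I)) (∫ u in b..σ, G (u + (-T : ℝ) * I))
    rw [norm_smul, norm_I, one_mul]
    linarith
  have := norm_sub_norm_le (∫ v : ℝ, G (σ + v * I)) (∫ v in (-T)..T, G (σ + v * I))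
  linarith

set_option maxHeartbeats 800000 in
open Complex DirichletCharacter in
lemma exists_norm_smooth_psi_le {A : ℝ} (hA : 0 < A) :
    ∃ K : ℝ, 0 < K ∧ ∃ y₀ : ℝ, 6 ≤ y₀ ∧ ∀ y : ℝ, y₀ ≤ y →
      ∀ (q : ℕ) [NeZero q] (χ : DirichletCharacter ℂ q), χ.IsPrimitive → χ ≠ 1 →
      (q : ℝ) ≤ y ^ A →
      ‖∑' n : ℕ, χ n * (ArithmeticFunction.vonMangoldt n : ℂ) *
        (max (1 - n / Real.exp (y ^ 3)) 0 : ℝ)‖ ≤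
        K * y ^ 3 * Real.exp (-y) * Real.exp (y ^ 3) := by
  obtain ⟨κ, hκ, hκ1, y₀, hy₀, hL⟩ := exists_logDeriv_bound hA
  obtain ⟨B, hB, hζ⟩ := exists_zeta_bounds
  refine ⟨(4 * Real.exp 1 * (1 + B) + 448 / κ * 2 * Real.pi + 2 * (Real.exp 1 * (448 / κ) * 2)),
    by positivity, max y₀ (2 / κ), le_max_of_le_left hy₀, fun y hy q _ χ hp hχ hq => ?_⟩
  have hy0 : y₀ ≤ y := (le_max_left _ _).trans hy
  have hyκ : 2 / κ ≤ y := (le_max_right _ _).trans hy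
  have hy6 : 6 ≤ y := hy₀.trans hy0
  have hypos : 0 < y := by linarith
  have hL := hL y hy0 q χ hp hχ hq
  set x := Real.exp (y ^ 3) with hx
  set σ := 1 + 1 / y ^ 3 with hσ
  set b := 1 - κ / (2 * y) with hb
  have hx0 : 0 < x := Real.exp_pos _
  have hx1 : 1 ≤ x := Real.one_le_exp (by positivity)
  have hy3 : 1 ≤ y ^ 3 := one_le_pow₀ (by linarith)
  have hσ1 : 1 < σ := by rw [hσ]; have : 0 < 1 / y ^ 3 := by positivity
                         linarith
  have hσ2 : σ ≤ 2 := by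
    have : 1 / y ^ 3 ≤ 1 := (div_le_one (by positivity)).mpr hy3
    rw [hσ]; linarith
  have hσκ : σ ≤ 1 + κ / y := by
    rw [hσ, add_le_add_iff_left, div_le_div_iff₀ (by positivity) hypos]
    rw [div_le_iff₀ hκ] at hyκ
    nlinarith [sq_nonneg y, mul_le_mul_of_nonneg_right hyκ (sq_nonneg y)]
  have hbhalf : 1 / 2 ≤ b := by
    have : κ / (2 * y) ≤ 1 / 2 := by
      rw [div_le_div_iff₀ (by positivity) (by norm_num)]; nlinarith
    rw [hb]; linarith
  have hbσ : b ≤ σ := by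
    have : 0 ≤ κ / (2 * y) := by positivity
    rw [hb]; linarith
  have hσb : σ - b ≤ 1 := by
    have h1 : κ / (2 * y) ≤ 1 / 2 := by
      rw [div_le_div_iff₀ (by positivity) (by norm_num)]; nlinarith
    have h2 : 1 / y ^ 3 ≤ 1 / 2 := by
      apply one_div_le_one_div_of_le (by norm_num)
      nlinarith [sq_nonneg y, pow_le_pow_left₀ (by norm_num) hy6 3]
    rw [hb, hσ]; linarith
  have hxσ : x ^ σ = Real.exp 1 * x := by
    rw [hx, ← Real.exp_mul, ← Real.exp_add, hσ]
    congr 1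
    field_simp
    ring
  have hxb : x ^ b ≤ Real.exp (-y) * x := by
    rw [hx, ← Real.exp_mul, ← Real.exp_add, Real.exp_le_exp, hb]
    have : y ^ 3 * (1 - κ / (2 * y)) = y ^ 3 - κ * y ^ 2 / 2 := by
      field_simp
    rw [this]
    rw [div_le_iff₀ hκ] at hyκ
    nlinarith [mul_le_mul_of_nonneg_right hyκ hypos.le]
  have hxu : ∀ u, u ≤ σ → x ^ u ≤ Real.exp 1 * x := fun u hu => by
    rw [← hxσ]; exact Real.rpow_le_rpow_of_exponent_le hx1 hu
  clear_value σ b x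
  set T := Real.exp y with hT
  have hT0 : 0 < T := Real.exp_pos _
  have hTinv : 1 / T = Real.exp (-y) := by rw [hT, Real.exp_neg, one_div]
  have hTinv1 : 1 / T ≤ 1 := by rw [hTinv, Real.exp_le_one_iff]; linarith
  set G : ℂ → ℂ := fun s => (x : ℂ) ^ s * (-(deriv (LFunction χ) s / LFunction χ s)) *
    (1 / (s * (s + 1))) with hG
  have hGn : ∀ s : ℂ, 1 / 2 ≤ s.re → ∀ M, ‖deriv (LFunction χ) s / LFunction χ s‖ ≤ M →
      ‖G s‖ ≤ x ^ s.re * M * (2 * (1 + s.im ^ 2)⁻¹) := by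
    intro s hs M hM
    simp only [hG]
    rw [norm_mul, norm_mul, norm_neg, norm_cpow_eq_rpow_re_of_pos hx0]
    have := norm_one_div_mul_add_one_le hs
    have hM0 := (norm_nonneg _).trans hM
    gcongr
  have hsum := (hasSum_perron χ hx0 hσ1).tsum_eq
  rw [tsum_mul_left] at hsum
  have hdiff : Differentiable ℂ (LFunction χ) := differentiable_LFunction hχ
  have hmain := norm_integral_vertical_le (G := G) (b := b) (σ := σ) (T := T)
    (M₁ := 2 * (Real.exp 1 * x * (y ^ 3 + B))) (M₂ := 2 * (Real.exp (-y) * x * (448 / κ * y ^ 2)))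
    (M₃ := Real.exp 1 * x * (448 / κ * y ^ 2) * (2 * (1 / T))) hbσ hT0 (by positivity) ?_ ?_ ?_ ?_
  · have h2pi : ‖(2 * Real.pi : ℂ)‖ = 2 * Real.pi := by
      rw [norm_mul, Complex.norm_real, Real.norm_of_nonneg Real.pi_pos.le]; norm_num
    rw [← hsum, norm_mul, h2pi] at hmain
    have h1 : (1 : ℝ) ≤ 2 * Real.pi := by linarith [Real.pi_gt_three]
    refine (le_mul_of_one_le_left (norm_nonneg _) h1).trans (hmain.trans ?_)
    have e2 : 2 / T = 2 * Real.exp (-y) := by rw [← hTinv]; ring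
    rw [hTinv, e2]
    have hE := Real.exp_pos (-y)
    have hEx : 0 < Real.exp (-y) * x := by positivity
    have hy2 : y ^ 2 ≤ y ^ 3 := by nlinarith [sq_nonneg y]
    have hyB : y ^ 3 + B ≤ (1 + B) * y ^ 3 := by nlinarith
    have i1 : 2 * (Real.exp 1 * x * (y ^ 3 + B)) * (2 * Real.exp (-y)) ≤
        4 * Real.exp 1 * (1 + B) * y ^ 3 * (Real.exp (-y) * x) := by
      have := mul_le_mul_of_nonneg_left hyB
        (by positivity : 0 ≤ 4 * Real.exp 1 * (Real.exp (-y) * x))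
      linarith
    have i2 : 2 * (Real.exp (-y) * x * (448 / κ * y ^ 2)) * Real.pi ≤
        448 / κ * 2 * Real.pi * y ^ 3 * (Real.exp (-y) * x) := by
      have := mul_le_mul_of_nonneg_left hy2
        (by positivity : 0 ≤ 448 / κ * 2 * Real.pi * (Real.exp (-y) * x))
      linarith
    have i3 : 2 * (Real.exp 1 * x * (448 / κ * y ^ 2) * (2 * Real.exp (-y))) * (σ - b) ≤
        2 * (Real.exp 1 * (448 / κ) * 2) * y ^ 3 * (Real.exp (-y) * x) := by
      have h3 := mul_le_mul_of_nonneg_left hy2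
        (by positivity : 0 ≤ 2 * (Real.exp 1 * (448 / κ) * 2) * (Real.exp (-y) * x))
      have h4 := mul_le_mul_of_nonneg_left hσb
        (by positivity : 0 ≤ 2 * (Real.exp 1 * x * (448 / κ * y ^ 2) * (2 * Real.exp (-y))))
      linarith
    linarith
  · intro s hs
    rw [mem_reProdIm, Set.uIcc_of_le hbσ, Set.uIcc_of_le (by linarith)] at hs
    have hne := (hL s (abs_le.mpr hs.2) hs.1.1).1
    have hs0 : s ≠ 0 := by
      rintro rfl
      have := hs.1.1
      simp at this; linarith
    have hs1 : s + 1 ≠ 0 := by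
      intro h
      have := congrArg Complex.re h
      have := hs.1.1
      simp at *; linarith
    have hd' : DifferentiableAt ℂ (deriv (LFunction χ)) s :=
      (hdiff.differentiableOn.deriv isOpen_univ).differentiableAt Filter.univ_mem
    apply DifferentiableAt.differentiableWithinAt
    refine DifferentiableAt.mul (DifferentiableAt.mul ?_ ((hd'.div (hdiff s) hne).neg))
      (DifferentiableAt.div (by fun_prop) (by fun_prop) (mul_ne_zero hs0 hs1))
    exact DifferentiableAt.const_cpow (by fun_prop) (Or.inl (by exact_mod_cast hx0.ne'))
  · intro v
    have h1 := norm_logDeriv_le_tsum χ (s := (σ : ℂ) + v * I) (by simpa using hσ1)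
    have h2 := hGn ((σ : ℂ) + v * I) (by simp; linarith) (y ^ 3 + B) (h1.trans (by
      have := (hζ σ hσ1 hσ2).2
      simp only [add_re, ofReal_re, mul_re, I_re, mul_zero, ofReal_im, I_im, mul_one, sub_self,
        add_zero]
      refine this.trans (le_of_eq ?_)
      rw [hσ]; simp))
    refine h2.trans (le_of_eq ?_)
    simp [hxσ]
    ring
  · intro v hv
    have h1 := (hL ((b : ℂ) + v * I) (by simpa using hv) (by simp)).2
      (by simp; linarith)
    have h2 := hGn ((b : ℂ) + v * I) (by simpa using hbhalf) _ h1
    refine h2.trans ?_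
    simp only [add_re, ofReal_re, mul_re, I_re, mul_zero, ofReal_im, I_im, mul_one, sub_self,
      add_zero, add_im, mul_im, zero_add]
    have := mul_le_mul_of_nonneg_right hxb
      (by positivity : 0 ≤ (448 / κ * y ^ 2) * (2 * (1 + v ^ 2)⁻¹))
    linarith
  · intro u hbu huσ v hv
    have h1 := (hL ((u : ℂ) + v * I) (by simpa using hv.le) (by simpa using hbu)).2
      (by simp; linarith)
    have h2 := hGn ((u : ℂ) + v * I) (by simp; linarith) _ h1
    refine h2.trans ?_
    simp only [add_re, ofReal_re, mul_re, I_re, mul_zero, ofReal_im, I_im, mul_one, sub_self,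
      add_zero, add_im, mul_im, zero_add]
    have h3 : (1 + v ^ 2)⁻¹ ≤ 1 / T := by
      rw [← sq_abs, hv, ← one_div]
      apply one_div_le_one_div_of_le hT0
      nlinarith
    exact mul_le_mul (mul_le_mul_of_nonneg_right (hxu u huσ) (by positivity))
      (mul_le_mul_of_nonneg_left h3 zero_le_two) (by positivity) (by positivity)

lemma tsum_mul_max_eq_sum (a : ℕ → ℂ) {x : ℝ} (hx : 0 < x) {N : ℕ} (hN : ⌊x⌋₊ ≤ N) :
    x * ∑' n : ℕ, a n * (max (1 - n / x) 0 : ℝ) =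
      ∑ n ∈ Icc 0 N, a n * (max (x - n) 0 : ℝ) := by
  rw [tsum_eq_sum (s := Icc 0 N), mul_sum]
  · refine sum_congr rfl fun n _ => ?_
    have : x * max (1 - n / x) 0 = max (x - n) 0 := by
      rw [mul_max_of_nonneg _ _ hx.le, mul_zero, mul_sub, mul_one, mul_div_cancel₀ _ hx.ne']
    rw [← this]
    push_cast
    ring
  · intro n hn
    have h1 : ⌊x⌋₊ < n := by
      simp at hn; omega
    have h2 : x ≤ n := ((Nat.floor_lt hx.le).mp h1).le
    rw [max_eq_right, Complex.ofReal_zero, mul_zero]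
    rw [sub_nonpos, one_le_div hx]
    exact h2

lemma norm_sum_le_of_smooth (a : ℕ → ℂ) {x h M L : ℝ} (hx : 0 < x) (hh : 0 < h)
    (hL : ∀ n : ℕ, (n : ℝ) ≤ x + h → ‖a n‖ ≤ L)
    (h₁ : ‖∑' n : ℕ, a n * (max (1 - n / x) 0 : ℝ)‖ ≤ M)
    (h₂ : ‖∑' n : ℕ, a n * (max (1 - n / (x + h)) 0 : ℝ)‖ ≤ M) :
    ‖∑ n ∈ Icc 0 ⌊x⌋₊, a n‖ ≤ M * (2 * x + h) / h + (h + 1) * L := by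
  have hL0 : 0 ≤ L := (norm_nonneg _).trans (hL 0 (by simp; positivity))
  have hle : ⌊x⌋₊ ≤ ⌊x + h⌋₊ := Nat.floor_mono (by linarith)
  have e₁ := tsum_mul_max_eq_sum a hx hle
  have e₂ := tsum_mul_max_eq_sum a (by positivity : 0 < x + h) le_rfl
  have hsplit : ∀ f : ℕ → ℂ, ∑ n ∈ Icc 0 ⌊x + h⌋₊, f n =
      ∑ n ∈ Icc 0 ⌊x⌋₊, f n + ∑ n ∈ Ioc ⌊x⌋₊ ⌊x + h⌋₊, f n := by
    intro f
    rw [← sum_union]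
    · congr 1
      ext n; simp; omega
    · rw [disjoint_left]
      intro n; simp; omega
  have hkey : (h : ℂ) * ∑ n ∈ Icc 0 ⌊x⌋₊, a n =
      ((x + h : ℝ) : ℂ) * (∑' n : ℕ, a n * (max (1 - n / (x + h)) 0 : ℝ)) -
      x * (∑' n : ℕ, a n * (max (1 - n / x) 0 : ℝ)) -
      ∑ n ∈ Ioc ⌊x⌋₊ ⌊x + h⌋₊, a n * (max (x + h - n) 0 : ℝ) := by
    rw [e₁, e₂, hsplit, hsplit (fun n => a n * (max (x - n) 0 : ℝ))]
    have hz : ∑ n ∈ Ioc ⌊x⌋₊ ⌊x + h⌋₊, a n * (max (x - n) 0 : ℝ) = 0 := by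
      refine sum_eq_zero fun n hn => ?_
      rw [mem_Ioc, Nat.floor_lt hx.le] at hn
      rw [max_eq_right (by linarith), Complex.ofReal_zero, mul_zero]
    have hd : (h : ℂ) * ∑ n ∈ Icc 0 ⌊x⌋₊, a n = ∑ n ∈ Icc 0 ⌊x⌋₊, a n * (max (x + h - n) 0 : ℝ) -
        ∑ n ∈ Icc 0 ⌊x⌋₊, a n * (max (x - n) 0 : ℝ) := by
      rw [← sum_sub_distrib, mul_sum]
      refine sum_congr rfl fun n hn => ?_
      rw [mem_Icc, Nat.le_floor_iff hx.le] at hn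
      rw [max_eq_left (by linarith), max_eq_left (by linarith)]
      push_cast
      ring
    rw [hd, hz]
    ring
  have hlast : ‖∑ n ∈ Ioc ⌊x⌋₊ ⌊x + h⌋₊, a n * (max (x + h - n) 0 : ℝ)‖ ≤ (h + 1) * (L * h) := by
    refine (norm_sum_le_of_le _ (f := fun n => a n * ((max (x + h - n) 0 : ℝ) : ℂ))
      (n := fun _ => L * h) fun n hn => ?_).trans ?_
    · rw [mem_Ioc, Nat.floor_lt hx.le, Nat.le_floor_iff (by positivity)] at hn
      rw [norm_mul, Complex.norm_real, Real.norm_of_nonneg (le_max_right _ _)]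
      exact mul_le_mul (hL n hn.2) (max_le (by linarith) hh.le) (le_max_right _ _) hL0
    · rw [sum_const, nsmul_eq_mul, Nat.card_Ioc, Nat.cast_sub hle]
      have h1 := Nat.floor_le (by positivity : 0 ≤ x + h)
      have h2 := Nat.lt_floor_add_one x
      exact mul_le_mul_of_nonneg_right (by linarith) (by positivity)
  have hn := congrArg norm hkey
  rw [norm_mul, Complex.norm_real, Real.norm_of_nonneg hh.le] at hn
  have hb := (hn.le.trans (norm_sub_le _ _)).trans (add_le_add_left (norm_sub_le _ _) _)
  rw [norm_mul, norm_mul, Complex.norm_real, Complex.norm_real, Real.norm_of_nonneg hx.le,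
    Real.norm_of_nonneg (by positivity)] at hb
  have h3 := mul_le_mul_of_nonneg_left h₁ hx.le
  have h4 := mul_le_mul_of_nonneg_left h₂ (by positivity : 0 ≤ x + h)
  have h5 : M * (2 * x + h) / h + (h + 1) * L = (M * (2 * x + h) + (h + 1) * (L * h)) / h := by
    field_simp
  rw [h5, le_div_iff₀ hh]
  linarith

open DirichletCharacter in
lemma exists_norm_psi_le {A : ℝ} (hA : 0 < A) :
    ∃ K : ℝ, 0 < K ∧ ∃ y₀ : ℝ, 6 ≤ y₀ ∧ ∀ y : ℝ, y₀ ≤ y →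
      ∀ (q : ℕ) [NeZero q] (χ : DirichletCharacter ℂ q), χ.IsPrimitive → χ ≠ 1 →
      (q : ℝ) ≤ y ^ A →
      ‖∑ n ∈ Icc 0 ⌊Real.exp (y ^ 3)⌋₊, χ n * (ArithmeticFunction.vonMangoldt n : ℂ)‖ ≤
        K * y ^ 3 * Real.exp (-y / 2) * Real.exp (y ^ 3) := by
  obtain ⟨K, hK, y₀, hy₀, h⟩ := exists_norm_smooth_psi_le hA
  refine ⟨12 * K + 4, by positivity, y₀, hy₀, fun y hy q _ χ hp hχ hq => ?_⟩
  have hy6 : 6 ≤ y := hy₀.trans hy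
  have hypos : 0 < y := by linarith
  set δ := Real.exp (-y / 2) with hδ
  have hδ0 : 0 < δ := Real.exp_pos _
  have hδ1 : δ ≤ 1 := by rw [hδ, Real.exp_le_one_iff]; linarith
  have hy3 : 1 ≤ y ^ 3 := one_le_pow₀ (by linarith)
  set z : ℝ := (y ^ 3 + Real.log (1 + δ)) ^ ((1 : ℝ) / 3) with hz
  have hlog0 : 0 ≤ Real.log (1 + δ) := Real.log_nonneg (by linarith)
  have hlog1 : Real.log (1 + δ) ≤ 1 := by
    have := Real.log_le_sub_one_of_pos (by linarith : 0 < 1 + δ)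
    linarith
  have hz3 : z ^ 3 = y ^ 3 + Real.log (1 + δ) := by
    rw [hz, ← Real.rpow_natCast, ← Real.rpow_mul (by positivity)]
    norm_num
  have hz0 : 0 ≤ z := by positivity
  have hyz : y ≤ z := by
    apply le_of_pow_le_pow_left₀ (n := 3) (by norm_num) hz0
    rw [hz3]; linarith
  have hx1 : Real.exp (z ^ 3) = Real.exp (y ^ 3) + Real.exp (y ^ 3) * δ := by
    rw [hz3, Real.exp_add, Real.exp_log (by linarith)]; ring
  have h1 := h y hy q χ hp hχ hq
  have h2 := h z (hy.trans hyz) q χ hp hχ (hq.trans (Real.rpow_le_rpow hypos.le hyz hA.le))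
  set x := Real.exp (y ^ 3) with hx
  have hx0 : 0 < x := Real.exp_pos _
  have hδ2 : Real.exp (-y) = δ * δ := by rw [hδ, ← Real.exp_add]; congr 1; ring
  have hM2 : K * z ^ 3 * Real.exp (-z) * Real.exp (z ^ 3) ≤
      4 * K * y ^ 3 * (δ * δ) * x := by
    have a1 : z ^ 3 ≤ 2 * y ^ 3 := by linarith
    have a2 : Real.exp (-z) ≤ δ * δ := by rw [← hδ2, Real.exp_le_exp]; linarith
    have a3 : Real.exp (z ^ 3) ≤ 2 * x := by rw [hx1]; nlinarith
    calc _ ≤ K * (2 * y ^ 3) * (δ * δ) * (2 * x) := by gcongr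
      _ = _ := by ring
  have hM1 : K * y ^ 3 * Real.exp (-y) * x ≤ 4 * K * y ^ 3 * (δ * δ) * x := by
    rw [hδ2]
    have : 0 ≤ K * y ^ 3 * (δ * δ) * x := by positivity
    linarith
  have hxδ : 1 ≤ x * δ := by
    rw [hx, hδ, ← Real.exp_add]
    apply Real.one_le_exp
    nlinarith [sq_nonneg y]
  have hlogx : Real.log (2 * x) ≤ 2 * y ^ 3 := by
    rw [Real.log_mul (by norm_num) hx0.ne', hx, Real.log_exp]
    have := Real.log_two_lt_d9
    linarith
  rw [hx1] at h2 hM2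
  have hmain := norm_sum_le_of_smooth
    (fun n => χ n * (ArithmeticFunction.vonMangoldt n : ℂ)) (x := x) (h := x * δ)
    (M := 4 * K * y ^ 3 * (δ * δ) * x) (L := 2 * y ^ 3) hx0 (by positivity) (by
      intro n hn
      rw [norm_mul, Complex.norm_real, Real.norm_of_nonneg ArithmeticFunction.vonMangoldt_nonneg]
      refine (mul_le_of_le_one_left ArithmeticFunction.vonMangoldt_nonneg
        (norm_le_one χ _)).trans ?_
      refine ArithmeticFunction.vonMangoldt_le_log.trans (le_trans ?_ hlogx)
      rcases Nat.eq_zero_or_pos n with rfl | hn0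
      · simp only [Nat.cast_zero, Real.log_zero]
        exact Real.log_nonneg (by nlinarith)
      · exact Real.log_le_log (by exact_mod_cast hn0) (by nlinarith)) (h1.trans hM1) (h2.trans hM2)
  refine hmain.trans ?_
  have e1 : 4 * K * y ^ 3 * (δ * δ) * x * (2 * x + x * δ) / (x * δ) =
      4 * K * y ^ 3 * δ * x * (2 + δ) := by
    field_simp
  rw [e1]
  have i1 := mul_le_mul_of_nonneg_left (by linarith : 2 + δ ≤ 3)
    (by positivity : 0 ≤ 4 * K * y ^ 3 * δ * x)
  have i2 := mul_le_mul_of_nonneg_right (by linarith : x * δ + 1 ≤ 2 * (x * δ))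
    (by positivity : 0 ≤ 2 * y ^ 3)
  have : 0 ≤ K * y ^ 3 * δ * x := by positivity
  linarith

lemma norm_e (x : ℝ) : ‖e x‖ = 1 := by
  rw [e, Complex.norm_exp]
  simp

lemma hasDerivAt_e_rpow (t : ℝ) {c u : ℝ} (hu : 0 < u) :
    HasDerivAt (fun u : ℝ => e (t * u ^ c))
      (e (t * u ^ c) * (2 * Real.pi * Complex.I * ((t * (c * u ^ (c - 1)) : ℝ) : ℂ))) u := by
  have h1 : HasDerivAt (fun u : ℝ => t * u ^ c) (t * (c * u ^ (c - 1))) u :=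
    (Real.hasDerivAt_rpow_const (Or.inl hu.ne')).const_mul t
  exact ((h1.ofReal_comp).const_mul (2 * Real.pi * Complex.I)).cexp

open MeasureTheory in
lemma norm_sum_mul_e_le (a : ℕ → ℂ) {c t x X B V : ℝ} (hx : 0 < x) (hxX : x ≤ X) (hc : 1 ≤ c)
    (ht : |t| ≤ X ^ (-c) * V)
    (ha : ∀ u, x ≤ u → u ≤ X → ‖∑ n ∈ Icc 0 ⌊u⌋₊, a n‖ ≤ B) :
    ‖∑ n ∈ Ioc ⌊x⌋₊ ⌊X⌋₊, a n * e (t * (n : ℝ) ^ c)‖ ≤ B * (2 + 2 * Real.pi * c * V) := by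
  have hX : 0 < X := hx.trans_le hxX
  have hB : 0 ≤ B := (norm_nonneg _).trans (ha X hxX le_rfl)
  have hd : ∀ u ∈ Set.Icc x X, HasDerivAt (fun u : ℝ => e (t * u ^ c))
      (e (t * u ^ c) * (2 * Real.pi * Complex.I * ((t * (c * u ^ (c - 1)) : ℝ) : ℂ))) u :=
    fun u hu => hasDerivAt_e_rpow t (hx.trans_le hu.1)
  have hdn : ∀ u ∈ Set.Icc x X, ‖deriv (fun u : ℝ => e (t * u ^ c)) u‖ ≤
      2 * Real.pi * c * V / X := by
    intro u hu
    have hu0 : 0 < u := hx.trans_le hu.1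
    rw [(hd u hu).deriv, norm_mul, norm_e, one_mul, norm_mul, norm_mul, norm_mul, Complex.norm_I,
      Complex.norm_real, Complex.norm_real, Real.norm_of_nonneg Real.pi_pos.le, Real.norm_eq_abs,
      abs_mul, abs_of_nonneg (by positivity : 0 ≤ c * u ^ (c - 1))]
    have h1 : u ^ (c - 1) ≤ X ^ (c - 1) := Real.rpow_le_rpow hu0.le hu.2 (by linarith)
    have h2 : |t| * (c * u ^ (c - 1)) ≤ X ^ (-c) * V * (c * X ^ (c - 1)) :=
      mul_le_mul ht (by gcongr) (by positivity) ((abs_nonneg t).trans ht)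
    have h3 : X ^ (-c) * X ^ (c - 1) = X⁻¹ := by
      rw [← Real.rpow_add hX, ← Real.rpow_neg_one]; congr 1; ring
    have h4 : X ^ (-c) * V * (c * X ^ (c - 1)) = c * V * X⁻¹ := by rw [← h3]; ring
    rw [h4] at h2
    have := mul_le_mul_of_nonneg_left h2 (by positivity : 0 ≤ 2 * Real.pi)
    simp only [Complex.norm_ofNat, mul_one]
    rw [div_eq_mul_inv]
    linarith
  have hint : IntegrableOn (deriv fun u : ℝ => e (t * u ^ c)) (Set.Icc x X) := by
    have hcont : ContinuousOn (fun u : ℝ => e (t * u ^ c) *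
        (2 * Real.pi * Complex.I * ((t * (c * u ^ (c - 1)) : ℝ) : ℂ))) (Set.Icc x X) := by
      intro u hu
      have hu0 : u ≠ 0 := (hx.trans_le hu.1).ne'
      have h1 := (hd u hu).continuousAt
      have h2 : ContinuousAt (fun u : ℝ => u ^ (c - 1)) u :=
        Real.continuousAt_rpow_const _ _ (Or.inl hu0)
      refine ContinuousAt.continuousWithinAt (h1.mul (continuousAt_const.mul ?_))
      exact Complex.continuous_ofReal.continuousAt.comp
        (continuousAt_const.mul (continuousAt_const.mul h2))
    refine (hcont.integrableOn_compact isCompact_Icc).congr_fun (fun u hu => ?_) measurableSet_Icc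
    exact (hd u hu).deriv.symm
  have habel := sum_mul_eq_sub_sub_integral_mul a hx.le hxX
    (fun u hu => (hd u hu).differentiableAt) hint
  have hI : ‖∫ u in Set.Ioc x X, deriv (fun u : ℝ => e (t * u ^ c)) u * ∑ k ∈ Icc 0 ⌊u⌋₊, a k‖ ≤
      2 * Real.pi * c * V / X * B * (X - x) := by
    rw [← intervalIntegral.integral_of_le hxX]
    have := intervalIntegral.norm_integral_le_of_norm_le_const (a := x) (b := X)
      (C := 2 * Real.pi * c * V / X * B)
      (f := fun u => deriv (fun u : ℝ => e (t * u ^ c)) u * ∑ k ∈ Icc 0 ⌊u⌋₊, a k) (by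
        intro u hu
        rw [Set.uIoc_of_le hxX] at hu
        rw [norm_mul]
        have h0 := hdn u ⟨hu.1.le, hu.2⟩
        exact mul_le_mul h0 (ha u hu.1.le hu.2) (norm_nonneg _) ((norm_nonneg _).trans h0))
    rwa [abs_of_nonneg (by linarith)] at this
  have hV : 0 ≤ 2 * Real.pi * c * V / X * B :=
    mul_nonneg ((norm_nonneg _).trans (hdn X ⟨hxX, le_rfl⟩)) hB
  have hI2 : 2 * Real.pi * c * V / X * B * (X - x) ≤ 2 * Real.pi * c * V * B := by
    have : 2 * Real.pi * c * V / X * B * X = 2 * Real.pi * c * V * B := by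
      field_simp
    rw [← this]
    exact mul_le_mul_of_nonneg_left (by linarith) hV
  simp_rw [mul_comm (a _)]
  rw [habel]
  refine (norm_sub_le _ _).trans ((add_le_add (norm_sub_le _ _) hI).trans ?_)
  rw [norm_mul, norm_mul, norm_e, norm_e, one_mul, one_mul]
  have b1 := ha X hxX le_rfl
  have b2 := ha x le_rfl hxX
  linarith

open Filter in
lemma exists_rpow_mul_exp_le (E : ℝ) : ∃ L₀ : ℝ, ∀ l : ℝ, L₀ ≤ l →
    l ^ E * Real.exp (-(l / 2) ^ ((1 : ℝ) / 3) / 2) ≤ 1 / Real.exp (l ^ ((1 : ℝ) / 4)) := by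
  set k : ℝ := (1 / 2) ^ ((1 : ℝ) / 3) / 4 with hk
  have hk0 : 0 < k := by positivity
  have h1 := tendsto_rpow_mul_exp_neg_mul_atTop_nhds_zero (3 * E) k hk0
  have hv : Tendsto (fun l : ℝ => l ^ ((1 : ℝ) / 3)) atTop atTop :=
    tendsto_rpow_atTop (by norm_num)
  have hw : Tendsto (fun l : ℝ => l ^ ((1 : ℝ) / 12)) atTop atTop :=
    tendsto_rpow_atTop (by norm_num)
  have hev := ((h1.comp hv).eventually_le_const zero_lt_one).and
    ((hw.eventually_ge_atTop (1 / k)).and (eventually_ge_atTop (1 : ℝ)))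
  obtain ⟨L₀, hL₀⟩ := eventually_atTop.mp hev
  refine ⟨L₀, fun l hl => ?_⟩
  obtain ⟨g1, g2, g3⟩ := hL₀ l hl
  have hl0 : 0 < l := by linarith
  simp only [Function.comp] at g1
  set v := l ^ ((1 : ℝ) / 3) with hvdef
  have hv0 : 0 < v := by positivity
  have e1 : v ^ (3 * E) = l ^ E := by
    rw [hvdef, ← Real.rpow_mul hl0.le]; congr 1; ring
  have e2 : (l / 2) ^ ((1 : ℝ) / 3) / 2 = 2 * k * v := by
    rw [div_eq_mul_one_div l 2, Real.mul_rpow hl0.le (by norm_num), hk]; ring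
  have e3 : l ^ ((1 : ℝ) / 4) ≤ k * v := by
    have h5 : l ^ ((1 : ℝ) / 4) * l ^ ((1 : ℝ) / 12) = v := by
      rw [hvdef, ← Real.rpow_add hl0]; norm_num
    rw [← h5]
    rw [div_le_iff₀ hk0] at g2
    have h6 : 0 ≤ l ^ ((1 : ℝ) / 4) := by positivity
    nlinarith [mul_le_mul_of_nonneg_left g2 h6]
  rw [e1] at g1
  rw [neg_div, e2, one_div, ← Real.exp_neg]
  have h7 : Real.exp (-(2 * k * v)) = Real.exp (-k * v) * Real.exp (-(k * v)) := by
    rw [← Real.exp_add]; congr 1; ring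
  rw [h7, ← mul_assoc]
  refine (mul_le_of_le_one_left (Real.exp_pos _).le g1).trans ?_
  rw [Real.exp_le_exp]
  linarith

open DirichletCharacter in
lemma exists_norm_char_sum_le {μ c : ℝ} (C : ℝ) (hμ0 : 0 < μ) (hμ1 : μ < 1) (hc : 1 ≤ c)
    (hC : 0 < C) :
    ∃ K > 0, ∃ L₀ ≥ 1, ∀ X : ℝ, 0 < X → L₀ ≤ Real.log X → ∀ t V : ℝ, |t| ≤ X ^ (-c) * V →
      ∀ (q : ℕ) [NeZero q] (χ : DirichletCharacter ℂ q), χ.IsPrimitive → χ ≠ 1 →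
        (q : ℝ) ≤ Real.log X ^ C →
        ‖∑ n ∈ Ioc ⌊μ * X⌋₊ ⌊X⌋₊, (ArithmeticFunction.vonMangoldt n : ℂ) * χ (n : ZMod q)
          * e (t * (n : ℝ) ^ c)‖ ≤
        K * Real.log X * Real.exp (-(Real.log X / 2) ^ ((1 : ℝ) / 3) / 2) * X *
          (2 + 2 * Real.pi * c * V) := by
  obtain ⟨K, hK, y₀, hy₀, hψ⟩ := exists_norm_psi_le (A := 4 * C) (by positivity)
  refine ⟨K, hK, max 1 (max (2 * y₀ ^ 3) (2 * -Real.log μ)), le_max_left _ _,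
    fun X hX hL t V ht q _ χ hp hχ hq => ?_⟩
  have hl1 : 1 ≤ Real.log X := (le_max_left _ _).trans hL
  have hl2 : 2 * y₀ ^ 3 ≤ Real.log X :=
    ((le_max_left _ _).trans (le_max_right _ _)).trans hL
  have hl3 : 2 * -Real.log μ ≤ Real.log X :=
    ((le_max_right _ _).trans (le_max_right _ _)).trans hL
  set l := Real.log X with hl
  set w := (l / 2) ^ ((1 : ℝ) / 3) with hw
  have hw3 : w ^ 3 = l / 2 := by
    rw [hw, ← Real.rpow_natCast, ← Real.rpow_mul (by positivity)]
    norm_num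
  have hw0 : 0 ≤ w := by positivity
  have hyw : y₀ ≤ w := le_of_pow_le_pow_left₀ (n := 3) (by norm_num) hw0 (by rw [hw3]; linarith)
  have hqw : (q : ℝ) ≤ w ^ (4 * C) := by
    refine hq.trans ?_
    rw [Real.rpow_mul hw0]
    refine Real.rpow_le_rpow (by linarith) ?_ hC.le
    have h1 : w ^ (4 : ℝ) = w * w ^ 3 := by
      rw [show (4 : ℝ) = ((4 : ℕ) : ℝ) by norm_num, Real.rpow_natCast]; ring
    rw [h1, hw3]
    nlinarith
  simp_rw [mul_comm (ArithmeticFunction.vonMangoldt _ : ℂ)]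
  refine norm_sum_mul_e_le _ (by positivity) (by nlinarith) hc ht fun u hu huX => ?_
  have hu0 : 0 < u := (by positivity : 0 < μ * X).trans_le hu
  have hlu1 : l / 2 ≤ Real.log u := by
    have := Real.log_le_log (by positivity) hu
    rw [Real.log_mul hμ0.ne' hX.ne'] at this
    linarith
  have hlu2 : Real.log u ≤ l := Real.log_le_log hu0 huX
  set y := (Real.log u) ^ ((1 : ℝ) / 3) with hy
  have hy3 : y ^ 3 = Real.log u := by
    rw [hy, ← Real.rpow_natCast, ← Real.rpow_mul (by linarith)]
    norm_num
  have hwy : w ≤ y := Real.rpow_le_rpow (by positivity) hlu1 (by norm_num)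
  have h1 := hψ y (hyw.trans hwy) q χ hp hχ
    (hqw.trans (Real.rpow_le_rpow hw0 hwy (by positivity)))
  rw [hy3, Real.exp_log hu0] at h1
  refine h1.trans ?_
  have h2 : Real.exp (-y / 2) ≤ Real.exp (-w / 2) := Real.exp_le_exp.mpr (by linarith)
  gcongr

end SiegelWalfisz

/-- Bound on the average over primitive characters of exponential sums over primes,
for very small frequencies `|t| ≤ X^{-c} (log X)^D`. -/
theorem avg_primitive_char_exponential_sum_small_t (μ c C D : ℝ)
    (hμ0 : 0 < μ) (hμ1 : μ < 1) (hc : 1 < c) (hC : 0 < C) (hD : 2 ≤ D) :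
    ∃ K > 0, ∃ X₀ : ℝ, ∀ X : ℝ, X₀ ≤ X →
      ∀ t : ℝ, |t| ≤ X ^ (-c) * Real.log X ^ D →
        ∑ q ∈ Ioc 1 ⌊Real.log X ^ C⌋₊, (1 / (Nat.totient q : ℝ)) *
            ∑ χ : DirichletCharacter ℂ q,
              (if χ.IsPrimitive then
                ‖∑ n ∈ Ioc ⌊μ * X⌋₊ ⌊X⌋₊,
                    (ArithmeticFunction.vonMangoldt n : ℂ) * χ (n : ZMod q)
                      * e (t * (n : ℝ) ^ c)‖
              else 0)
          ≤ K * (X / Real.exp (Real.log X ^ ((1 : ℝ) / 4))) := by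
  obtain ⟨K, hK, L₀, hL₀, hsum⟩ := SiegelWalfisz.exists_norm_char_sum_le C hμ0 hμ1 hc.le hC
  obtain ⟨L₁, hL₁⟩ := SiegelWalfisz.exists_rpow_mul_exp_le (C + 1 + D)
  refine ⟨K * (2 + 2 * Real.pi * c), by have := Real.pi_pos; positivity,
    Real.exp (max L₀ L₁), fun X hX t ht => ?_⟩
  have hX0 : 0 < X := (Real.exp_pos _).trans_le hX
  have hlog := (Real.le_log_iff_exp_le hX0).mpr hX
  have hl0 := (le_max_left _ _).trans hlog
  have hl1 := (le_max_right _ _).trans hlog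
  have hsum := hsum X hX0 hl0 t _ ht
  have hL₁ := hL₁ _ hl1
  have hl : 1 ≤ Real.log X := le_trans hL₀ hl0
  set l := Real.log X
  set E := Real.exp (-(l / 2) ^ ((1 : ℝ) / 3) / 2)
  have hE : 0 < E := Real.exp_pos _
  have hpi := Real.pi_pos
  have hlD : 1 ≤ l ^ D := Real.one_le_rpow hl (by linarith)
  have hM0 : 0 ≤ K * l * E * X * (2 + 2 * Real.pi * c * l ^ D) := by positivity
  have hq : ∀ q ∈ Ioc 1 ⌊l ^ C⌋₊, (1 / (Nat.totient q : ℝ)) *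
      ∑ χ : DirichletCharacter ℂ q,
        (if χ.IsPrimitive then
          ‖∑ n ∈ Ioc ⌊μ * X⌋₊ ⌊X⌋₊,
              (ArithmeticFunction.vonMangoldt n : ℂ) * χ (n : ZMod q)
                * e (t * (n : ℝ) ^ c)‖
        else 0) ≤ K * l * E * X * (2 + 2 * Real.pi * c * l ^ D) := by
    intro q hq
    rw [mem_Ioc, Nat.le_floor_iff (by positivity)] at hq
    have : NeZero q := ⟨by omega⟩
    have htot : (0 : ℝ) < Nat.totient q := by
      exact_mod_cast Nat.totient_pos.mpr (by omega)
    rw [one_div, inv_mul_le_iff₀ htot]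
    refine (sum_le_card_nsmul _ _ (K * l * E * X * (2 + 2 * Real.pi * c * l ^ D))
      fun χ _ => ?_).trans ?_
    · split_ifs with hp
      · refine hsum q χ hp ?_ hq.2
        rintro rfl
        have := DirichletCharacter.conductor_one (R := ℂ) (n := q)
        rw [DirichletCharacter.isPrimitive_def] at hp
        omega
      · exact hM0
    · rw [nsmul_eq_mul, card_univ, ← Nat.card_eq_fintype_card,
        DirichletCharacter.card_eq_totient_of_hasEnoughRootsOfUnity]
  refine (sum_le_card_nsmul _ _ _ hq).trans ?_
  rw [nsmul_eq_mul, Nat.card_Ioc]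
  have hcard : ((⌊l ^ C⌋₊ - 1 : ℕ) : ℝ) ≤ l ^ C :=
    le_trans (by exact_mod_cast Nat.sub_le _ _) (Nat.floor_le (by positivity))
  have hfac : 2 + 2 * Real.pi * c * l ^ D ≤ (2 + 2 * Real.pi * c) * l ^ D := by linarith
  calc ((⌊l ^ C⌋₊ - 1 : ℕ) : ℝ) * (K * l * E * X * (2 + 2 * Real.pi * c * l ^ D))
      ≤ l ^ C * (K * l * E * X * ((2 + 2 * Real.pi * c) * l ^ D)) := by gcongr
    _ = K * (2 + 2 * Real.pi * c) * (X * (l ^ (C + 1 + D) * E)) := by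
        rw [Real.rpow_add (by linarith), Real.rpow_add (by linarith), Real.rpow_one]; ring
    _ ≤ K * (2 + 2 * Real.pi * c) * (X * (1 / Real.exp (l ^ ((1 : ℝ) / 4)))) := by gcongr
    _ = _ := by rw [mul_one_div]
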